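/- arXiv:2102.04730 — 6 statements merged into one kernel-verified Lean document; each statement's English description precedes it below -/
import Mathlib

section
/- Let B ≥ 2 be an integer, E > 0, σ² > 0 and μ > 0. For every ε > 0 there exist ω₀ < ∞, Λ₀ < ∞ and ρ₀ > 0 such that for all integers ω > ω₀ and Λ > Λ₀ with Λ ≥ 2ω − 1 and all 0 ≤ ρ < ρ₀, the following holds. Let W be the (ω, Λ, ρ) base matrix, let μ_inner = (R/C)μ with R = Λ + ω − 1, C = Λ, and let τ_c^{SC-FP} (c ∈ [C]) be the limits of the spatially coupled state evolution with base matrix W. Then max_{c ∈ [C]} τ_c^{SC-FP} ≤ σ² + ϑμ · (max 𝓜(ϑμ, σ²) + ε), where ϑ = 1 + (ω − 1)/Λ and 𝓜(μ', σ²) denotes the (nonempty) set of minimizers over ψ ∈ [0, E] of the potential function F(μ', σ², ψ). -/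
open MeasureTheory ProbabilityTheory Real Filter

noncomputable section

/-- The law of `B` i.i.d. standard Gaussians. -/
def gaussPi (B : ℕ) : Measure (Fin B → ℝ) := Measure.pi fun _ => gaussianReal 0 1

/-- `mmse(1/τ)` for the prior `p₁`. -/
def mmseFn (B : ℕ) [NeZero B] (E τ : ℝ) : ℝ :=
  E * (1 - ∫ z, exp (sqrt (E / τ) * z 0) /
      (exp (sqrt (E / τ) * z 0) +
        exp (-(E / τ)) * ∑ j ∈ Finset.univ.erase (0 : Fin B), exp (sqrt (E / τ) * z j))
    ∂ gaussPi B)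

/-- The mutual information `I(X; X + √τ Z)` for `X ~ p₁`. -/
def miFn (B : ℕ) [NeZero B] (E τ : ℝ) : ℝ :=
  E / τ + Real.log B - ∫ z, Real.log (exp (E / τ + sqrt (E / τ) * z 0) +
      ∑ j ∈ Finset.univ.erase (0 : Fin B), exp (sqrt (E / τ) * z j)) ∂ gaussPi B

/-- The potential function `F(μ, σ², ψ) = I(τ) + (1/(2μ))[ln(τ/σ²) − μψ/τ]`, `τ = σ² + μψ`. -/
def potF (B : ℕ) [NeZero B] (E μ σ2 ψ : ℝ) : ℝ :=
  miFn B E (σ2 + μ * ψ) +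
    1 / (2 * μ) * (Real.log ((σ2 + μ * ψ) / σ2) - μ * ψ / (σ2 + μ * ψ))

/-- The set `𝓜(μ, σ²)` of minimizers of the potential function over `ψ ∈ [0, E]`. -/
def minSet (B : ℕ) [NeZero B] (E μ σ2 : ℝ) : Set ℝ :=
  {ψ | ψ ∈ Set.Icc 0 E ∧ ∀ ψ' ∈ Set.Icc (0 : ℝ) E, potF B E μ σ2 ψ ≤ potF B E μ σ2 ψ'}

/-- The `(ω, Λ, ρ)` base matrix, with `R = Λ + ω − 1` rows and `C = Λ` columns
(indices `0`-based): the band-diagonal entries equal `(1−ρ)/ω` and all others `ρ/(Λ−1)`. -/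
def baseW (ω Λ : ℕ) (ρ : ℝ) : Fin (Λ + ω - 1) → Fin Λ → ℝ :=
  fun r c => if c.val ≤ r.val ∧ r.val < c.val + ω then (1 - ρ) / ω else ρ / ((Λ : ℝ) - 1)

/-- The spatially coupled state evolution sequence `ψ_c^t`. -/
def scψ (B : ℕ) [NeZero B] (R C : ℕ) (E σ2 μin : ℝ) (W : Fin R → Fin C → ℝ) :
    ℕ → Fin C → ℝ
  | 0 => fun _ => E
  | t + 1 => fun c =>
      mmseFn B E ((∑ r : Fin R, W r c /
        (σ2 + μin * ∑ c' : Fin C, W r c' * scψ B R C E σ2 μin W t c'))⁻¹)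

/-- Spatially coupled state evolution: `γ_r^t = Σ_c W_{rc} ψ_c^t`. -/
def scγ (B : ℕ) [NeZero B] (R C : ℕ) (E σ2 μin : ℝ) (W : Fin R → Fin C → ℝ)
    (t : ℕ) (r : Fin R) : ℝ :=
  ∑ c : Fin C, W r c * scψ B R C E σ2 μin W t c

/-- Spatially coupled state evolution: `φ_r^t = σ² + μ_inner γ_r^t`. -/
def scφ (B : ℕ) [NeZero B] (R C : ℕ) (E σ2 μin : ℝ) (W : Fin R → Fin C → ℝ)
    (t : ℕ) (r : Fin R) : ℝ :=
  σ2 + μin * scγ B R C E σ2 μin W t r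

/-- Spatially coupled state evolution: `τ_c^t = [Σ_r W_{rc}/φ_r^t]⁻¹`. -/
def scτ (B : ℕ) [NeZero B] (R C : ℕ) (E σ2 μin : ℝ) (W : Fin R → Fin C → ℝ)
    (t : ℕ) (c : Fin C) : ℝ :=
  (∑ r : Fin R, W r c / scφ B R C E σ2 μin W t r)⁻¹

open scoped NNReal ENNReal

def nu (B : ℕ) (a : ℝ≥0) : Measure (Fin B → ℝ) := Measure.pi fun _ => gaussianReal 0 a

instance nu_prob (B : ℕ) (a : ℝ≥0) : IsProbabilityMeasure (nu B a) := by
  unfold nu; infer_instance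

lemma nu_conv (B : ℕ) (a d : ℝ≥0) : (nu B a).conv (nu B d) = nu B (a + d) := by
  classical
  apply Measure.ext_of_charFunDual
  ext L
  rw [charFunDual_conv]
  unfold nu
  rw [charFunDual_pi, charFunDual_pi, charFunDual_pi, ← Finset.prod_mul_distrib]
  refine Finset.prod_congr rfl fun i _ => ?_
  rw [← charFunDual_conv, gaussianReal_conv_gaussianReal]
  simp

lemma nu_map_smul (B : ℕ) (c : ℝ) (a : ℝ≥0) (hc : c ^ 2 = a) :
    (gaussPi B).map (fun z => c • z) = nu B a := by
  unfold gaussPi nu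
  have := Measure.pi_map_pi (ι := Fin B) (X := fun _ => ℝ) (Y := fun _ => ℝ)
    (μ := fun _ => gaussianReal 0 1) (f := fun _ x => c * x) (fun i => by fun_prop)
  have h2 : (fun z : Fin B → ℝ => c • z) = (fun x i => c * x i) := by
    ext z i; simp
  rw [h2, this]
  congr 1
  ext1 i
  rw [gaussianReal_map_const_mul]
  congr 1
  · simp
  · ext; simp [hc]

lemma gauss_cm (d : ℝ≥0) (hd : d ≠ 0) :
    gaussianReal d d = (gaussianReal 0 d).withDensity (fun w => ENNReal.ofReal (exp (w - d / 2))) := by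
  rw [gaussianReal_of_var_ne_zero _ hd, gaussianReal_of_var_ne_zero _ hd,
    ← withDensity_mul _ (measurable_gaussianPDF _ _) (by fun_prop)]
  congr 1
  ext1 w
  simp only [gaussianPDF, Pi.mul_apply]
  rw [← ENNReal.ofReal_mul (gaussianPDFReal_nonneg _ _ _)]
  congr 1
  have hd' : (d : ℝ) ≠ 0 := by exact_mod_cast hd
  simp only [gaussianPDFReal]
  rw [mul_assoc _ (rexp _) (rexp _), ← Real.exp_add]
  congr 2
  field_simp
  ring

lemma nu_cm_measure (B : ℕ) (d : ℝ≥0) (hd : d ≠ 0) (j : Fin B) :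
    (nu B d).map (fun w => w + Pi.single j (d : ℝ)) =
      (nu B d).withDensity (fun w => ENNReal.ofReal (exp (w j - d / 2))) := by
  classical
  have hint1 : Integrable (fun w : ℝ => exp (w - d / 2)) (gaussianReal 0 d) := by
    have := (integrable_exp_mul_gaussianReal (μ := 0) (v := d) 1).mul_const (exp (-(d / 2)))
    refine this.congr (ae_of_all _ fun w => ?_)
    simp only [one_mul]; rw [← Real.exp_add]; congr 1
  have hintg : Integrable (fun w : Fin B → ℝ => exp (w j - d / 2)) (nu B d) :=
    (measurePreserving_eval (fun _ : Fin B => gaussianReal 0 d) j).integrable_comp_of_integrable hint1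
  have hfin : IsFiniteMeasure ((nu B d).withDensity (fun w => ENNReal.ofReal (exp (w j - d / 2)))) :=
    isFiniteMeasure_withDensity_ofReal hintg.2
  have hp : IsProbabilityMeasure ((nu B d).map (fun w => w + Pi.single j (d : ℝ))) :=
    Measure.isProbabilityMeasure_map (by fun_prop)
  have hL : (nu B d).map (fun w => w + Pi.single j (d : ℝ)) =
      Measure.pi (fun i => gaussianReal (if i = j then (d : ℝ) else 0) d) := by
    have := Measure.pi_map_pi (ι := Fin B) (X := fun _ => ℝ) (Y := fun _ => ℝ)
      (μ := fun _ => gaussianReal 0 d) (f := fun i x => x + (if i = j then (d : ℝ) else 0))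
      (fun i => by fun_prop)
    have h2 : (fun z : Fin B → ℝ => z + Pi.single j (d : ℝ))
        = (fun x i => x i + (if i = j then (d : ℝ) else 0)) := by
      ext z i; simp [Pi.single_apply]
    unfold nu
    rw [h2, this]
    congr 1
    ext1 i
    rw [gaussianReal_map_add_const]
    simp
  apply Measure.ext_of_charFunDual
  ext L
  rw [hL, charFunDual_pi, charFunDual_apply]
  rw [integral_withDensity_eq_integral_toReal_smul (by fun_prop) (by simp)]
  have e1 : ∀ w : Fin B → ℝ, (ENNReal.ofReal (exp (w j - d / 2))).toReal •
      Complex.exp (↑(L w) * Complex.I) = ∏ i, ((if i = j then (Real.exp (w i - d / 2) : ℂ) else 1) *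
        Complex.exp (((L.comp (.single ℝ (fun _ => ℝ) i)) (w i) : ℝ) * Complex.I)) := by
    intro w
    rw [Finset.prod_mul_distrib, Finset.prod_ite_eq' Finset.univ j]
    rw [ENNReal.toReal_ofReal (exp_pos _).le]
    rw [← L.sum_comp_single, ← Complex.exp_sum]
    simp [Finset.sum_mul]
  simp_rw [e1]
  unfold nu
  rw [integral_fintype_prod_eq_prod (f := fun i (x : ℝ) => ((if i = j then (Real.exp (x - d / 2) : ℂ) else 1) *
        Complex.exp (((L.comp (.single ℝ (fun _ => ℝ) i)) x : ℝ) * Complex.I)))]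
  refine Finset.prod_congr rfl fun i _ => ?_
  rw [charFunDual_apply]
  by_cases hij : i = j
  · simp only [hij, if_true]
    rw [gauss_cm d hd, integral_withDensity_eq_integral_toReal_smul (by fun_prop) (by simp)]
    refine integral_congr_ae (ae_of_all _ fun w => ?_)
    simp [ENNReal.toReal_ofReal (exp_pos _).le]
  · simp [hij]

lemma nu_cm (B : ℕ) (d : ℝ≥0) (hd : d ≠ 0) (j : Fin B) (f : (Fin B → ℝ) → ℝ) (hf : Measurable f) :
    ∫ w, f (w + Pi.single j (d : ℝ)) ∂(nu B d) = ∫ w, exp (w j - d / 2) * f w ∂(nu B d) := by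
  have h := integral_map (μ := nu B d) (φ := fun w => w + Pi.single j (d : ℝ)) (by fun_prop)
    (f := f) hf.aestronglyMeasurable
  rw [← h, nu_cm_measure B d hd j,
    integral_withDensity_eq_integral_toReal_smul (by fun_prop) (by simp)]
  refine integral_congr_ae (ae_of_all _ fun w => ?_)
  simp [ENNReal.toReal_ofReal (exp_pos _).le]

lemma nu_exp_integrable (B : ℕ) (d : ℝ≥0) (c : Fin B → ℝ) :
    Integrable (fun w => exp (∑ k, c k * w k)) (nu B d) := by
  simp_rw [Real.exp_sum]
  exact Integrable.fintype_prod (f := fun k x => exp (c k * x))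
    (fun i => integrable_exp_mul_gaussianReal (c i))

lemma nu_exp (B : ℕ) (d : ℝ≥0) (c : Fin B → ℝ) :
    ∫ w, exp (∑ k, c k * w k) ∂(nu B d) = exp (d * (∑ k, c k ^ 2) / 2) := by
  simp_rw [Real.exp_sum]
  unfold nu
  rw [integral_fintype_prod_eq_prod (f := fun k x => exp (c k * x))]
  have : ∀ k, ∫ x, exp (c k * x) ∂(gaussianReal 0 d) = exp (d * c k ^ 2 / 2) := by
    intro k
    have := congrFun (mgf_id_gaussianReal (μ := 0) (v := d)) (c k)
    simpa [mgf] using this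
  simp_rw [this]
  rw [← Real.exp_sum, Finset.mul_sum, Finset.sum_div]
def ee (B : ℕ) (d : ℝ≥0) (w : Fin B → ℝ) (j : Fin B) : ℝ := exp (w j - d / 2)

lemma ee_pos {B : ℕ} (d : ℝ≥0) (w : Fin B → ℝ) (j : Fin B) : 0 < ee B d w j := exp_pos _

lemma ee_cont {B : ℕ} (d : ℝ≥0) (j : Fin B) : Continuous fun w => ee B d w j := by
  unfold ee; fun_prop

lemma ee_add {B : ℕ} (a d : ℝ≥0) (x w : Fin B → ℝ) (j : Fin B) :
    ee B (a + d) (x + w) j = ee B a x j * ee B d w j := by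
  unfold ee; rw [← Real.exp_add]; congr 1; push_cast; simp; ring

lemma ee_pow_integrable {B : ℕ} (d : ℝ≥0) (j : Fin B) (k : ℕ) :
    Integrable (fun w => ee B d w j ^ k) (nu B d) := by
  have h := (nu_exp_integrable B d (Pi.single j (k : ℝ))).mul_const (exp (-(k * d / 2)))
  refine h.congr (ae_of_all _ fun w => ?_)
  simp only [ee, Pi.single_apply, ite_mul, zero_mul, Finset.sum_ite_eq', Finset.mem_univ, if_true]
  rw [← Real.exp_add, ← Real.exp_nat_mul]; congr 1; ring

lemma ee_pow_integral {B : ℕ} (d : ℝ≥0) (j : Fin B) (k : ℕ) :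
    ∫ w, ee B d w j ^ k ∂(nu B d) = exp (d * ((k : ℝ) ^ 2 - k) / 2) := by
  have h := nu_exp B d (Pi.single j (k : ℝ))
  have e : ∀ w : Fin B → ℝ, ee B d w j ^ k =
      exp (∑ i, (Pi.single j (k : ℝ) : Fin B → ℝ) i * w i) * exp (-(k * d / 2)) := by
    intro w
    simp only [ee, Pi.single_apply, ite_mul, zero_mul, Finset.sum_ite_eq', Finset.mem_univ, if_true]
    rw [← Real.exp_add, ← Real.exp_nat_mul]; congr 1; ring
  simp_rw [e]
  rw [integral_mul_const, h, ← Real.exp_add]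
  congr 1
  simp only [Pi.single_apply, ite_pow, zero_pow (two_ne_zero), Finset.sum_ite_eq', Finset.mem_univ, if_true]
  ring

lemma ee_integrable {B : ℕ} (d : ℝ≥0) (j : Fin B) : Integrable (fun w => ee B d w j) (nu B d) := by
  simpa using ee_pow_integrable d j 1

lemma ee_integral {B : ℕ} (d : ℝ≥0) (j : Fin B) : ∫ w, ee B d w j ∂(nu B d) = 1 := by
  simpa using ee_pow_integral d j 1

lemma ee_mul_integrable {B : ℕ} (d : ℝ≥0) (i j : Fin B) :
    Integrable (fun w => ee B d w i * ee B d w j) (nu B d) := by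
  have h := (nu_exp_integrable B d (Pi.single i 1 + Pi.single j 1)).mul_const (exp (-d))
  refine h.congr (ae_of_all _ fun w => ?_)
  simp only [ee, Pi.add_apply, Pi.single_apply, add_mul, ite_mul, zero_mul, one_mul, Finset.sum_add_distrib,
    Finset.sum_ite_eq', Finset.mem_univ, if_true]
  rw [← Real.exp_add, ← Real.exp_add]; congr 1; ring

lemma ee_mul_integral {B : ℕ} (d : ℝ≥0) (i j : Fin B) :
    ∫ w, ee B d w i * ee B d w j ∂(nu B d) = if i = j then exp d else 1 := by
  split_ifs with hij
  · subst hij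
    have := ee_pow_integral d i 2
    simp_rw [← pow_two]; rw [this]; congr 1; push_cast; ring
  · have h := nu_exp B d (Pi.single i 1 + Pi.single j 1)
    have e : ∀ w : Fin B → ℝ, ee B d w i * ee B d w j =
      exp (∑ k, (Pi.single i 1 + Pi.single j 1 : Fin B → ℝ) k * w k) * exp (-d) := by
      intro w
      simp only [ee, Pi.add_apply, Pi.single_apply, add_mul, ite_mul, zero_mul, one_mul,
        Finset.sum_add_distrib, Finset.sum_ite_eq', Finset.mem_univ, if_true]
      rw [← Real.exp_add, ← Real.exp_add]; congr 1; ring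
    simp_rw [e]
    rw [integral_mul_const, h, ← Real.exp_add]
    have : ∑ k, (Pi.single i 1 + Pi.single j 1 : Fin B → ℝ) k ^ 2 = 2 := by
      have : ∀ k, (Pi.single i 1 + Pi.single j 1 : Fin B → ℝ) k ^ 2 =
          (if k = i then 1 else 0) + (if k = j then 1 else 0) := by
        intro k
        simp only [Pi.add_apply, Pi.single_apply]
        by_cases h1 : k = i
        · subst h1; simp [hij]
        · simp [h1]
      simp_rw [this]
      rw [Finset.sum_add_distrib]
      simp; norm_num
    rw [this]; simp

lemma coord_integrable {B : ℕ} (d : ℝ≥0) (k : Fin B) : Integrable (fun w => w k) (nu B d) := by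
  have h1 : Integrable (fun x : ℝ => x) (gaussianReal 0 d) := by
    have := memLp_id_gaussianReal (μ := 0) (v := d) 1
    exact memLp_one_iff_integrable.1 (by simpa using this : MemLp id 1 (gaussianReal 0 d))
  exact (measurePreserving_eval (fun _ : Fin B => gaussianReal 0 d) k).integrable_comp_of_integrable h1

lemma coord_integral {B : ℕ} (d : ℝ≥0) (k : Fin B) : ∫ w, w k ∂(nu B d) = 0 := by
  have := (measurePreserving_eval (fun _ : Fin B => gaussianReal 0 d) k)
  have h2 := integral_map (μ := nu B d) (φ := fun w => w k) (measurable_pi_apply k).aemeasurable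
    (f := fun x : ℝ => x) (by fun_prop)
  rw [← h2]
  have h3 : Measure.map (fun w : Fin B → ℝ => w k) (nu B d) = gaussianReal 0 d := this.map_eq
  rw [h3, integral_id_gaussianReal]

lemma ee_coord_integrable {B : ℕ} (d : ℝ≥0) (j k : Fin B) :
    Integrable (fun w => ee B d w j * w k) (nu B d) := by
  have h1 := (nu_exp_integrable B d (Pi.single j 1 + Pi.single k 1)).mul_const (exp (-(d / 2)))
  have h2 := (nu_exp_integrable B d (Pi.single j 1 - Pi.single k 1)).mul_const (exp (-(d / 2)))
  refine (h1.add h2).mono' ?_ (ae_of_all _ fun w => ?_)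
  · exact (((ee_cont d j).mul (continuous_apply k))).aestronglyMeasurable
  · simp only [Pi.add_apply, Pi.sub_apply, Pi.single_apply, add_mul, sub_mul, ite_mul, zero_mul, one_mul,
      Finset.sum_add_distrib, Finset.sum_sub_distrib, Finset.sum_ite_eq', Finset.mem_univ, if_true]
    rw [norm_mul, Real.norm_of_nonneg (ee_pos d w j).le]
    have : exp (w j + w k) * exp (-(d / 2)) + exp (w j - w k) * exp (-(d / 2)) =
        ee B d w j * (exp (w k) + exp (-w k)) := by
      unfold ee
      simp only [sub_eq_add_neg, Real.exp_add]; ring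
    rw [this]
    refine mul_le_mul_of_nonneg_left ?_ (ee_pos d w j).le
    rw [Real.norm_eq_abs]
    have h3 := add_one_le_exp (w k)
    have h4 := add_one_le_exp (-w k)
    have h5 := exp_pos (w k)
    have h6 := exp_pos (-w k)
    rw [abs_le]; constructor <;> linarith

lemma ee_coord_integral {B : ℕ} (d : ℝ≥0) (hd : d ≠ 0) (j k : Fin B) :
    ∫ w, ee B d w j * w k ∂(nu B d) = if k = j then (d : ℝ) else 0 := by
  have := nu_cm B d hd j (fun w => w k) (by fun_prop)
  unfold ee
  rw [← this]
  simp only [Pi.add_apply]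
  rw [integral_add (coord_integrable d k) (integrable_const _), coord_integral]
  simp [Pi.single_apply]

lemma conv_integrable {B : ℕ} (a d : ℝ≥0) (f : (Fin B → ℝ) → ℝ) (hf : Integrable f (nu B (a + d))) :
    Integrable (fun x => ∫ w, f (x + w) ∂(nu B d)) (nu B a) := by
  rw [← nu_conv] at hf
  unfold Measure.conv at hf
  rw [integrable_map_measure hf.1 (by fun_prop)] at hf
  exact hf.integral_prod_left

lemma conv_integral {B : ℕ} (a d : ℝ≥0) (f : (Fin B → ℝ) → ℝ) (hf : Integrable f (nu B (a + d))) :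
    ∫ x, f x ∂(nu B (a + d)) = ∫ x, ∫ w, f (x + w) ∂(nu B d) ∂(nu B a) := by
  rw [← nu_conv] at hf ⊢
  exact integral_conv hf
def SS (B : ℕ) (a : ℝ≥0) (x : Fin B → ℝ) : ℝ := ∑ j, ee B a x j

def PhiS (B : ℕ) (a : ℝ≥0) (x : Fin B → ℝ) : ℝ := ∑ j, ee B a x j ^ 2 / SS B a x

def PB (B : ℕ) (a : ℝ≥0) : ℝ := ∫ x, PhiS B a x ∂(nu B a)

def QB (B : ℕ) (a : ℝ≥0) : ℝ := ∫ x, SS B a x * Real.log (SS B a x) ∂(nu B a)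

lemma SS_pos {B : ℕ} [NeZero B] (a : ℝ≥0) (x : Fin B → ℝ) : 0 < SS B a x :=
  Finset.sum_pos (fun j _ => ee_pos a x j) ⟨0, Finset.mem_univ _⟩

lemma SS_cont (B : ℕ) (a : ℝ≥0) : Continuous (SS B a) := by
  unfold SS
  exact continuous_finsetSum _ fun j _ => ee_cont a j

lemma PhiS_cont (B : ℕ) [NeZero B] (a : ℝ≥0) : Continuous (PhiS B a) := by
  unfold PhiS
  exact continuous_finsetSum _ fun j _ => ((ee_cont a j).pow 2).div (SS_cont B a)
    (fun x => (SS_pos a x).ne')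

lemma SS_integrable (B : ℕ) (a : ℝ≥0) : Integrable (SS B a) (nu B a) := by
  unfold SS
  exact integrable_finsetSum _ fun j _ => ee_integrable a j

lemma SS_integral (B : ℕ) (a : ℝ≥0) : ∫ x, SS B a x ∂(nu B a) = B := by
  unfold SS
  rw [integral_finsetSum _ fun j _ => ee_integrable a j]
  simp [ee_integral]

lemma ee_le_SS {B : ℕ} (a : ℝ≥0) (x : Fin B → ℝ) (j : Fin B) : ee B a x j ≤ SS B a x :=
  Finset.single_le_sum (f := fun j => ee B a x j) (fun i _ => (ee_pos a x i).le) (Finset.mem_univ j)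

lemma PhiS_nonneg {B : ℕ} [NeZero B] (a : ℝ≥0) (x : Fin B → ℝ) : 0 ≤ PhiS B a x :=
  Finset.sum_nonneg fun j _ => div_nonneg (sq_nonneg _) (SS_pos a x).le

lemma PhiS_le {B : ℕ} [NeZero B] (a : ℝ≥0) (x : Fin B → ℝ) : PhiS B a x ≤ SS B a x := by
  unfold PhiS
  conv_rhs => unfold SS
  refine Finset.sum_le_sum fun j _ => ?_
  rw [div_le_iff₀ (SS_pos a x), pow_two]
  exact mul_le_mul_of_nonneg_left (ee_le_SS a x j) (ee_pos a x j).le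

lemma PhiS_integrable (B : ℕ) [NeZero B] (a : ℝ≥0) : Integrable (PhiS B a) (nu B a) := by
  refine (SS_integrable B a).mono' (PhiS_cont B a).aestronglyMeasurable (ae_of_all _ fun x => ?_)
  rw [Real.norm_of_nonneg (PhiS_nonneg a x)]
  exact PhiS_le a x

lemma PB_le (B : ℕ) [NeZero B] (a : ℝ≥0) : PB B a ≤ B := by
  rw [← SS_integral B a]
  exact integral_mono (PhiS_integrable B a) (SS_integrable B a) (PhiS_le a)

lemma PB_nonneg (B : ℕ) [NeZero B] (a : ℝ≥0) : 0 ≤ PB B a :=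
  integral_nonneg (PhiS_nonneg a)

lemma SSlog_integrable (B : ℕ) [NeZero B] (a : ℝ≥0) :
    Integrable (fun x => SS B a x * Real.log (SS B a x)) (nu B a) := by
  have h1 : Integrable (fun x => SS B a x ^ 2) (nu B a) := by
    have : ∀ x, SS B a x ^ 2 = ∑ i, ∑ j, ee B a x i * ee B a x j := by
      intro x; rw [pow_two]; unfold SS; rw [Finset.sum_mul_sum]
    simp_rw [this]
    exact integrable_finsetSum _ fun i _ => integrable_finsetSum _ fun j _ => ee_mul_integrable a i j
  refine (h1.add (integrable_const 1)).mono' ?_ (ae_of_all _ fun x => ?_)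
  · exact ((SS_cont B a).measurable.mul (Real.measurable_log.comp (SS_cont B a).measurable)).aestronglyMeasurable
  · have hp := SS_pos a x
    simp only [Pi.add_apply]
    rw [Real.norm_eq_abs, abs_le]
    have h2 := Real.log_le_sub_one_of_pos hp
    have h3 := Real.one_sub_inv_le_log_of_pos hp
    have h4 : SS B a x * (1 - (SS B a x)⁻¹) ≤ SS B a x * Real.log (SS B a x) :=
      mul_le_mul_of_nonneg_left h3 hp.le
    have h5 : SS B a x * (1 - (SS B a x)⁻¹) = SS B a x - 1 := by field_simp
    constructor
    · nlinarith
    · nlinarith [mul_le_mul_of_nonneg_left h2 hp.le]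

lemma SS_add {B : ℕ} (a d : ℝ≥0) (x w : Fin B → ℝ) :
    SS B (a + d) (x + w) = ∑ j, ee B a x j * ee B d w j := by
  unfold SS; simp_rw [ee_add]

lemma SS_add_integrable {B : ℕ} (a d : ℝ≥0) (x : Fin B → ℝ) :
    Integrable (fun w => SS B (a + d) (x + w)) (nu B d) := by
  simp_rw [SS_add]
  exact integrable_finsetSum _ fun j _ => (ee_integrable d j).const_mul _

lemma SS_add_integral {B : ℕ} (a d : ℝ≥0) (x : Fin B → ℝ) :
    ∫ w, SS B (a + d) (x + w) ∂(nu B d) = SS B a x := by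
  simp_rw [SS_add]
  rw [integral_finsetSum _ fun j _ => (ee_integrable d j).const_mul _]
  simp_rw [integral_const_mul, ee_integral, mul_one]
  rfl

/-- lower tangent -/
def tang (B : ℕ) (a d : ℝ≥0) (x w : Fin B → ℝ) : ℝ :=
  ∑ j, (2 * (ee B a x j / SS B a x) * (ee B a x j * ee B d w j)
    - (ee B a x j / SS B a x) ^ 2 * SS B (a + d) (x + w))

lemma tang_integrable {B : ℕ} (a d : ℝ≥0) (x : Fin B → ℝ) :
    Integrable (fun w => tang B a d x w) (nu B d) := by
  unfold tang
  exact integrable_finsetSum _ fun j _ => (((ee_integrable d j).const_mul _).const_mul _).sub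
    ((SS_add_integrable a d x).const_mul _)

lemma tang_integral {B : ℕ} [NeZero B] (a d : ℝ≥0) (x : Fin B → ℝ) :
    ∫ w, tang B a d x w ∂(nu B d) = PhiS B a x := by
  unfold tang
  have hj : ∀ j, Integrable (fun w => 2 * (ee B a x j / SS B a x) * (ee B a x j * ee B d w j)
    - (ee B a x j / SS B a x) ^ 2 * SS B (a + d) (x + w)) (nu B d) := fun j =>
    (((ee_integrable d j).const_mul _).const_mul _).sub ((SS_add_integrable a d x).const_mul _)
  rw [integral_finsetSum _ fun j _ => hj j]
  unfold PhiS
  refine Finset.sum_congr rfl fun j _ => ?_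
  rw [integral_sub (((ee_integrable d j).const_mul _).const_mul _)
    ((SS_add_integrable a d x).const_mul _), integral_const_mul, integral_const_mul, integral_const_mul,
    ee_integral, SS_add_integral]
  have := (SS_pos a x).ne'
  field_simp
  ring

lemma PhiS_sub_tang {B : ℕ} [NeZero B] (a d : ℝ≥0) (x w : Fin B → ℝ) :
    PhiS B (a + d) (x + w) - tang B a d x w =
      ∑ j, SS B (a + d) (x + w) *
        (ee B a x j * ee B d w j / SS B (a + d) (x + w) - ee B a x j / SS B a x) ^ 2 := by
  unfold PhiS tang
  rw [← Finset.sum_sub_distrib]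
  refine Finset.sum_congr rfl fun j _ => ?_
  rw [ee_add]
  have h1 := (SS_pos (a + d) (x + w)).ne'
  have h2 := (SS_pos a x).ne'
  field_simp
  ring

lemma PhiS_add_integrable {B : ℕ} [NeZero B] (a d : ℝ≥0) (x : Fin B → ℝ) :
    Integrable (fun w => PhiS B (a + d) (x + w)) (nu B d) := by
  refine (SS_add_integrable a d x).mono' ?_ (ae_of_all _ fun w => ?_)
  · exact ((PhiS_cont B (a + d)).comp (continuous_const.add continuous_id)).aestronglyMeasurable
  · rw [Real.norm_of_nonneg (PhiS_nonneg _ _)]; exact PhiS_le _ _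

instance nu_openPos (B : ℕ) (d : ℝ≥0) [hd : NeZero d] : (nu B d).IsOpenPosMeasure := by
  unfold nu
  have : (gaussianReal 0 d).IsOpenPosMeasure :=
    (gaussianReal_absolutelyContinuous' 0 hd.out).isOpenPosMeasure
  infer_instance

lemma PhiS_inner_lt {B : ℕ} [NeZero B] (hB : 2 ≤ B) (a d : ℝ≥0) (hd : d ≠ 0) (x : Fin B → ℝ) :
    PhiS B a x < ∫ w, PhiS B (a + d) (x + w) ∂(nu B d) := by
  haveI : NeZero d := ⟨hd⟩
  rw [← sub_pos, ← tang_integral a d x, ← integral_sub (PhiS_add_integrable a d x) (tang_integrable a d x)]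
  simp_rw [PhiS_sub_tang]
  have hcS : Continuous fun w : Fin B → ℝ => SS B (a + d) (x + w) :=
    (SS_cont B (a + d)).comp (continuous_const.add continuous_id)
  have hc : Continuous fun w : Fin B → ℝ => ∑ j, SS B (a + d) (x + w) *
        (ee B a x j * ee B d w j / SS B (a + d) (x + w) - ee B a x j / SS B a x) ^ 2 := by
    refine continuous_finsetSum _ fun j _ => hcS.mul ((((continuous_const.mul (ee_cont d j)).div hcS
      (fun w => (SS_pos _ _).ne')).sub continuous_const).pow 2)
  have hnn : ∀ w : Fin B → ℝ, ∀ j, 0 ≤ SS B (a + d) (x + w) *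
        (ee B a x j * ee B d w j / SS B (a + d) (x + w) - ee B a x j / SS B a x) ^ 2 :=
    fun w j => mul_nonneg (SS_pos _ _).le (sq_nonneg _)
  rw [integral_pos_iff_support_of_nonneg (fun w => Finset.sum_nonneg fun j _ => hnn w j)]
  · refine (hc.isOpen_support).measure_pos _ ⟨Pi.single 0 1, ?_⟩
    rw [Function.mem_support]
    refine (Finset.sum_pos' (fun j _ => hnn _ j) ⟨0, Finset.mem_univ _, ?_⟩).ne'
    refine mul_pos (SS_pos _ _) (sq_pos_of_ne_zero ?_)
    have hne := SS_pos (a + d) (x + Pi.single (0 : Fin B) (1 : ℝ))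
    have hne2 := SS_pos a x
    rw [sub_ne_zero, Ne, div_eq_div_iff hne.ne' hne2.ne', SS_add, SS]
    set w : Fin B → ℝ := Pi.single (0 : Fin B) (1 : ℝ) with hw
    rw [← Finset.add_sum_erase Finset.univ _ (Finset.mem_univ (0 : Fin B)),
      ← Finset.add_sum_erase Finset.univ (fun j => ee B a x j * ee B d w j) (Finset.mem_univ (0 : Fin B))]
    have e1 : ee B d w 0 = exp 1 * exp (-(d / 2)) := by
      rw [← Real.exp_add]; simp [ee, hw]; ring
    have e2 : ∑ j ∈ Finset.univ.erase (0 : Fin B), ee B a x j * ee B d w j =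
        (∑ j ∈ Finset.univ.erase (0 : Fin B), ee B a x j) * exp (-(d / 2)) := by
      rw [Finset.sum_mul]
      refine Finset.sum_congr rfl fun j hj => ?_
      have : j ≠ 0 := (Finset.mem_erase.1 hj).1
      simp [ee, hw, Pi.single_apply, this]
    rw [e2, e1]
    set T := ∑ j ∈ Finset.univ.erase (0 : Fin B), ee B a x j
    have hT : 0 < T := by
      refine Finset.sum_pos (fun j _ => ee_pos a x j) ?_
      rw [← Finset.card_pos, Finset.card_erase_of_mem (Finset.mem_univ _)]
      simp; omega
    have h0 := ee_pos a x 0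
    have hx := Real.exp_pos (-((d : ℝ) / 2))
    have h1 : 1 < exp 1 := by simp
    intro h
    have : ee B a x 0 * T * exp (-(d / 2)) * (exp 1 - 1) = 0 := by linarith
    have h3 : 0 < ee B a x 0 * T * exp (-(d / 2)) * (exp 1 - 1) := by
      have := sub_pos.2 h1
      positivity
    linarith
  · have := (PhiS_add_integrable a d x).sub (tang_integrable a d x)
    refine this.congr (ae_of_all _ fun w => ?_)
    simp only [Pi.sub_apply]
    exact PhiS_sub_tang a d x w

lemma PB_lt {B : ℕ} [NeZero B] (hB : 2 ≤ B) (a d : ℝ≥0) (hd : d ≠ 0) : PB B a < PB B (a + d) := by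
  unfold PB
  rw [conv_integral a d _ (PhiS_integrable B (a + d))]
  have h1 := conv_integrable a d _ (PhiS_integrable B (a + d))
  rw [← sub_pos, ← integral_sub h1 (PhiS_integrable B a)]
  rw [integral_pos_iff_support_of_nonneg (fun x => (sub_pos.2 (PhiS_inner_lt hB a d hd x)).le)
    (h1.sub (PhiS_integrable B a))]
  have : Function.support (fun x => (∫ w, PhiS B (a + d) (x + w) ∂(nu B d)) - PhiS B a x) = Set.univ := by
    ext x; simp only [Function.mem_support, Set.mem_univ, iff_true]
    exact (sub_pos.2 (PhiS_inner_lt hB a d hd x)).ne'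
  rw [this]; simp
def pp (B : ℕ) (a : ℝ≥0) (x : Fin B → ℝ) (j : Fin B) : ℝ := ee B a x j / SS B a x

lemma pp_nonneg {B : ℕ} [NeZero B] (a : ℝ≥0) (x : Fin B → ℝ) (j : Fin B) : 0 ≤ pp B a x j :=
  div_nonneg (ee_pos a x j).le (SS_pos a x).le

lemma pp_sum {B : ℕ} [NeZero B] (a : ℝ≥0) (x : Fin B → ℝ) : ∑ j, pp B a x j = 1 := by
  unfold pp
  rw [← Finset.sum_div]
  exact div_self (SS_pos a x).ne'

lemma ee_eq_pp {B : ℕ} [NeZero B] (a : ℝ≥0) (x : Fin B → ℝ) (j : Fin B) :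
    ee B a x j = SS B a x * pp B a x j := by
  unfold pp; rw [mul_div_cancel₀ _ (SS_pos a x).ne']

lemma PhiS_eq_pp {B : ℕ} [NeZero B] (a : ℝ≥0) (x : Fin B → ℝ) :
    PhiS B a x = SS B a x * ∑ j, pp B a x j ^ 2 := by
  unfold PhiS pp
  rw [Finset.mul_sum]
  refine Finset.sum_congr rfl fun j _ => ?_
  have := (SS_pos a x).ne'
  field_simp

lemma SSlog_add_integrable_ae {B : ℕ} [NeZero B] (a d : ℝ≥0) (x : Fin B → ℝ) :
    Integrable (fun w => SS B (a + d) (x + w) * Real.log (SS B (a + d) (x + w))) (nu B d) := by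
  have h1 : Integrable (fun w => SS B (a + d) (x + w) ^ 2) (nu B d) := by
    have : ∀ w, SS B (a + d) (x + w) ^ 2 =
        ∑ i, ∑ j, (ee B a x i * ee B a x j) * (ee B d w i * ee B d w j) := by
      intro w; rw [pow_two, SS_add, Finset.sum_mul_sum]
      refine Finset.sum_congr rfl fun i _ => Finset.sum_congr rfl fun j _ => by ring
    simp_rw [this]
    exact integrable_finsetSum _ fun i _ => integrable_finsetSum _ fun j _ =>
      (ee_mul_integrable d i j).const_mul _
  have hcS : Continuous fun w : Fin B → ℝ => SS B (a + d) (x + w) :=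
    (SS_cont B (a + d)).comp (continuous_const.add continuous_id)
  refine (h1.add (integrable_const 1)).mono' ?_ (ae_of_all _ fun w => ?_)
  · exact (hcS.measurable.mul (Real.measurable_log.comp hcS.measurable)).aestronglyMeasurable
  · have hp := SS_pos (a + d) (x + w)
    simp only [Pi.add_apply]
    rw [Real.norm_eq_abs, abs_le]
    have h2 := Real.log_le_sub_one_of_pos hp
    have h3 := Real.one_sub_inv_le_log_of_pos hp
    set s := SS B (a + d) (x + w)
    have h4 : s * (1 - s⁻¹) ≤ s * Real.log s :=
      mul_le_mul_of_nonneg_left h3 hp.le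
    have h5 : s * (1 - s⁻¹) = s - 1 := by field_simp
    constructor
    · nlinarith
    · nlinarith [mul_le_mul_of_nonneg_left h2 hp.le]

lemma fenchel_log {s s' G : ℝ} (hs : 0 < s) (hs' : 0 < s') :
    s' * (Real.log s + G) + s' - s * exp G ≤ s' * Real.log s' := by
  have h := Real.log_le_sub_one_of_pos (x := s * exp G / s') (by positivity)
  rw [Real.log_div (by positivity) hs'.ne', Real.log_mul hs.ne' (by positivity), Real.log_exp] at h
  have h2 := mul_le_mul_of_nonneg_left h hs'.le
  have h3 : s' * (s * exp G / s' - 1) = s * exp G - s' := by field_simp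
  nlinarith

lemma inner_forward {B : ℕ} [NeZero B] (a d : ℝ≥0) (hd : d ≠ 0) (x : Fin B → ℝ) :
    SS B a x * Real.log (SS B a x) + d / 2 * PhiS B a x ≤
      ∫ w, SS B (a + d) (x + w) * Real.log (SS B (a + d) (x + w)) ∂(nu B d) := by
  set p := pp B a x with hp
  set c : ℝ := d / 2 * ∑ j, p j ^ 2 with hc
  set L := Real.log (SS B a x) with hL
  have hexpint := nu_exp_integrable B d p
  have hexp := nu_exp B d p
  have hi1 : Integrable (fun w => ∑ k, ∑ j, (ee B a x j * p k) * (ee B d w j * w k)) (nu B d) :=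
    integrable_finsetSum _ fun k _ => integrable_finsetSum _ fun j _ =>
      (ee_coord_integrable d j k).const_mul _
  have hi2 : Integrable (fun w => (L - c + 1) * SS B (a + d) (x + w)) (nu B d) :=
    (SS_add_integrable a d x).const_mul _
  have hi3 : Integrable (fun w => (SS B a x * exp (-c)) * exp (∑ k, p k * w k)) (nu B d) :=
    hexpint.const_mul _
  have key : ∀ w, (∑ k, ∑ j, (ee B a x j * p k) * (ee B d w j * w k)) +
      (L - c + 1) * SS B (a + d) (x + w) - (SS B a x * exp (-c)) * exp (∑ k, p k * w k) ≤
      SS B (a + d) (x + w) * Real.log (SS B (a + d) (x + w)) := by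
    intro w
    have h := fenchel_log (G := ∑ k, p k * w k - c) (SS_pos a x) (SS_pos (a + d) (x + w))
    refine le_trans (le_of_eq ?_) h
    have e1 : ∑ k, ∑ j, (ee B a x j * p k) * (ee B d w j * w k) =
        SS B (a + d) (x + w) * ∑ k, p k * w k := by
      rw [SS_add, Finset.mul_sum]
      refine Finset.sum_congr rfl fun k _ => ?_
      rw [Finset.sum_mul]
      refine Finset.sum_congr rfl fun j _ => by ring
    rw [e1, sub_eq_add_neg (∑ k, p k * w k) c, Real.exp_add]
    ring
  have hm := integral_mono ((hi1.add hi2).sub hi3) (SSlog_add_integrable_ae a d x) key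
  refine le_trans (le_of_eq ?_) hm
  have e0 : ∫ w, ((fun w : Fin B → ℝ => ∑ k, ∑ j, (ee B a x j * p k) * (ee B d w j * w k)) +
      (fun w : Fin B → ℝ => (L - c + 1) * SS B (a + d) (x + w)) -
      (fun w : Fin B → ℝ => (SS B a x * exp (-c)) * exp (∑ k, p k * w k))) w ∂(nu B d) =
      (∫ w, ∑ k, ∑ j, (ee B a x j * p k) * (ee B d w j * w k) ∂(nu B d)) +
      (∫ w, (L - c + 1) * SS B (a + d) (x + w) ∂(nu B d)) -
      ∫ w, (SS B a x * exp (-c)) * exp (∑ k, p k * w k) ∂(nu B d) := by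
    rw [← integral_add hi1 hi2]; exact integral_sub (hi1.add hi2) hi3
  rw [e0, integral_const_mul, integral_const_mul, SS_add_integral, hexp]
  have e1 : ∫ w, ∑ k, ∑ j, (ee B a x j * p k) * (ee B d w j * w k) ∂(nu B d) =
      d * (SS B a x * ∑ j, p j ^ 2) := by
    rw [integral_finsetSum _ fun k _ => integrable_finsetSum _ fun j _ =>
      (ee_coord_integrable d j k).const_mul _, Finset.mul_sum, Finset.mul_sum]
    refine Finset.sum_congr rfl fun k _ => ?_
    rw [integral_finsetSum _ fun j _ => (ee_coord_integrable d j k).const_mul _]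
    simp_rw [integral_const_mul, ee_coord_integral d hd]
    simp only [mul_ite, mul_zero, Finset.sum_ite_eq, Finset.mem_univ, if_true]
    rw [ee_eq_pp]; ring
  rw [e1, PhiS_eq_pp]
  have e2 : exp (-c) * exp (d * (∑ i, p i ^ 2) / 2) = 1 := by
    rw [← Real.exp_add, hc]; simp; ring
  have e3 : SS B a x * exp (-c) * exp (d * (∑ i, p i ^ 2) / 2) = SS B a x := by
    rw [mul_assoc, e2, mul_one]
  rw [e3, hc]; ring

lemma QB_forward {B : ℕ} [NeZero B] (a d : ℝ≥0) (hd : d ≠ 0) :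
    QB B a + d / 2 * PB B a ≤ QB B (a + d) := by
  unfold QB PB
  rw [conv_integral a d _ (SSlog_integrable B (a + d)), ← integral_const_mul,
    ← integral_add (SSlog_integrable B a) ((PhiS_integrable B a).const_mul _)]
  exact integral_mono ((SSlog_integrable B a).add ((PhiS_integrable B a).const_mul _))
    (conv_integrable a d _ (SSlog_integrable B (a + d))) (inner_forward a d hd)
lemma log_le_cubic {v : ℝ} (hv : -1 < v) : Real.log (1 + v) ≤ v - v ^ 2 / 2 + v ^ 3 / 3 := by
  set f : ℝ → ℝ := fun v => v - v ^ 2 / 2 + v ^ 3 / 3 - Real.log (1 + v) with hf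
  have hd : ∀ v, -1 < v → HasDerivAt f (v ^ 3 / (1 + v)) v := by
    intro v hv
    have h1 : (1 + v) ≠ 0 := by linarith
    have := (((hasDerivAt_id v).sub ((hasDerivAt_pow 2 v).div_const 2)).add
      ((hasDerivAt_pow 3 v).div_const 3)).sub (((hasDerivAt_id v).const_add 1).log h1)
    refine this.congr_deriv ?_
    simp only [id]
    push_cast
    field_simp
    ring
  have hf0 : f 0 = 0 := by simp [hf]
  suffices 0 ≤ f v by simp only [hf] at this; linarith
  rw [← hf0]
  rcases le_total 0 v with h | h
  · refine monotoneOn_of_deriv_nonneg (convex_Ici 0)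
      (fun x hx => (hd x (by simp at hx; linarith)).continuousAt.continuousWithinAt)
      (fun x hx => (hd x (by simp at hx; linarith)).differentiableAt.differentiableWithinAt) (fun x hx => ?_)
      (by simp) (by simpa using h) h
    simp at hx
    rw [(hd x (by linarith)).deriv]; positivity
  · refine antitoneOn_of_deriv_nonpos (convex_Icc v 0)
      (fun x hx => (hd x (by linarith [hx.1])).continuousAt.continuousWithinAt)
      (fun x hx => (hd x (by rw [interior_Icc] at hx; linarith [hx.1])).differentiableAt.differentiableWithinAt)
      (fun x hx => ?_)
      (by simpa using h) (by simpa using h) h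
    rw [interior_Icc] at hx
    rw [(hd x (by linarith [hx.1])).deriv]
    have : x ^ 3 ≤ 0 := by nlinarith [hx.2, sq_nonneg x]
    exact div_nonpos_of_nonpos_of_nonneg this (by linarith [hx.1])

lemma ulogu_le {v η : ℝ} (hv : -1 < v) (hη : 0 < η) :
    (1 + v) * Real.log (1 + v) ≤ v + (1 / 2 + η) * v ^ 2 + (1 / 3 + 1 / (144 * η)) * v ^ 4 := by
  have h := mul_le_mul_of_nonneg_left (log_le_cubic hv) (by linarith : 0 ≤ 1 + v)
  have h2 : 0 ≤ (v * Real.sqrt η + v ^ 2 / (12 * Real.sqrt η)) ^ 2 := sq_nonneg _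
  have h3 : Real.sqrt η ^ 2 = η := Real.sq_sqrt hη.le
  have h4 : Real.sqrt η ≠ 0 := (Real.sqrt_pos.2 hη).ne'
  have h5 : (v * Real.sqrt η + v ^ 2 / (12 * Real.sqrt η)) ^ 2 = η * v ^ 2 + v ^ 3 / 6 + 1 / (144 * η) * v ^ 4 := by
    conv_rhs => rw [← h3]
    field_simp
    ring
  nlinarith

lemma c4_le {d : ℝ} (hd : 0 ≤ d) (hd6 : d ≤ 1 / 6) :
    exp (6 * d) - 4 * exp (3 * d) + 6 * exp d - 3 ≤ 42 * d ^ 2 := by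
  have h1 := Real.abs_exp_sub_one_sub_id_le (x := 6 * d) (by rw [abs_of_nonneg (by linarith)]; linarith)
  have h2 := Real.abs_exp_sub_one_sub_id_le (x := d) (by rw [abs_of_nonneg (by linarith)]; linarith)
  have h3 := Real.add_one_le_exp (3 * d)
  have h4 := (abs_le.1 h1).2
  have h5 := (abs_le.1 h2).2
  nlinarith

lemma ee_sub_pow4_integrable {B : ℕ} (d : ℝ≥0) (j : Fin B) :
    Integrable (fun w => (ee B d w j - 1) ^ 4) (nu B d) := by
  have := ((((ee_pow_integrable d j 4).sub ((ee_pow_integrable d j 3).const_mul 4)).add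
    ((ee_pow_integrable d j 2).const_mul 6)).sub ((ee_pow_integrable d j 1).const_mul 4)).add (integrable_const 1)
  refine this.congr (ae_of_all _ fun w => ?_)
  simp only [Pi.add_apply, Pi.sub_apply]
  ring

def II {X : Type*} [MeasurableSpace X] (m : Measure X) (f : X → ℝ) (c : ℝ) : Prop :=
  Integrable f m ∧ ∫ x, f x ∂m = c

lemma II.add {X : Type*} [MeasurableSpace X] {m : Measure X} {f g : X → ℝ} {c c' : ℝ}
    (hf : II m f c) (hg : II m g c') : II m (fun x => f x + g x) (c + c') :=
  ⟨hf.1.add hg.1, by rw [integral_add hf.1 hg.1, hf.2, hg.2]⟩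

lemma II.sub {X : Type*} [MeasurableSpace X] {m : Measure X} {f g : X → ℝ} {c c' : ℝ}
    (hf : II m f c) (hg : II m g c') : II m (fun x => f x - g x) (c - c') :=
  ⟨hf.1.sub hg.1, by rw [integral_sub hf.1 hg.1, hf.2, hg.2]⟩

lemma II.cmul {X : Type*} [MeasurableSpace X] {m : Measure X} {f : X → ℝ} {c : ℝ}
    (hf : II m f c) (k : ℝ) : II m (fun x => k * f x) (k * c) :=
  ⟨hf.1.const_mul k, by rw [integral_const_mul, hf.2]⟩

lemma II.const {X : Type*} [MeasurableSpace X] (m : Measure X) [IsProbabilityMeasure m] (k : ℝ) :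
    II m (fun _ => k) k :=
  ⟨integrable_const k, by simp⟩

lemma ee_sub_pow4 {B : ℕ} (d : ℝ≥0) (j : Fin B) :
    ∫ w, (ee B d w j - 1) ^ 4 ∂(nu B d) = exp (6 * d) - 4 * exp (3 * d) + 6 * exp d - 3 := by
  have e : ∀ w : Fin B → ℝ, (ee B d w j - 1) ^ 4 = ee B d w j ^ 4 - 4 * ee B d w j ^ 3 + 6 * ee B d w j ^ 2
     - 4 * ee B d w j ^ 1 + 1 := fun w => by ring
  simp_rw [e]
  have hk : ∀ k : ℕ, II (nu B d) (fun w => ee B d w j ^ k) (exp (d * ((k : ℝ) ^ 2 - k) / 2)) :=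
    fun k => ⟨ee_pow_integrable d j k, ee_pow_integral d j k⟩
  rw [(((((hk 4).sub ((hk 3).cmul 4)).add ((hk 2).cmul 6)).sub ((hk 1).cmul 4)).add (II.const _ 1)).2]
  have a1 : (d : ℝ) * (((4 : ℕ) : ℝ) ^ 2 - ((4 : ℕ) : ℝ)) / 2 = 6 * d := by push_cast; ring
  have a2 : (d : ℝ) * (((3 : ℕ) : ℝ) ^ 2 - ((3 : ℕ) : ℝ)) / 2 = 3 * d := by push_cast; ring
  have a3 : (d : ℝ) * (((2 : ℕ) : ℝ) ^ 2 - ((2 : ℕ) : ℝ)) / 2 = d := by push_cast; ring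
  have a4 : (d : ℝ) * (((1 : ℕ) : ℝ) ^ 2 - ((1 : ℕ) : ℝ)) / 2 = 0 := by push_cast; ring
  rw [a1, a2, a3, a4, Real.exp_zero]; ring

lemma ee_sub_mul_integrable {B : ℕ} (d : ℝ≥0) (i j : Fin B) :
    Integrable (fun w => (ee B d w i - 1) * (ee B d w j - 1)) (nu B d) := by
  have := (((ee_mul_integrable d i j).sub (ee_integrable d i)).sub (ee_integrable d j)).add (integrable_const 1)
  refine this.congr (ae_of_all _ fun w => ?_)
  simp only [Pi.add_apply, Pi.sub_apply]
  ring

lemma ee_sub_mul {B : ℕ} (d : ℝ≥0) (i j : Fin B) :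
    ∫ w, (ee B d w i - 1) * (ee B d w j - 1) ∂(nu B d) = if i = j then exp d - 1 else 0 := by
  have e : ∀ w : Fin B → ℝ, (ee B d w i - 1) * (ee B d w j - 1) = ee B d w i * ee B d w j - ee B d w i
    - ee B d w j + 1 := fun w => by ring
  simp_rw [e]
  have h1 : II (nu B d) (fun w => ee B d w i * ee B d w j) _ := ⟨ee_mul_integrable d i j, ee_mul_integral d i j⟩
  have h2 : II (nu B d) (fun w => ee B d w i) 1 := ⟨ee_integrable d i, ee_integral d i⟩
  have h3 : II (nu B d) (fun w => ee B d w j) 1 := ⟨ee_integrable d j, ee_integral d j⟩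
  rw [(((h1.sub h2).sub h3).add (II.const _ 1)).2]
  split_ifs <;> ring

lemma inner_upper {B : ℕ} [NeZero B] (a d : ℝ≥0) (hd6 : (d : ℝ) ≤ 1 / 6) (x : Fin B → ℝ) (η : ℝ) (hη : 0 < η) :
    ∫ w, SS B (a + d) (x + w) * Real.log (SS B (a + d) (x + w)) ∂(nu B d) ≤
    SS B a x * Real.log (SS B a x) + (1 / 2 + η) * (exp d - 1) * PhiS B a x +
      (1 / 3 + 1 / (144 * η)) * (42 * d ^ 2) * SS B a x := by
  set p := pp B a x with hp
  set L := Real.log (SS B a x) with hL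
  set K := 1 / 3 + 1 / (144 * η) with hK
  have hK0 : 0 ≤ K := by positivity
  have hS := SS_pos a x
  have hSu : ∀ w, SS B (a + d) (x + w) = SS B a x * (1 + ∑ j, p j * (ee B d w j - 1)) := by
    intro w
    have : 1 + ∑ j, p j * (ee B d w j - 1) = ∑ j, p j * ee B d w j := by
      simp_rw [mul_sub, mul_one, Finset.sum_sub_distrib]
      rw [hp, pp_sum]; ring
    rw [this, SS_add, Finset.mul_sum]
    refine Finset.sum_congr rfl fun j _ => ?_
    rw [ee_eq_pp]; ring
  have hi1 : Integrable (fun w => (L + 1) * SS B (a + d) (x + w)) (nu B d) :=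
    (SS_add_integrable a d x).const_mul _
  have hi2' : ∀ i, Integrable (fun w => ∑ j, (p i * p j) * ((ee B d w i - 1) * (ee B d w j - 1))) (nu B d) :=
    fun i => integrable_finsetSum _ fun j _ => (ee_sub_mul_integrable d i j).const_mul _
  have hi2 : Integrable (fun w => (SS B a x * (1 / 2 + η)) *
      ∑ i, ∑ j, (p i * p j) * ((ee B d w i - 1) * (ee B d w j - 1))) (nu B d) :=
    (integrable_finsetSum _ fun i _ => hi2' i).const_mul _
  have hi3' : Integrable (fun w => ∑ j, p j * (ee B d w j - 1) ^ 4) (nu B d) :=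
    (integrable_finsetSum _ fun j _ => (ee_sub_pow4_integrable d j).const_mul _)
  have hi3 : Integrable (fun w => (SS B a x * K) * ∑ j, p j * (ee B d w j - 1) ^ 4) (nu B d) :=
    hi3'.const_mul _
  have key : ∀ w, SS B (a + d) (x + w) * Real.log (SS B (a + d) (x + w)) ≤
      (L + 1) * SS B (a + d) (x + w) + (SS B a x * (1 / 2 + η)) *
      ∑ i, ∑ j, (p i * p j) * ((ee B d w i - 1) * (ee B d w j - 1)) +
      (SS B a x * K) * ∑ j, p j * (ee B d w j - 1) ^ 4 - SS B a x := by
    intro w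
    have hpos := SS_pos (a + d) (x + w)
    rw [hSu w] at hpos ⊢
    set v := ∑ j, p j * (ee B d w j - 1) with hv
    have hv1 : 0 < 1 + v := pos_of_mul_pos_right hpos hS.le
    have e2 : ∑ i, ∑ j, (p i * p j) * ((ee B d w i - 1) * (ee B d w j - 1)) = v ^ 2 := by
      rw [pow_two, hv, Finset.sum_mul_sum]
      refine Finset.sum_congr rfl fun i _ => Finset.sum_congr rfl fun j _ => by ring
    have e4 : v ^ 4 ≤ ∑ j, p j * (ee B d w j - 1) ^ 4 :=
      Real.pow_arith_mean_le_arith_mean_pow_of_even _ _ _ (fun i _ => pp_nonneg a x i) (pp_sum a x)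
        (by decide)
    rw [e2, Real.log_mul hS.ne' hv1.ne']
    have h := ulogu_le (v := v) (by linarith) hη
    have h' := mul_le_mul_of_nonneg_left h hS.le
    have h'' := mul_le_mul_of_nonneg_left e4 (mul_nonneg hS.le hK0)
    rw [← hK] at h'
    rw [← hL]
    linarith
  have hI1 : II (nu B d) (fun w => (L + 1) * SS B (a + d) (x + w)) ((L + 1) * SS B a x) :=
    ⟨hi1, by rw [integral_const_mul, SS_add_integral]⟩
  have hI := ((hI1.add ⟨hi2, rfl⟩).add ⟨hi3, rfl⟩).sub (II.const (nu B d) (SS B a x))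
  refine le_trans (integral_mono (SSlog_add_integrable_ae a d x) hI.1 key) ?_
  rw [hI.2, integral_const_mul, integral_const_mul,
    integral_finsetSum _ fun i _ => hi2' i]
  have e2 : ∑ i, ∫ w, ∑ j, (p i * p j) * ((ee B d w i - 1) * (ee B d w j - 1)) ∂(nu B d) =
      (exp d - 1) * ∑ j, p j ^ 2 := by
    rw [Finset.mul_sum]
    refine Finset.sum_congr rfl fun i _ => ?_
    rw [integral_finsetSum _ fun j _ => (ee_sub_mul_integrable d i j).const_mul _]
    simp_rw [integral_const_mul, ee_sub_mul]
    simp only [mul_ite, mul_zero, Finset.sum_ite_eq, Finset.mem_univ, if_true]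
    ring
  have e3 : ∫ w, ∑ j, p j * (ee B d w j - 1) ^ 4 ∂(nu B d) ≤ 42 * (d : ℝ) ^ 2 := by
    rw [integral_finsetSum _ fun j _ => (ee_sub_pow4_integrable d j).const_mul _]
    simp_rw [integral_const_mul, ee_sub_pow4]
    rw [← Finset.sum_mul, hp, pp_sum, one_mul]
    exact c4_le d.2 hd6
  rw [e2, PhiS_eq_pp]
  have h3 := mul_le_mul_of_nonneg_left e3 (mul_nonneg hS.le hK0)
  linarith

lemma QB_upper_step {B : ℕ} [NeZero B] (a d : ℝ≥0) (hd6 : (d : ℝ) ≤ 1 / 6) (η : ℝ) (hη : 0 < η) :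
    QB B (a + d) ≤ QB B a + (1 / 2 + η) * (exp d - 1) * PB B a +
      (1 / 3 + 1 / (144 * η)) * (42 * d ^ 2) * B := by
  rw [← SS_integral B a]
  unfold QB PB
  have i1 : II (nu B a) _ _ := ⟨SSlog_integrable B a, rfl⟩
  have i2 : II (nu B a) _ _ := ⟨PhiS_integrable B a, rfl⟩
  have i3 : II (nu B a) _ _ := ⟨SS_integrable B a, rfl⟩
  have hI := (i1.add (i2.cmul ((1 / 2 + η) * (exp d - 1)))).add
    (i3.cmul ((1 / 3 + 1 / (144 * η)) * (42 * (d : ℝ) ^ 2)))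
  rw [conv_integral a d _ (SSlog_integrable B (a + d)), ← hI.2]
  exact integral_mono (conv_integrable a d _ (SSlog_integrable B (a + d))) hI.1
    (fun x => inner_upper a d hd6 x η hη)
lemma PB_mono {B : ℕ} [NeZero B] (hB : 2 ≤ B) (a d : ℝ≥0) : PB B a ≤ PB B (a + d) := by
  by_cases hd : d = 0
  · rw [hd, add_zero]
  · exact (PB_lt hB a d hd).le

lemma QB_upper_step' {B : ℕ} [NeZero B] (a d : ℝ≥0) (hd6 : (d : ℝ) ≤ 1 / 6) (η : ℝ) (hη : 0 < η) :
    QB B (a + d) ≤ QB B a + (1 / 2 + η) * PB B a * d +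
      ((1 / 2 + η) * B + (1 / 3 + 1 / (144 * η)) * 42 * B) * d ^ 2 := by
  refine (QB_upper_step a d hd6 η hη).trans ?_
  have h2 := Real.abs_exp_sub_one_sub_id_le (x := (d : ℝ))
    (by rw [abs_of_nonneg d.coe_nonneg]; linarith)
  have h5 := (abs_le.1 h2).2
  have h6 := PB_le B a
  have h7 := PB_nonneg B a
  have h8 : (1 / 2 + η) * (exp d - 1) * PB B a ≤ (1 / 2 + η) * (d + d ^ 2) * PB B a := by
    gcongr; linarith
  have h9 : (1 / 2 + η) * (d : ℝ) ^ 2 * PB B a ≤ (1 / 2 + η) * d ^ 2 * B := by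
    gcongr
  linarith

lemma QB_backward_aux {B : ℕ} [NeZero B] (hB : 2 ≤ B) (a D : ℝ≥0) (η : ℝ) (hη : 0 < η) :
    QB B (a + D) ≤ QB B a + (1 / 2 + η) * PB B (a + D) * D := by
  set K := ((1 / 2 + η) * B + (1 / 3 + 1 / (144 * η)) * 42 * B) with hK
  have main : ∀ n : ℕ, 0 < n → (D : ℝ) / n ≤ 1 / 6 →
      QB B (a + D) ≤ QB B a + (1 / 2 + η) * PB B (a + D) * D + K * D ^ 2 * (1 / (n : ℝ)) := by
    intro n hn hD
    have hn' : (0 : ℝ) < n := by exact_mod_cast hn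
    have step : ∀ k : ℕ, k ≤ n → QB B (a + k * (D / n)) ≤ QB B a +
        k * ((1 / 2 + η) * PB B (a + D) * (D / n) + K * (D / n) ^ 2) := by
      intro k
      induction k with
      | zero => intro _; simp
      | succ k ih =>
        intro hk
        have h1 := ih (by omega)
        have h2 := QB_upper_step' (B := B) (a + k * (D / n)) (D / n) (by push_cast; exact hD) η hη
        have e : a + ((k + 1 : ℕ) : ℝ≥0) * (D / n) = a + k * (D / n) + D / n := by push_cast; ring
        rw [e]
        have h3 : PB B (a + k * (D / n)) ≤ PB B (a + D) := by
          have hle : a + k * (D / n) ≤ a + D := by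
            gcongr
            rw [mul_div_assoc', div_le_iff₀ (by exact_mod_cast hn), mul_comm]
            gcongr
            exact_mod_cast (by omega : k ≤ n)
          obtain ⟨c, hc⟩ := exists_add_of_le hle
          rw [hc]; exact PB_mono hB _ _
        have h4 : (1 / 2 + η) * PB B (a + k * (D / n)) * (D / n : ℝ) ≤ (1 / 2 + η) * PB B (a + D) * (D / n) := by
          gcongr
        push_cast at h2 ⊢
        rw [← hK] at h2
        linarith
    have := step n le_rfl
    have e : a + (n : ℝ≥0) * (D / n) = a + D := by
      rw [mul_div_cancel₀]; exact_mod_cast hn.ne'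
    rw [e] at this
    refine this.trans (le_of_eq ?_)
    field_simp
    ring
  have ht : Tendsto (fun n : ℕ => QB B a + (1 / 2 + η) * PB B (a + D) * D + K * D ^ 2 * (1 / (n : ℝ))) atTop
      (nhds (QB B a + (1 / 2 + η) * PB B (a + D) * D + K * D ^ 2 * 0)) :=
    tendsto_const_nhds.add (tendsto_const_nhds.mul tendsto_one_div_atTop_nhds_zero_nat)
  rw [mul_zero, add_zero] at ht
  refine ge_of_tendsto ht ?_
  have h6 : Tendsto (fun n : ℕ => (D : ℝ) / n) atTop (nhds 0) := tendsto_const_div_atTop_nhds_zero_nat _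
  filter_upwards [eventually_gt_atTop 0, h6.eventually (eventually_le_nhds (by norm_num : (0 : ℝ) < 1 / 6))]
    with n hn h
  exact main n hn h

lemma QB_backward {B : ℕ} [NeZero B] (hB : 2 ≤ B) (a D : ℝ≥0) :
    QB B (a + D) ≤ QB B a + D / 2 * PB B (a + D) := by
  have hc : Tendsto (fun η : ℝ => QB B a + (1 / 2 + η) * PB B (a + D) * D) (nhdsWithin 0 (Set.Ioi 0))
      (nhds (QB B a + (1 / 2 + 0) * PB B (a + D) * D)) :=
    (Continuous.tendsto (by fun_prop) 0).mono_left nhdsWithin_le_nhds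
  have := ge_of_tendsto hc (by
    filter_upwards [self_mem_nhdsWithin] with η hη
    exact QB_backward_aux hB a D η hη)
  linarith
lemma nu_swap {B : ℕ} [NeZero B] (a : ℝ≥0) (j : Fin B) :
    ∃ T : (Fin B → ℝ) ≃ᵐ (Fin B → ℝ), MeasurePreserving T (nu B a) (nu B a) ∧
      ∀ x i, T x (Equiv.swap 0 j i) = x i := by
  refine ⟨MeasurableEquiv.piCongrLeft (fun _ => ℝ) (Equiv.swap 0 j), ?_, fun x i => ?_⟩
  · exact measurePreserving_piCongrLeft (fun _ : Fin B => gaussianReal 0 a) (Equiv.swap 0 j)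
  · exact Equiv.piCongrLeft_apply_apply (P := fun _ => ℝ) (Equiv.swap 0 j) x i

lemma SS_swap {B : ℕ} [NeZero B] (a : ℝ≥0) (j : Fin B) (x y : Fin B → ℝ)
    (h : ∀ i, y (Equiv.swap 0 j i) = x i) : SS B a y = SS B a x := by
  unfold SS
  rw [← Equiv.sum_comp (Equiv.swap 0 j)]
  refine Finset.sum_congr rfl fun i _ => ?_
  simp [ee, h]

lemma ee_symm {B : ℕ} [NeZero B] (a : ℝ≥0) (F : ℝ → ℝ → ℝ) (j : Fin B) :
    ∫ x, F (ee B a x j) (SS B a x) ∂(nu B a) = ∫ x, F (ee B a x 0) (SS B a x) ∂(nu B a) := by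
  obtain ⟨T, hT, hTx⟩ := nu_swap a j
  rw [← hT.integral_comp' (fun x => F (ee B a x 0) (SS B a x))]
  refine integral_congr_ae (ae_of_all _ fun x => ?_)
  have h1 : ee B a (T x) 0 = ee B a x j := by
    have := hTx x j
    rw [Equiv.swap_apply_right] at this
    simp [ee, this]
  simp only [h1, SS_swap a j x (T x) (hTx x)]

lemma PB_eq {B : ℕ} [NeZero B] (a : ℝ≥0) :
    PB B a = B * ∫ x, ee B a x 0 ^ 2 / SS B a x ∂(nu B a) := by
  have hi : ∀ j, Integrable (fun x => ee B a x j ^ 2 / SS B a x) (nu B a) := by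
    intro j
    refine (PhiS_integrable B a).mono' ?_ (ae_of_all _ fun x => ?_)
    · exact (((ee_cont a j).pow 2).div (SS_cont B a) (fun x => (SS_pos a x).ne')).aestronglyMeasurable
    · have hnn : ∀ j, 0 ≤ ee B a x j ^ 2 / SS B a x := fun j => div_nonneg (sq_nonneg _) (SS_pos a x).le
      rw [Real.norm_of_nonneg (hnn j)]
      exact Finset.single_le_sum (f := fun j => ee B a x j ^ 2 / SS B a x) (fun i _ => hnn i) (Finset.mem_univ j)
  unfold PB PhiS
  rw [integral_finsetSum _ fun j _ => hi j]
  rw [Finset.sum_congr rfl fun j _ => ee_symm a (fun u s => u ^ 2 / s) j]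
  simp

lemma eelog_integrable {B : ℕ} [NeZero B] (a : ℝ≥0) (j : Fin B) :
    Integrable (fun x => ee B a x j * Real.log (SS B a x)) (nu B a) := by
  refine (((SSlog_integrable B a).norm).add (integrable_const 1)).mono' ?_ (ae_of_all _ fun x => ?_)
  · exact ((ee_cont a j).measurable.mul (Real.measurable_log.comp (SS_cont B a).measurable)).aestronglyMeasurable
  · simp only [Pi.add_apply, norm_mul]
    have h1 : ‖ee B a x j‖ ≤ ‖SS B a x‖ := by
      rw [Real.norm_of_nonneg (ee_pos a x j).le, Real.norm_of_nonneg (SS_pos a x).le]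
      exact ee_le_SS a x j
    have := mul_le_mul_of_nonneg_right h1 (norm_nonneg (Real.log (SS B a x)))
    linarith

lemma QB_eq {B : ℕ} [NeZero B] (a : ℝ≥0) :
    QB B a = B * ∫ x, ee B a x 0 * Real.log (SS B a x) ∂(nu B a) := by
  have e : ∀ x, SS B a x * Real.log (SS B a x) = ∑ j, ee B a x j * Real.log (SS B a x) := by
    intro x; rw [← Finset.sum_mul]; rfl
  unfold QB
  simp_rw [e]
  rw [integral_finsetSum _ fun j _ => eelog_integrable a j]
  rw [Finset.sum_congr rfl fun j _ => ee_symm a (fun u s => u * Real.log s) j]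
  simp

lemma shift_ee0 {B : ℕ} [NeZero B] (a : ℝ≥0) (x : Fin B → ℝ) :
    ee B a (x + Pi.single 0 (a : ℝ)) 0 = exp (a / 2) * exp (x 0) := by
  rw [← Real.exp_add]; simp [ee]; ring

lemma shift_SS {B : ℕ} [NeZero B] (a : ℝ≥0) (x : Fin B → ℝ) :
    SS B a (x + Pi.single 0 (a : ℝ)) = exp (a / 2) * (exp (x 0) +
      exp (-a) * ∑ j ∈ Finset.univ.erase (0 : Fin B), exp (x j)) := by
  unfold SS
  rw [← Finset.add_sum_erase Finset.univ _ (Finset.mem_univ (0 : Fin B)), shift_ee0, mul_add, ← mul_assoc,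
    ← Real.exp_add, Finset.mul_sum]
  congr 1
  refine Finset.sum_congr rfl fun j hj => ?_
  have : j ≠ 0 := (Finset.mem_erase.1 hj).1
  rw [← Real.exp_add, ← Real.exp_add]
  simp only [ee, Pi.add_apply, Pi.single_apply, this, if_false]
  congr 1; ring

lemma mmse_rep {B : ℕ} [NeZero B] {E τ : ℝ} (hE : 0 < E) (hτ : 0 < τ) :
    mmseFn B E τ = E * (1 - PB B (E / τ).toNNReal / B) := by
  have ha : 0 < E / τ := div_pos hE hτ
  set a := (E / τ).toNNReal with haa
  have hac : (a : ℝ) = E / τ := Real.coe_toNNReal _ ha.le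
  have ha0 : a ≠ 0 := by rw [haa]; simpa using ha
  have hsq : Real.sqrt (E / τ) ^ 2 = a := by rw [Real.sq_sqrt ha.le, hac]
  have hB0 : (B : ℝ) ≠ 0 := by exact_mod_cast NeZero.ne B
  unfold mmseFn
  rw [PB_eq, mul_div_cancel_left₀ _ hB0, ← hac]
  congr 2
  have hcm := nu_cm B a ha0 0 (fun x => ee B a x 0 / SS B a x)
    (((ee_cont a 0).div (SS_cont B a) (fun x => (SS_pos a x).ne')).measurable)
  have e1 : ∀ x, ee B a x 0 ^ 2 / SS B a x = exp (x 0 - a / 2) * (ee B a x 0 / SS B a x) := by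
    intro x; unfold ee; ring
  simp_rw [e1]
  rw [← hcm, ← nu_map_smul B (Real.sqrt (E / τ)) a hsq, hac, integral_map (by fun_prop)]
  · refine integral_congr_ae (ae_of_all _ fun z => ?_)
    simp only
    rw [← hac, shift_ee0, shift_SS, mul_div_mul_left _ _ (Real.exp_pos _).ne']
    simp
  · refine (Continuous.div ?_ ?_ (fun x => (SS_pos a _).ne')).aestronglyMeasurable
    · exact (ee_cont a 0).comp (by fun_prop)
    · exact (SS_cont B a).comp (by fun_prop)

lemma mi_rep {B : ℕ} [NeZero B] {E τ : ℝ} (hE : 0 < E) (hτ : 0 < τ) :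
    miFn B E τ = E / τ / 2 + Real.log B - QB B (E / τ).toNNReal / B := by
  have ha : 0 < E / τ := div_pos hE hτ
  set a := (E / τ).toNNReal with haa
  have hac : (a : ℝ) = E / τ := Real.coe_toNNReal _ ha.le
  have ha0 : a ≠ 0 := by rw [haa]; simpa using ha
  have hsq : Real.sqrt (E / τ) ^ 2 = a := by rw [Real.sq_sqrt ha.le, hac]
  have hB0 : (B : ℝ) ≠ 0 := by exact_mod_cast NeZero.ne B
  unfold miFn
  rw [QB_eq, mul_div_cancel_left₀ _ hB0, ← hac]
  have hcm := nu_cm B a ha0 0 (fun x => (a / 2 : ℝ) + Real.log (SS B a x))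
    (measurable_const.add (Real.measurable_log.comp (SS_cont B a).measurable))
  have e1 : ∫ w, exp (w 0 - a / 2) * ((a / 2 : ℝ) + Real.log (SS B a w)) ∂(nu B a) =
      a / 2 + ∫ x, ee B a x 0 * Real.log (SS B a x) ∂(nu B a) := by
    have h1 : II (nu B a) (fun x => ee B a x 0) 1 := ⟨ee_integrable a 0, ee_integral a 0⟩
    have h2 : II (nu B a) (fun x => ee B a x 0 * Real.log (SS B a x)) _ := ⟨eelog_integrable a 0, rfl⟩
    have h := ((h1.cmul (a / 2)).add h2).2
    rw [mul_one] at h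
    rw [← h]
    refine integral_congr_ae (ae_of_all _ fun z => ?_)
    simp only [ee]; ring
  rw [e1] at hcm
  suffices hs : ∫ z, Real.log (exp (a + sqrt a * z 0) +
      ∑ j ∈ Finset.univ.erase (0 : Fin B), exp (sqrt a * z j)) ∂ gaussPi B =
      a / 2 + ∫ x, ee B a x 0 * Real.log (SS B a x) ∂(nu B a) by
    rw [hs]; ring
  rw [← hcm, ← nu_map_smul B (Real.sqrt (E / τ)) a hsq, integral_map (by fun_prop)]
  · refine integral_congr_ae (ae_of_all _ fun z => ?_)
    simp only
    rw [shift_SS, ← hac]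
    have hpos : 0 < exp ((√(a : ℝ) • z) 0) + exp (-(a : ℝ)) * ∑ j ∈ Finset.univ.erase (0 : Fin B), exp ((√(a : ℝ) • z) j) := by
      have hnn := Finset.sum_nonneg (s := Finset.univ.erase (0 : Fin B)) (f := fun j => exp ((√(a : ℝ) • z) j))
        (fun j _ => (Real.exp_pos _).le)
      positivity
    have hl : ∀ y : ℝ, 0 < y → (a / 2 : ℝ) + Real.log (exp (a / 2) * y) = Real.log (exp a * y) := by
      intro y hy
      rw [Real.log_mul (Real.exp_pos _).ne' hy.ne', Real.log_mul (Real.exp_pos _).ne' hy.ne', Real.log_exp,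
        Real.log_exp]
      ring
    rw [hl _ hpos]
    congr 1
    rw [mul_add, ← mul_assoc, ← Real.exp_add, ← Real.exp_add, add_neg_cancel, Real.exp_zero, one_mul]
    rfl
  · refine Measurable.aestronglyMeasurable ?_
    refine measurable_const.add (Real.measurable_log.comp ?_)
    exact ((SS_cont B a).comp (by fun_prop)).measurable
structure MIsys (E : ℝ) (m I : ℝ → ℝ) : Prop where
  cont : Continuous m
  nn : ∀ s, 0 < s → 0 ≤ m s
  le : ∀ s, 0 < s → m s ≤ E
  anti : StrictAntiOn m (Set.Ioi 0)
  sg : ∀ s s', 0 < s → 0 < s' → I s' ≤ I s + 1 / 2 * m s * (s' - s)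

lemma mm_cont (B : ℕ) [NeZero B] (E : ℝ) : Continuous fun s => mmseFn B E s⁻¹ := by
  unfold mmseFn
  simp only [div_inv_eq_mul]
  refine continuous_const.mul (continuous_const.sub ?_)
  haveI : IsProbabilityMeasure (gaussPi B) := by unfold gaussPi; infer_instance
  have hpos : ∀ (s : ℝ) (z : Fin B → ℝ), 0 < exp (sqrt (E * s) * z 0) + exp (-(E * s)) *
      ∑ j ∈ Finset.univ.erase (0 : Fin B), exp (sqrt (E * s) * z j) := by
    intro s z
    have hnn := Finset.sum_nonneg (s := Finset.univ.erase (0 : Fin B)) (f := fun j => exp (sqrt (E * s) * z j))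
        (fun j _ => (Real.exp_pos _).le)
    positivity
  refine continuous_of_dominated (bound := fun _ => 1) (fun s => ?_) (fun s => ae_of_all _ fun z => ?_)
    (integrable_const _) (ae_of_all _ fun z => ?_)
  · refine (Continuous.div (by fun_prop) (by fun_prop) (fun z => (hpos s z).ne')).aestronglyMeasurable
  · rw [Real.norm_of_nonneg (div_nonneg (Real.exp_pos _).le (hpos s z).le), div_le_one (hpos s z)]
    have hnn := Finset.sum_nonneg (s := Finset.univ.erase (0 : Fin B)) (f := fun j => exp (sqrt (E * s) * z j))
        (fun j _ => (Real.exp_pos _).le)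
    have := mul_nonneg (Real.exp_pos (-(E * s))).le hnn
    linarith
  · exact Continuous.div (by fun_prop) (by fun_prop) (fun s => (hpos s z).ne')

lemma QB_sg {B : ℕ} [NeZero B] (hB : 2 ≤ B) (a a' : ℝ≥0) :
    QB B a + 1 / 2 * PB B a * ((a' : ℝ) - a) ≤ QB B a' := by
  rcases lt_trichotomy a a' with h | h | h
  · obtain ⟨d, hd⟩ := exists_add_of_le h.le
    have hd0 : d ≠ 0 := by rintro rfl; simp [hd] at h
    have := QB_forward (B := B) a d hd0
    rw [hd]; push_cast; linarith
  · rw [h]; simp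
  · obtain ⟨d, hd⟩ := exists_add_of_le h.le
    have := QB_backward (B := B) hB a' d
    rw [← hd] at this
    have h2 : (a : ℝ) = a' + d := by rw [hd]; push_cast; ring
    rw [h2]; linarith

lemma mi_sys (B : ℕ) [NeZero B] (hB : 2 ≤ B) {E : ℝ} (hE : 0 < E) :
    MIsys E (fun s => mmseFn B E s⁻¹) (fun s => miFn B E s⁻¹) := by
  have hB0 : (0 : ℝ) < B := by exact_mod_cast (by omega : 0 < B)
  refine ⟨mm_cont B E, fun s hs => ?_, fun s hs => ?_, fun s hs s' hs' h => ?_, fun s s' hs hs' => ?_⟩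
  · show 0 ≤ mmseFn B E s⁻¹
    rw [mmse_rep hE (inv_pos.2 hs)]
    refine mul_nonneg hE.le (sub_nonneg.2 ?_)
    rw [div_le_one hB0]; exact PB_le B _
  · show mmseFn B E s⁻¹ ≤ E
    rw [mmse_rep hE (inv_pos.2 hs)]
    have := div_nonneg (PB_nonneg B (E / s⁻¹).toNNReal) hB0.le
    nlinarith
  · show mmseFn B E s'⁻¹ < mmseFn B E s⁻¹
    rw [mmse_rep hE (inv_pos.2 hs), mmse_rep hE (inv_pos.2 hs')]
    have hs0 : 0 < s := hs
    have hs0' : 0 < s' := hs'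
    have hlt : (E / s⁻¹).toNNReal < (E / s'⁻¹).toNNReal := by
      rw [Real.toNNReal_lt_toNNReal_iff (by positivity)]
      simp only [div_inv_eq_mul]
      gcongr
    obtain ⟨d, hd⟩ := exists_add_of_le hlt.le
    have hd0 : d ≠ 0 := by rintro rfl; rw [add_zero] at hd; exact hlt.ne hd.symm
    rw [hd]
    have := PB_lt hB (E / s⁻¹).toNNReal d hd0
    gcongr
  · show miFn B E s'⁻¹ ≤ miFn B E s⁻¹ + 1 / 2 * mmseFn B E s⁻¹ * (s' - s)
    rw [mmse_rep hE (inv_pos.2 hs), mi_rep hE (inv_pos.2 hs), mi_rep hE (inv_pos.2 hs')]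
    simp only [div_inv_eq_mul]
    have h := QB_sg hB (E * s).toNNReal (E * s').toNNReal
    rw [Real.coe_toNNReal _ (by positivity), Real.coe_toNNReal _ (by positivity)] at h
    have h2 := div_le_div_of_nonneg_right h hB0.le
    have e : (QB B (E * s).toNNReal + 1 / 2 * PB B (E * s).toNNReal * (E * s' - E * s)) / B =
      QB B (E * s).toNNReal / B + 1 / 2 * (PB B (E * s).toNNReal / B) * (E * s' - E * s) := by ring
    rw [e] at h2
    linarith
def sf (σ2 μ x : ℝ) : ℝ := (σ2 + μ * x)⁻¹

def kk (σ2 μ x : ℝ) : ℝ := Real.log ((σ2 + μ * x) / σ2) - μ * x / (σ2 + μ * x)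

def FF (I : ℝ → ℝ) (σ2 μ x : ℝ) : ℝ := I (sf σ2 μ x) + 1 / (2 * μ) * kk σ2 μ x

lemma den_pos {σ2 μ x : ℝ} (hσ : 0 < σ2) (hμ : 0 < μ) (hx : 0 ≤ x) : 0 < σ2 + μ * x := by positivity

lemma sf_pos {σ2 μ x : ℝ} (hσ : 0 < σ2) (hμ : 0 < μ) (hx : 0 ≤ x) : 0 < sf σ2 μ x :=
  inv_pos.2 (den_pos hσ hμ hx)

lemma sf_anti {σ2 μ x y : ℝ} (hσ : 0 < σ2) (hμ : 0 < μ) (hx : 0 ≤ x) (hxy : x ≤ y) :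
    sf σ2 μ y ≤ sf σ2 μ x := by
  unfold sf
  have := den_pos hσ hμ hx
  gcongr

lemma sf_le {σ2 μ x : ℝ} (hσ : 0 < σ2) (hμ : 0 < μ) (hx : 0 ≤ x) : sf σ2 μ x ≤ σ2⁻¹ := by
  have := sf_anti hσ hμ le_rfl hx
  simpa [sf] using this

lemma sf_sub {σ2 μ x y : ℝ} (hσ : 0 < σ2) (hμ : 0 < μ) (hx : 0 ≤ x) (hy : 0 ≤ y) :
    sf σ2 μ x - sf σ2 μ y = μ * (y - x) * (sf σ2 μ x * sf σ2 μ y) := by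
  unfold sf
  have h1 := (den_pos hσ hμ hx).ne'
  have h2 := (den_pos hσ hμ hy).ne'
  field_simp
  ring

lemma kk_row {σ2 μ x y : ℝ} (hσ : 0 < σ2) (hμ : 0 < μ) (hx : 0 ≤ x) (hy : 0 ≤ y) :
    1 / (2 * μ) * kk σ2 μ y ≤ 1 / (2 * μ) * kk σ2 μ x - 1 / 2 * y * (sf σ2 μ y - sf σ2 μ x) := by
  have h1 := den_pos hσ hμ hx
  have h2 := den_pos hσ hμ hy
  have hl := Real.log_le_sub_one_of_pos (div_pos h2 h1)
  rw [Real.log_div h2.ne' h1.ne'] at hl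
  have e : 1 / (2 * μ) * kk σ2 μ x - 1 / 2 * y * (sf σ2 μ y - sf σ2 μ x) - 1 / (2 * μ) * kk σ2 μ y =
      1 / (2 * μ) * ((σ2 + μ * y) / (σ2 + μ * x) - 1 - (Real.log (σ2 + μ * y) - Real.log (σ2 + μ * x))) := by
    unfold kk sf
    rw [Real.log_div h2.ne' hσ.ne', Real.log_div h1.ne' hσ.ne']
    have h1' := h1.ne'
    have h2' := h2.ne'
    field_simp
    ring
  have : 0 ≤ 1 / (2 * μ) * ((σ2 + μ * y) / (σ2 + μ * x) - 1 - (Real.log (σ2 + μ * y) - Real.log (σ2 + μ * x))) :=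
    mul_nonneg (by positivity) (by linarith)
  linarith

lemma FF_core {E : ℝ} {m I : ℝ → ℝ} (hs : MIsys E m I) {σ2 μ x y : ℝ} (hσ : 0 < σ2) (hμ : 0 < μ)
    (hx : 0 ≤ x) (hy : 0 ≤ y) :
    FF I σ2 μ y ≤ FF I σ2 μ x + 1 / 2 * (m (sf σ2 μ x) - y) * (sf σ2 μ y - sf σ2 μ x) := by
  have h1 := kk_row hσ hμ hx hy
  have h2 := hs.sg _ _ (sf_pos hσ hμ hx) (sf_pos hσ hμ hy)
  unfold FF
  linarith


lemma kk_nonneg {σ2 μ x : ℝ} (hσ : 0 < σ2) (hμ : 0 < μ) (hx : 0 ≤ x) : 0 ≤ kk σ2 μ x := by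
  have h1 := den_pos hσ hμ hx
  have h := Real.one_sub_inv_le_log_of_pos (div_pos h1 hσ)
  unfold kk
  have e : μ * x / (σ2 + μ * x) = 1 - ((σ2 + μ * x) / σ2)⁻¹ := by
    have := h1.ne'
    field_simp
    ring
  rw [e]; linarith

lemma kk_le {σ2 μ x : ℝ} (hσ : 0 < σ2) (hμ : 0 < μ) (hx : 0 ≤ x) : kk σ2 μ x ≤ μ * x / σ2 := by
  have h1 := den_pos hσ hμ hx
  have h := Real.log_le_sub_one_of_pos (div_pos h1 hσ)
  unfold kk
  have e : (σ2 + μ * x) / σ2 - 1 = μ * x / σ2 := by field_simp; ring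
  have : 0 ≤ μ * x / (σ2 + μ * x) := by positivity
  linarith

lemma kk_mono {σ2 μ x y : ℝ} (hσ : 0 < σ2) (hμ : 0 < μ) (hx : 0 ≤ x) (hxy : x ≤ y) :
    kk σ2 μ x ≤ kk σ2 μ y := by
  have h := kk_row hσ hμ (hx.trans hxy) hx
  have h2 := sf_anti hσ hμ hx hxy
  have h3 : 0 ≤ 1 / 2 * x * (sf σ2 μ x - sf σ2 μ y) := by
    have := sub_nonneg.2 h2
    positivity
  have h4 : 1 / (2 * μ) * kk σ2 μ x ≤ 1 / (2 * μ) * kk σ2 μ y := by linarith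
  exact le_of_mul_le_mul_left h4 (by positivity)

lemma FF_scale (I : ℝ → ℝ) {σ2 μ t x : ℝ} (hμ : 0 < μ) (ht : 0 < t) :
    FF I σ2 (t * μ) x = FF I σ2 μ (t * x) - (1 - 1 / t) * (1 / (2 * μ)) * kk σ2 μ (t * x) := by
  unfold FF
  have e1 : sf σ2 (t * μ) x = sf σ2 μ (t * x) := by unfold sf; ring_nf
  have e2 : kk σ2 (t * μ) x = kk σ2 μ (t * x) := by unfold kk; ring_nf
  rw [e1, e2]
  field_simp
  ring

lemma I_lip {E : ℝ} {m I : ℝ → ℝ} (hs : MIsys E m I) {s s' : ℝ} (h : 0 < s) (h' : 0 < s') :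
    |I s' - I s| ≤ E * |s' - s| := by
  have h1 := hs.sg s s' h h'
  have h2 := hs.sg s' s h' h
  have a1 : |m s * (s' - s)| ≤ E * |s' - s| := by
    rw [abs_mul, abs_of_nonneg (hs.nn s h)]
    exact mul_le_mul_of_nonneg_right (hs.le s h) (abs_nonneg _)
  have a2 : |m s' * (s' - s)| ≤ E * |s' - s| := by
    rw [abs_mul, abs_of_nonneg (hs.nn s' h')]
    exact mul_le_mul_of_nonneg_right (hs.le s' h') (abs_nonneg _)
  rw [abs_le] at a1 a2 ⊢
  have hE : 0 ≤ E := (hs.nn s h).trans (hs.le s h)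
  have := mul_nonneg hE (abs_nonneg (s' - s))
  constructor <;> linarith

lemma FF_cont {E : ℝ} {m I : ℝ → ℝ} (hs : MIsys E m I) {σ2 μ : ℝ} (hσ : 0 < σ2) (hμ : 0 < μ) :
    ContinuousOn (FF I σ2 μ) (Set.Ici 0) := by
  have hE : 0 ≤ E := (hs.nn 1 one_pos).trans (hs.le 1 one_pos)
  have hI : ContinuousOn I (Set.Ioi 0) := by
    have : LipschitzOnWith ⟨E, hE⟩ I (Set.Ioi 0) := by
      refine LipschitzOnWith.of_dist_le_mul fun s h s' h' => ?_
      rw [Real.dist_eq, Real.dist_eq]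
      exact I_lip hs h' h
    exact this.continuousOn
  have hden : ContinuousOn (fun x => σ2 + μ * x) (Set.Ici 0) := by fun_prop
  have hne : ∀ x ∈ Set.Ici (0 : ℝ), σ2 + μ * x ≠ 0 := fun x hx => (den_pos hσ hμ hx).ne'
  unfold FF kk sf
  refine ContinuousOn.add (hI.comp (hden.inv₀ hne) fun x hx => inv_pos.2 (den_pos hσ hμ hx)) ?_
  refine continuousOn_const.mul (ContinuousOn.sub ?_ ?_)
  · refine ContinuousOn.log (hden.div_const _) fun x hx => (div_pos (den_pos hσ hμ hx) hσ).ne'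
  · exact ContinuousOn.div (by fun_prop) hden hne

/-- minimizers on `[0,E]` -/
def MS (I : ℝ → ℝ) (E σ2 μ : ℝ) : Set ℝ :=
  {x | x ∈ Set.Icc 0 E ∧ ∀ y ∈ Set.Icc (0 : ℝ) E, FF I σ2 μ x ≤ FF I σ2 μ y}

lemma MS_nonempty {E : ℝ} {m I : ℝ → ℝ} (hs : MIsys E m I) {σ2 μ : ℝ} (hσ : 0 < σ2) (hμ : 0 < μ) :
    (MS I E σ2 μ).Nonempty := by
  have hE : 0 ≤ E := (hs.nn 1 one_pos).trans (hs.le 1 one_pos)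
  obtain ⟨x, hx, h⟩ := isCompact_Icc.exists_isMinOn (Set.nonempty_Icc.2 hE)
    ((FF_cont hs hσ hμ).mono Set.Icc_subset_Ici_self)
  exact ⟨x, hx, fun y hy => h hy⟩

lemma MS_sSup_mem {E : ℝ} {m I : ℝ → ℝ} (hs : MIsys E m I) {σ2 μ : ℝ} (hσ : 0 < σ2) (hμ : 0 < μ) :
    sSup (MS I E σ2 μ) ∈ MS I E σ2 μ := by
  obtain ⟨x0, hx0⟩ := MS_nonempty hs hσ hμ
  have hc : IsClosed (MS I E σ2 μ) := by
    have : MS I E σ2 μ = Set.Icc 0 E ∩ (FF I σ2 μ) ⁻¹' (Set.Iic (FF I σ2 μ x0)) := by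
      ext x; constructor
      · rintro ⟨h1, h2⟩; exact ⟨h1, h2 x0 hx0.1⟩
      · rintro ⟨h1, h2⟩; exact ⟨h1, fun y hy => le_trans h2 (hx0.2 y hy)⟩
    rw [this]
    exact ((FF_cont hs hσ hμ).mono Set.Icc_subset_Ici_self).preimage_isClosed_of_isClosed
      isClosed_Icc isClosed_Iic
  exact hc.csSup_mem ⟨x0, hx0⟩ ⟨E, fun x hx => hx.1.2⟩

lemma MS_le_sSup {E : ℝ} {I : ℝ → ℝ} {σ2 μ x : ℝ} (hx : x ∈ MS I E σ2 μ) : x ≤ sSup (MS I E σ2 μ) :=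
  le_csSup ⟨E, fun _ hx => hx.1.2⟩ hx

/-- minimizers satisfy `x ≤ m(s(x))` -/
lemma MS_le_m {E : ℝ} {m I : ℝ → ℝ} (hs : MIsys E m I) {σ2 μ x : ℝ} (hσ : 0 < σ2) (hμ : 0 < μ)
    (hx : x ∈ MS I E σ2 μ) : x ≤ m (sf σ2 μ x) := by
  by_contra! hlt
  set M := m (sf σ2 μ x) with hM
  have hM0 : 0 ≤ M := hs.nn _ (sf_pos hσ hμ hx.1.1)
  have hxE := hx.1.2
  set y := (x + M) / 2 with hy
  have hy0 : 0 ≤ y := by linarith [hx.1.1]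
  have hyx : y < x := by linarith
  have h := FF_core hs hσ hμ hx.1.1 hy0
  have h2 := hx.2 y ⟨hy0, by linarith⟩
  have h3 := sf_sub hσ hμ hy0 hx.1.1
  have h4 : 0 < sf σ2 μ y - sf σ2 μ x := by
    rw [h3]
    have := sub_pos.2 hyx
    have := sf_pos hσ hμ hy0
    have := sf_pos hσ hμ hx.1.1
    positivity
  have h5 : (M - y) * (sf σ2 μ y - sf σ2 μ x) < 0 := mul_neg_of_neg_of_pos (by linarith) h4
  rw [← hM] at h
  linarith
/-- window average of length `v+1` -/
def avg (v : ℕ) (Y : ℕ → ℝ) (r : ℕ) : ℝ := (∑ k ∈ Finset.range (v + 1), Y (r + k)) / ((v : ℝ) + 1)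

lemma avg_const {v : ℕ} {Y : ℕ → ℝ} {r : ℕ} {c : ℝ} (h : ∀ k ≤ v, Y (r + k) = c) : avg v Y r = c := by
  unfold avg
  rw [Finset.sum_congr rfl fun k hk => h k (by simp at hk; omega)]
  have : (v : ℝ) + 1 ≠ 0 := by positivity
  simp; field_simp

lemma avg_le {v : ℕ} {Y : ℕ → ℝ} {r : ℕ} {c : ℝ} (h : ∀ k ≤ v, Y (r + k) ≤ c) : avg v Y r ≤ c := by
  unfold avg
  rw [div_le_iff₀ (by positivity)]
  refine (Finset.sum_le_sum (g := fun _ => c) fun k hk => h k (by simp at hk; omega)).trans (le_of_eq ?_)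
  simp; ring

lemma le_avg {v : ℕ} {Y : ℕ → ℝ} {r : ℕ} {c : ℝ} (h : ∀ k ≤ v, c ≤ Y (r + k)) : c ≤ avg v Y r := by
  unfold avg
  rw [le_div_iff₀ (by positivity)]
  refine le_trans (le_of_eq ?_) (Finset.sum_le_sum (f := fun _ => c) fun k hk => h k (by simp at hk; omega))
  simp; ring

lemma avg_mono {v : ℕ} {Y Z : ℕ → ℝ} {r r' : ℕ} (h : ∀ k ≤ v, Y (r + k) ≤ Z (r' + k)) :
    avg v Y r ≤ avg v Z r' := by
  unfold avg
  gcongr with k hk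
  exact h k (by simp at hk; omega)

lemma avg_succ_sub (v : ℕ) (Y : ℕ → ℝ) (r : ℕ) :
    avg v Y r - avg v Y (r + 1) = (Y r - Y (r + (v + 1))) / ((v : ℝ) + 1) := by
  unfold avg
  rw [← sub_div]
  congr 1
  have h1 := Finset.sum_range_succ (fun k => Y (r + k)) (v + 1)
  have h2 := Finset.sum_range_succ' (fun k => Y (r + k)) (v + 1)
  have h3 : ∀ k, Y (r + (k + 1)) = Y (r + 1 + k) := fun k => by congr 1; ring
  simp only [h3, add_zero] at h2
  rw [h2] at h1
  linarith

/-- adjointness of the two window averages -/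
lemma adjoint_sum (v N : ℕ) (Y d : ℕ → ℝ) (h0 : ∀ r < v + 1, d r = 0) (hN : ∀ r, N ≤ r → d r = 0) :
    ∑ i ∈ Finset.range N, Y (i + (v + 1)) * ∑ k ∈ Finset.range (v + 1), d (i + k) =
      ∑ r ∈ Finset.range N, (∑ k ∈ Finset.range (v + 1), Y (r + 1 + k)) * d r := by
  simp_rw [Finset.mul_sum, Finset.sum_mul]
  rw [Finset.sum_comm]
  rw [Finset.sum_comm (s := Finset.range N)]
  rw [← Finset.sum_range_reflect (fun k => ∑ r ∈ Finset.range N, Y (r + 1 + k) * d r)]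
  refine Finset.sum_congr rfl fun k hk => ?_
  simp only [Finset.mem_range] at hk
  set f : ℕ → ℝ := fun r => Y (r + 1 + (v - k)) * d r with hf
  have e1 : ∑ r ∈ Finset.range N, Y (r + 1 + (v + 1 - 1 - k)) * d r = ∑ r ∈ Finset.range N, f r := rfl
  have e2 : ∑ i ∈ Finset.range N, Y (i + (v + 1)) * d (i + k) = ∑ i ∈ Finset.range N, f (k + i) := by
    refine Finset.sum_congr rfl fun i _ => ?_
    simp only [hf]
    rw [show k + i + 1 + (v - k) = i + (v + 1) by omega, add_comm k i]
  rw [e1, e2]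
  have h1 := Finset.sum_range_add f k N
  have h2 := Finset.sum_range_add f N k
  have z1 : ∑ r ∈ Finset.range k, f r = 0 :=
    Finset.sum_eq_zero fun r hr => by
      simp only [Finset.mem_range] at hr
      simp [hf, h0 r (by omega)]
  have z2 : ∑ r ∈ Finset.range k, f (N + r) = 0 :=
    Finset.sum_eq_zero fun r _ => by simp [hf, hN (N + r) (by omega)]
  rw [z1, zero_add] at h1
  rw [z2, add_zero, add_comm N k] at h2
  rw [← h1, h2]

def SA (σ2 μ : ℝ) (v : ℕ) (Y : ℕ → ℝ) : ℕ → ℝ := avg v (fun r => sf σ2 μ (avg v Y r))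

structure Prof (m : ℝ → ℝ) (σ2 μ E : ℝ) (v N : ℕ) (x0 x1 η : ℝ) (Y : ℕ → ℝ) : Prop where
  mono : Monotone Y
  left : ∀ i < 2 * (v + 1), Y i = x0
  right : ∀ i, N ≤ i → Y i = x1
  xnonneg : 0 ≤ x0
  xleE : x1 ≤ E
  sub : ∀ i, Y (i + v) ≤ m (SA σ2 μ v Y i) + η

namespace Prof
variable {m I : ℝ → ℝ} {σ2 μ E : ℝ} {v N : ℕ} {x0 x1 η : ℝ} {Y : ℕ → ℝ}

lemma ge (h : Prof m σ2 μ E v N x0 x1 η Y) (i : ℕ) : x0 ≤ Y i := by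
  rw [← h.left 0 (by omega)]; exact h.mono (Nat.zero_le _)

lemma le (h : Prof m σ2 μ E v N x0 x1 η Y) (i : ℕ) : Y i ≤ x1 := by
  rw [← h.right (max i N) (le_max_right _ _)]; exact h.mono (le_max_left _ _)

lemma x01 (h : Prof m σ2 μ E v N x0 x1 η Y) : x0 ≤ x1 := (h.ge 0).trans (h.le 0)

lemma gnn (h : Prof m σ2 μ E v N x0 x1 η Y) (r : ℕ) : 0 ≤ avg v Y r :=
  le_avg fun k _ => h.xnonneg.trans (h.ge _)

lemma gle (h : Prof m σ2 μ E v N x0 x1 η Y) (r : ℕ) : avg v Y r ≤ x1 :=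
  avg_le fun k _ => h.le _

lemma gmono (h : Prof m σ2 μ E v N x0 x1 η Y) : Monotone (avg v Y) := fun r r' hr =>
  avg_mono fun k _ => h.mono (by omega)

lemma santi (h : Prof m σ2 μ E v N x0 x1 η Y) (hσ : 0 < σ2) (hμ : 0 < μ) :
    Antitone (fun r => sf σ2 μ (avg v Y r)) := fun r _ hr =>
  sf_anti hσ hμ (h.gnn r) (h.gmono hr)

lemma SAanti (h : Prof m σ2 μ E v N x0 x1 η Y) (hσ : 0 < σ2) (hμ : 0 < μ) :
    Antitone (SA σ2 μ v Y) := fun _ _ hr =>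
  avg_mono fun k _ => h.santi hσ hμ (by omega)

lemma SAle (h : Prof m σ2 μ E v N x0 x1 η Y) (hσ : 0 < σ2) (hμ : 0 < μ) (i : ℕ) : SA σ2 μ v Y i ≤ σ2⁻¹ :=
  avg_le fun k _ => sf_le hσ hμ (h.gnn _)

lemma SAge (h : Prof m σ2 μ E v N x0 x1 η Y) (hσ : 0 < σ2) (hμ : 0 < μ) (i : ℕ) :
    sf σ2 μ x1 ≤ SA σ2 μ v Y i :=
  le_avg fun k _ => sf_anti hσ hμ (h.gnn _) (h.gle _)

lemma SApos (h : Prof m σ2 μ E v N x0 x1 η Y) (hσ : 0 < σ2) (hμ : 0 < μ) (i : ℕ) : 0 < SA σ2 μ v Y i :=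
  lt_of_lt_of_le (sf_pos hσ hμ (h.xnonneg.trans h.x01)) (h.SAge hσ hμ i)

theorem energy (h : Prof m σ2 μ E v N x0 x1 η Y) (hs : MIsys E m I) (hσ : 0 < σ2) (hμ : 0 < μ) (hη : 0 ≤ η) :
    FF I σ2 μ x1 ≤ FF I σ2 μ x0 + 1 / 2 * (E / (((v : ℝ) + 1) * σ2) + η / σ2) := by
  set g := avg v Y with hg
  set s : ℕ → ℝ := fun r => sf σ2 μ (g r) with hsd
  set S := SA σ2 μ v Y with hS
  have hSs : ∀ i, S i = avg v s i := fun i => rfl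
  have hv : (0 : ℝ) < (v : ℝ) + 1 := by positivity
  -- endpoint values
  have g0 : ∀ r ≤ v + 1, g r = x0 := fun r hr => avg_const fun k hk => h.left _ (by omega)
  have gN : ∀ r, N ≤ r → g r = x1 := fun r hr => avg_const fun k _ => h.right _ (by omega)
  have S0 : S 0 = sf σ2 μ x0 := avg_const fun k hk => by rw [← hg, g0 _ (by omega)]
  have SN : S N = sf σ2 μ x1 := avg_const fun k hk => by rw [← hg, gN _ (by omega)]
  -- I part
  have hI : I (S N) - I (S 0) ≤ ∑ i ∈ Finset.range N, 1 / 2 * m (S i) * (S (i + 1) - S i) := by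
    rw [← Finset.sum_range_sub (fun i => I (S i))]
    refine Finset.sum_le_sum fun i _ => ?_
    have := hs.sg (S i) (S (i + 1)) (h.SApos hσ hμ i) (h.SApos hσ hμ (i + 1))
    linarith
  have hK : 1 / (2 * μ) * kk σ2 μ (g N) - 1 / (2 * μ) * kk σ2 μ (g 0) ≤
      ∑ r ∈ Finset.range N, -(1 / 2 * g (r + 1) * (s (r + 1) - s r)) := by
    rw [← Finset.sum_range_sub (fun r => 1 / (2 * μ) * kk σ2 μ (g r))]
    refine Finset.sum_le_sum fun r _ => ?_
    have := kk_row hσ hμ (h.gnn r) (h.gnn (r + 1))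
    simp only [hsd]
    linarith
  have hadj := adjoint_sum v N Y (fun r => s (r + 1) - s r)
    (fun r hr => by simp only [hsd]; rw [g0 (r + 1) (by omega), g0 r (by omega), sub_self])
    (fun r hr => by simp only [hsd]; rw [gN (r + 1) (by omega), gN r hr, sub_self])
  have e1 : ∀ i, S (i + 1) - S i = (∑ k ∈ Finset.range (v + 1), (s (i + k + 1) - s (i + k))) / ((v : ℝ) + 1) := by
    intro i
    rw [hSs, hSs]; unfold avg
    rw [← sub_div, ← Finset.sum_sub_distrib]
    congr 1
    refine Finset.sum_congr rfl fun k _ => ?_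
    rw [show i + 1 + k = i + k + 1 by ring]
  have hadj2 : ∑ i ∈ Finset.range N, Y (i + (v + 1)) * (S (i + 1) - S i) =
      ∑ r ∈ Finset.range N, g (r + 1) * (s (r + 1) - s r) := by
    have l : ∀ i, Y (i + (v + 1)) * (S (i + 1) - S i) =
      (Y (i + (v + 1)) * ∑ k ∈ Finset.range (v + 1), (s (i + k + 1) - s (i + k))) / ((v : ℝ) + 1) := by
      intro i; rw [e1]; ring
    have r : ∀ r, g (r + 1) * (s (r + 1) - s r) =
        ((∑ k ∈ Finset.range (v + 1), Y (r + 1 + k)) * (s (r + 1) - s r)) / ((v : ℝ) + 1) := by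
      intro r; rw [hg]; unfold avg; ring
    simp_rw [l, r]
    rw [← Finset.sum_div, ← Finset.sum_div, hadj]
  have hK2 : ∑ r ∈ Finset.range N, -(1 / 2 * g (r + 1) * (s (r + 1) - s r)) =
      ∑ i ∈ Finset.range N, -(1 / 2 * (Y (i + (v + 1)) * (S (i + 1) - S i))) := by
    rw [Finset.sum_neg_distrib, Finset.sum_neg_distrib, ← Finset.mul_sum, hadj2, Finset.mul_sum]
    congr 1
    refine Finset.sum_congr rfl fun r _ => by ring
  rw [hK2] at hK
  have tot : FF I σ2 μ x1 - FF I σ2 μ x0 ≤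
      ∑ i ∈ Finset.range N, (1 / 2 * (Y (i + (v + 1)) - Y (i + v)) * (1 / (((v : ℝ) + 1) * σ2)) +
        1 / 2 * η * (S i - S (i + 1))) := by
    have : FF I σ2 μ x1 - FF I σ2 μ x0 = (I (S N) - I (S 0)) +
        (1 / (2 * μ) * kk σ2 μ (g N) - 1 / (2 * μ) * kk σ2 μ (g 0)) := by
      rw [SN, S0, gN N le_rfl, g0 0 (by omega)]; unfold FF; ring
    rw [this]
    refine (add_le_add hI hK).trans ?_
    rw [← Finset.sum_add_distrib]
    refine Finset.sum_le_sum fun i _ => ?_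
    have d1 : 0 ≤ S i - S (i + 1) := sub_nonneg.2 (h.SAanti hσ hμ (Nat.le_succ i))
    have d2 : S i - S (i + 1) ≤ 1 / (((v : ℝ) + 1) * σ2) := by
      rw [hSs, hSs, avg_succ_sub, div_le_div_iff₀ hv (by positivity)]
      have b1 : s i ≤ σ2⁻¹ := sf_le hσ hμ (h.gnn _)
      have b2 : 0 < s (i + (v + 1)) := sf_pos hσ hμ (h.gnn _)
      have b3 : (s i - s (i + (v + 1))) * σ2 ≤ 1 := by
        have : σ2⁻¹ * σ2 = 1 := inv_mul_cancel₀ hσ.ne'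
        nlinarith
      nlinarith
    have d3 := h.sub i
    have d4 : Y (i + v) ≤ Y (i + (v + 1)) := h.mono (by omega)
    have d5 := mul_le_mul_of_nonneg_left d2 (sub_nonneg.2 d4)
    have d6 := mul_le_mul_of_nonneg_right d3 d1
    rw [← hS] at d6
    linarith
  rw [Finset.sum_add_distrib, ← Finset.mul_sum, Finset.sum_range_sub' S N, ← Finset.sum_mul, ← Finset.mul_sum] at tot
  have ty : ∑ i ∈ Finset.range N, (Y (i + (v + 1)) - Y (i + v)) ≤ E := by
    have := Finset.sum_range_sub (fun i => Y (i + v)) N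
    have e : ∀ i, Y (i + 1 + v) = Y (i + (v + 1)) := fun i => by congr 1; ring
    simp only [e] at this
    rw [this]
    have := h.le (N + v)
    have := h.xleE
    have := h.xnonneg.trans (h.ge (0 + v))
    linarith
  have t1 := mul_le_mul_of_nonneg_right ty (by positivity : 0 ≤ 1 / (((v : ℝ) + 1) * σ2))
  have t2 : η * (S 0 - S N) ≤ η / σ2 := by
    rw [div_eq_mul_inv]
    have := h.SAle hσ hμ 0
    have := (h.SApos hσ hμ N).le
    exact mul_le_mul_of_nonneg_left (by rw [← hS] at *; linarith) hη
  have e9 : E * (1 / (((v : ℝ) + 1) * σ2)) = E / (((v : ℝ) + 1) * σ2) := by ring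
  rw [e9] at t1
  linarith

end Prof

lemma gap_exists {E : ℝ} {m I : ℝ → ℝ} (hs : MIsys E m I) {σ2 μ ε : ℝ} (hσ : 0 < σ2) (hμ : 0 < μ)
    (hε : 0 < ε) : ∃ Δ > (0 : ℝ), ∀ y ∈ Set.Icc (0 : ℝ) E, sSup (MS I E σ2 μ) + ε ≤ y →
      FF I σ2 μ (sSup (MS I E σ2 μ)) + Δ ≤ FF I σ2 μ y := by
  have hp := MS_sSup_mem hs hσ hμ
  set p := sSup (MS I E σ2 μ) with hpd
  rcases (Set.Icc (p + ε) E).eq_empty_or_nonempty with he | hne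
  · refine ⟨1, one_pos, fun y hy hle => ?_⟩
    have : y ∈ Set.Icc (p + ε) E := ⟨hle, hy.2⟩
    rw [he] at this
    exact this.elim
  · have hsub : Set.Icc (p + ε) E ⊆ Set.Ici 0 := fun y hy => by
      have h1 := hp.1.1
      have h2 := hy.1
      simp only [Set.mem_Ici]; linarith
    obtain ⟨z, hz, hmin⟩ := isCompact_Icc.exists_isMinOn hne ((FF_cont hs hσ hμ).mono hsub)
    have hlt : FF I σ2 μ p < FF I σ2 μ z := by
      by_contra! hcon
      have : z ∈ MS I E σ2 μ := ⟨⟨hsub hz, hz.2⟩, fun y hy => hcon.trans (hp.2 y hy)⟩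
      have h1 := MS_le_sSup this
      have h2 := hz.1
      linarith
    refine ⟨FF I σ2 μ z - FF I σ2 μ p, by linarith, fun y hy hle => ?_⟩
    have : FF I σ2 μ z ≤ FF I σ2 μ y := hmin (⟨hle, hy.2⟩ : y ∈ Set.Icc (p + ε) E)
    linarith

lemma caseA {E : ℝ} {m I : ℝ → ℝ} (hs : MIsys E m I) {σ2 μ ε : ℝ} (hσ : 0 < σ2) (hμ : 0 < μ)
    (hε : 0 < ε) : ∃ θ > (0 : ℝ), ∃ δ > (0 : ℝ), ∀ t, 1 ≤ t → t ≤ 1 + θ → ∀ x ∈ Set.Icc (0 : ℝ) E,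
      FF I σ2 (t * μ) x ≤ FF I σ2 (t * μ) (sSup (MS I E σ2 (t * μ))) + δ →
      x ≤ sSup (MS I E σ2 (t * μ)) + ε := by
  have hE : 0 ≤ E := (hs.nn 1 one_pos).trans (hs.le 1 one_pos)
  obtain ⟨Δ, hΔ, hgap⟩ := gap_exists hs hσ hμ (half_pos hε)
  have hp := MS_sSup_mem hs hσ hμ
  set p := sSup (MS I E σ2 μ) with hpd
  obtain ⟨θ, hθ, hθ1, hθ2⟩ : ∃ θ > (0 : ℝ), θ * E ≤ ε / 2 ∧ θ * (E / σ2) ≤ Δ / 4 := by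
    refine ⟨min (ε / 2 / (E + 1)) (Δ / 4 / (E / σ2 + 1)), by positivity, ?_, ?_⟩
    · have : min (ε / 2 / (E + 1)) (Δ / 4 / (E / σ2 + 1)) ≤ ε / 2 / (E + 1) := min_le_left _ _
      calc _ ≤ ε / 2 / (E + 1) * (E + 1) := by gcongr; linarith
        _ = ε / 2 := by field_simp
    · have : min (ε / 2 / (E + 1)) (Δ / 4 / (E / σ2 + 1)) ≤ Δ / 4 / (E / σ2 + 1) := min_le_right _ _
      have h0 : E / σ2 + 1 ≠ 0 := by positivity
      calc _ ≤ Δ / 4 / (E / σ2 + 1) * (E / σ2 + 1) := by gcongr; linarith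
        _ = Δ / 4 := div_mul_cancel₀ _ h0
  refine ⟨θ, hθ, Δ / 4, by positivity, fun t ht1 ht2 x hx hF => ?_⟩
  have ht : 0 < t := by linarith
  have hM := MS_sSup_mem hs hσ (mul_pos ht hμ)
  set M := sSup (MS I E σ2 (t * μ)) with hMd
  have hc : 0 ≤ (1 - 1 / t) * (1 / (2 * μ)) := by
    have : 1 / t ≤ 1 := by rw [div_le_one ht]; exact ht1
    have : 0 ≤ 1 - 1 / t := by linarith
    positivity
  set c := (1 - 1 / t) * (1 / (2 * μ)) with hcd
  have hpt : p / t ∈ Set.Icc (0 : ℝ) E :=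
    ⟨div_nonneg hp.1.1 ht.le, (div_le_self hp.1.1 ht1).trans hp.1.2⟩
  have hsc : ∀ y, FF I σ2 (t * μ) y = FF I σ2 μ (t * y) - c * kk σ2 μ (t * y) := fun y =>
    FF_scale I hμ ht
  have hpt2 : t * (p / t) = p := by field_simp
  have hMp : FF I σ2 (t * μ) M ≤ FF I σ2 (t * μ) (p / t) := hM.2 _ hpt
  have hub : FF I σ2 (t * μ) M ≤ FF I σ2 μ p := by
    refine hMp.trans ?_
    rw [hsc, hpt2]
    have := mul_nonneg hc (kk_nonneg hσ hμ hp.1.1)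
    linarith
  -- lower bound on M
  have hMlow : p ≤ t * M := by
    by_contra! hlt
    have hlt2 : M < p / t := by rw [lt_div_iff₀ ht]; linarith
    have hstrict : FF I σ2 (t * μ) M < FF I σ2 (t * μ) (p / t) := by
      by_contra! hcon
      have : p / t ∈ MS I E σ2 (t * μ) := ⟨hpt, fun y hy => hcon.trans (hM.2 y hy)⟩
      have := MS_le_sSup this
      linarith
    rw [hsc, hsc, hpt2] at hstrict
    have h0 : 0 ≤ t * M := mul_nonneg ht.le hM.1.1
    have h1 := mul_le_mul_of_nonneg_left (kk_mono hσ hμ h0 hlt.le) hc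
    have h2 := hp.2 (t * M) ⟨h0, hlt.le.trans hp.1.2⟩
    linarith
  have htx : 0 ≤ t * x := mul_nonneg ht.le hx.1
  have hlow : FF I σ2 μ (t * x) - Δ / 4 ≤ FF I σ2 (t * μ) x := by
    rw [hsc]
    have h1 : c * kk σ2 μ (t * x) ≤ c * (μ * (t * x) / σ2) :=
      mul_le_mul_of_nonneg_left (kk_le hσ hμ htx) hc
    have h2 : c * (μ * (t * x) / σ2) = 1 / 2 * ((t - 1) * (x / σ2)) := by
      rw [hcd]; field_simp
    have h3 : (t - 1) * (x / σ2) ≤ θ * (E / σ2) := by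
      have := hx.2
      have := hx.1
      gcongr
      linarith
    linarith
  set y := min (t * x) E with hy
  have hFy : FF I σ2 μ y ≤ FF I σ2 μ (t * x) := by
    rcases le_total (t * x) E with h | h
    · rw [hy, min_eq_left h]
    · rw [hy, min_eq_right h]
      have h1 := FF_core hs hσ hμ htx hE
      have h2 := hs.le _ (sf_pos hσ hμ htx)
      have h3 := sf_anti hσ hμ hE h
      nlinarith
  have hy2 : y < p + ε / 2 := by
    by_contra! hcon
    have := hgap y ⟨le_min htx hE, min_le_right _ _⟩ hcon
    linarith
  have hxy : x ≤ y := le_min (le_mul_of_one_le_left hx.1 ht1) hx.2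
  have h5 : (t - 1) * M ≤ θ * E := by
    have := hM.1.1
    have := hM.1.2
    gcongr
    linarith
  linarith

lemma inv_modulus {E : ℝ} {m I : ℝ → ℝ} (hs : MIsys E m I) {a b β : ℝ} (ha : 0 < a) (hβ : 0 < β) :
    ∃ ζ > (0 : ℝ), ∀ s s', a ≤ s → s' ≤ b → s + β ≤ s' → m s' + ζ ≤ m s := by
  rcases (Set.Icc a b).eq_empty_or_nonempty with he | hne
  · refine ⟨1, one_pos, fun s s' h1 h2 h3 => ?_⟩
    have : s ∈ Set.Icc a b := ⟨h1, by linarith⟩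
    rw [he] at this
    exact this.elim
  · have hc : ContinuousOn (fun s => m s - m (s + β)) (Set.Icc a b) := by
      have := hs.cont
      fun_prop
    obtain ⟨z, hz, hmin⟩ := isCompact_Icc.exists_isMinOn hne hc
    have hz0 : 0 < z := ha.trans_le hz.1
    refine ⟨m z - m (z + β), ?_, fun s s' h1 h2 h3 => ?_⟩
    · have := hs.anti (Set.mem_Ioi.2 hz0) (Set.mem_Ioi.2 (by linarith : 0 < z + β)) (by linarith)
      linarith
    · have h4 : m z - m (z + β) ≤ m s - m (s + β) :=
        hmin (⟨h1, by linarith⟩ : s ∈ Set.Icc a b)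
      have h5 : m s' ≤ m (s + β) :=
        hs.anti.antitoneOn (Set.mem_Ioi.2 (by linarith)) (Set.mem_Ioi.2 (by linarith)) h3
      linarith

lemma avg_anti_bound {v h : ℕ} {f : ℕ → ℝ} {c : ℝ} {L : ℕ} (hf : Antitone f) (hc : ∀ i, c ≤ f i)
    (hv : h ≤ v) (hL : v + 1 ≤ L * (h + 1)) (i : ℕ) : f (i + h) - c ≤ L * (avg v f i - c) := by
  have h1 : ((h : ℝ) + 1) * (f (i + h) - c) ≤ ∑ k ∈ Finset.range (v + 1), (f (i + k) - c) := by
    calc ((h : ℝ) + 1) * (f (i + h) - c) = ∑ k ∈ Finset.range (h + 1), (f (i + h) - c) := by simp; ring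
      _ ≤ ∑ k ∈ Finset.range (h + 1), (f (i + k) - c) := by
        refine Finset.sum_le_sum fun k hk => ?_
        simp only [Finset.mem_range] at hk
        have := hf (show i + k ≤ i + h by omega)
        linarith
      _ ≤ _ := Finset.sum_le_sum_of_subset_of_nonneg
          (fun k hk => by simp only [Finset.mem_range] at *; omega)
          (fun k _ _ => sub_nonneg.2 (hc _))
  have h2 : ∑ k ∈ Finset.range (v + 1), (f (i + k) - c) = ((v : ℝ) + 1) * (avg v f i - c) := by
    unfold avg
    have : (v : ℝ) + 1 ≠ 0 := by positivity
    rw [Finset.sum_sub_distrib, mul_sub, mul_div_cancel₀ _ this]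
    simp
  have h3 : 0 ≤ avg v f i - c := sub_nonneg.2 (le_avg fun k _ => hc _)
  have h4 : (v : ℝ) + 1 ≤ L * ((h : ℝ) + 1) := by exact_mod_cast hL
  have h5 : ((h : ℝ) + 1) * (f (i + h) - c) ≤ ((h : ℝ) + 1) * (L * (avg v f i - c)) := by
    calc _ ≤ ((v : ℝ) + 1) * (avg v f i - c) := by rw [← h2]; exact h1
      _ ≤ L * ((h : ℝ) + 1) * (avg v f i - c) := by gcongr
      _ = _ := by ring
  exact le_of_mul_le_mul_left h5 (by positivity)

lemma sf_ge {σ2 μ μ' E x : ℝ} (hσ : 0 < σ2) (hμ : 0 < μ) (h1 : μ ≤ μ') (h2 : μ' ≤ 2 * μ)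
    (hx : 0 ≤ x) (hxE : x ≤ E) : (σ2 + 2 * μ * E)⁻¹ ≤ sf σ2 μ' x := by
  unfold sf
  have := den_pos hσ (hμ.trans_le h1) hx
  gcongr

lemma near_min {E : ℝ} {m I : ℝ → ℝ} (hs : MIsys E m I) {σ2 μ α : ℝ} (hσ : 0 < σ2) (hμ : 0 < μ)
    (hα : 0 < α) : ∃ δ > (0 : ℝ), ∀ μ', μ ≤ μ' → μ' ≤ 2 * μ → ∀ x ∈ Set.Icc (0 : ℝ) E,
      FF I σ2 μ' x ≤ FF I σ2 μ' (sSup (MS I E σ2 μ')) + δ → m (sf σ2 μ' x) ≤ x + α := by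
  have hE : 0 ≤ E := (hs.nn 1 one_pos).trans (hs.le 1 one_pos)
  set a := (σ2 + 2 * μ * E)⁻¹ with had
  have ha : 0 < a := by positivity
  refine ⟨μ * α ^ 2 * a ^ 2 / 16, by positivity, fun μ' h1 h2 x hx hF => ?_⟩
  by_contra! hlt
  have hμ' : 0 < μ' := hμ.trans_le h1
  have hM := MS_sSup_mem hs hσ hμ'
  set M := m (sf σ2 μ' x) with hMd
  have hME : M ≤ E := hs.le _ (sf_pos hσ hμ' hx.1)
  have hx0 := hx.1
  set y := (x + M) / 2 with hyd
  have hy0 : 0 ≤ y := by linarith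
  have hyE : y ≤ E := by linarith [hx.2]
  have h3 := FF_core hs hσ hμ' hx.1 hy0
  rw [← hMd] at h3
  have h4 := hM.2 y ⟨hy0, hyE⟩
  have h5 := sf_sub hσ hμ' hx.1 hy0
  have h6 : μ * (α / 2) * (a * a) ≤ sf σ2 μ' x - sf σ2 μ' y := by
    rw [h5]
    have b1 := sf_ge hσ hμ h1 h2 hx.1 hx.2
    have b2 := sf_ge hσ hμ h1 h2 hy0 hyE
    have b3 : α / 2 ≤ y - x := by linarith
    have b4 : 0 ≤ y - x := by linarith
    have b5 : 0 ≤ μ' * (y - x) := by positivity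
    have b6 := (sf_pos hσ hμ' hx.1).le
    gcongr
  have h7 : α / 2 * (μ * (α / 2) * (a * a)) ≤ (M - y) * (sf σ2 μ' x - sf σ2 μ' y) := by
    have b3 : α / 2 ≤ M - y := by linarith
    have b4 : 0 ≤ M - y := by linarith
    gcongr
  have h8 : 0 < μ * α ^ 2 * a ^ 2 := by positivity
  nlinarith

lemma caseB_step {E : ℝ} {m I : ℝ → ℝ} (hs : MIsys E m I) {σ2 μ β : ℝ} (hσ : 0 < σ2) (hμ : 0 < μ)
    (hβ : 0 < β) : ∃ α > (0 : ℝ), ∀ (μ' : ℝ) (v N : ℕ) (x0 x1 η : ℝ) (Y : ℕ → ℝ),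
      μ ≤ μ' → μ' ≤ 2 * μ → Prof m σ2 μ' E v N x0 x1 η Y → 8 ≤ v + 1 → η ≤ α →
      m (sf σ2 μ' x1) ≤ x1 + α → ∀ j, x1 - Y j ≤ α → x1 - Y (j - (v + 1) / 8) ≤ β := by
  have hE : 0 ≤ E := (hs.nn 1 one_pos).trans (hs.le 1 one_pos)
  set a := (σ2 + 2 * μ * E)⁻¹ with had
  have ha : 0 < a := by positivity
  obtain ⟨ζ, hζ, hinv⟩ := inv_modulus (b := σ2⁻¹) hs ha (by positivity : 0 < β * (μ * (a * a)) / 8)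
  refine ⟨min β (ζ / 4), by positivity, fun μ' v N x0 x1 η Y h1 h2 hP hv hη hm j hj => ?_⟩
  have l1 : min β (ζ / 4) ≤ β := min_le_left _ _
  have l2 : min β (ζ / 4) ≤ ζ / 4 := min_le_right _ _
  have hμ' : 0 < μ' := hμ.trans_le h1
  have hx1 : 0 ≤ x1 := hP.xnonneg.trans hP.x01
  rcases lt_or_ge j v with hjv | hjv
  · have e1 := hP.left j (by omega)
    have e2 := hP.left (j - (v + 1) / 8) (by omega)
    rw [e2, ← e1]; linarith
  · obtain ⟨i, rfl⟩ := Nat.exists_eq_add_of_le' hjv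
    have hsub := hP.sub i
    have hSA : SA σ2 μ' v Y i < sf σ2 μ' x1 + β * (μ * (a * a)) / 8 := by
      by_contra! hcon
      have := hinv _ _ (sf_ge hσ hμ h1 h2 hx1 hP.xleE) (hP.SAle hσ hμ' i) hcon
      linarith
    have hb1 := avg_anti_bound (h := (v + 1) / 2) (L := 2) (v := v) (c := sf σ2 μ' x1)
      (hP.santi hσ hμ') (fun r => sf_anti hσ hμ' (hP.gnn r) (hP.gle r)) (by omega) (by omega) i
    have hSA' : avg v (fun r => sf σ2 μ' (avg v Y r)) i = SA σ2 μ' v Y i := rfl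
    rw [hSA'] at hb1
    set r := i + (v + 1) / 2 with hr
    have hb2 := avg_anti_bound (h := (v + 1) / 4) (L := 4) (v := v) (c := -x1) (f := fun i => -Y i)
      (fun p q hpq => neg_le_neg (hP.mono hpq)) (fun p => neg_le_neg (hP.le p)) (by omega) (by omega) r
    have hneg : avg v (fun i => -Y i) r = - avg v Y r := by
      unfold avg
      rw [Finset.sum_neg_distrib, neg_div]
    rw [hneg] at hb2
    have hsub2 := sf_sub hσ hμ' (hP.gnn r) hx1
    have h0 : 0 ≤ x1 - avg v Y r := sub_nonneg.2 (hP.gle r)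
    have h6 : μ * (x1 - avg v Y r) * (a * a) ≤ sf σ2 μ' (avg v Y r) - sf σ2 μ' x1 := by
      rw [hsub2]
      have b1 := sf_ge hσ hμ h1 h2 (hP.gnn r) ((hP.gle r).trans hP.xleE)
      have b2 := sf_ge hσ hμ h1 h2 hx1 hP.xleE
      have b5 : 0 ≤ μ' * (x1 - avg v Y r) := by positivity
      have b6 := (sf_pos hσ hμ' (hP.gnn r)).le
      gcongr
    have h7 : (μ * (a * a)) * (4 * (x1 - avg v Y r)) ≤ (μ * (a * a)) * β := by
      push_cast at hb1
      linarith
    have h8 := le_of_mul_le_mul_left h7 (by positivity)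
    have h9 := hP.mono (show r + (v + 1) / 4 ≤ i + v - (v + 1) / 8 by omega)
    push_cast at hb2
    linarith

lemma caseB_ind {E : ℝ} {m I : ℝ → ℝ} (hs : MIsys E m I) {σ2 μ : ℝ} (hσ : 0 < σ2) (hμ : 0 < μ)
    (n : ℕ) : ∀ β > (0 : ℝ), ∃ α > (0 : ℝ), ∀ (μ' : ℝ) (v N : ℕ) (x0 x1 η : ℝ) (Y : ℕ → ℝ),
      μ ≤ μ' → μ' ≤ 2 * μ → Prof m σ2 μ' E v N x0 x1 η Y → 8 ≤ v + 1 → η ≤ α →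
      m (sf σ2 μ' x1) ≤ x1 + α → x1 - Y (N - n * ((v + 1) / 8)) ≤ β := by
  induction n with
  | zero =>
    intro β hβ
    refine ⟨1, one_pos, fun μ' v N x0 x1 η Y h1 h2 hP hv hη hm => ?_⟩
    rw [zero_mul, Nat.sub_zero, hP.right N le_rfl, sub_self]
    exact hβ.le
  | succ n ih =>
    intro β hβ
    obtain ⟨α1, hα1, hstep⟩ := caseB_step hs hσ hμ hβ
    obtain ⟨α2, hα2, hih⟩ := ih α1 hα1
    refine ⟨min α1 α2, lt_min hα1 hα2, fun μ' v N x0 x1 η Y h1 h2 hP hv hη hm => ?_⟩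
    have l1 : min α1 α2 ≤ α1 := min_le_left _ _
    have l2 : min α1 α2 ≤ α2 := min_le_right _ _
    have h3 := hih μ' v N x0 x1 η Y h1 h2 hP hv (hη.trans l2) (by linarith)
    have h4 := hstep μ' v N x0 x1 η Y h1 h2 hP hv (hη.trans l1) (by linarith) _ h3
    rwa [Nat.sub_sub, ← Nat.succ_mul] at h4

/-- Case B: short chains -/
lemma caseB {E : ℝ} {m I : ℝ → ℝ} (hs : MIsys E m I) {σ2 μ β : ℝ} (hσ : 0 < σ2) (hμ : 0 < μ)
    (K : ℕ) (hβ : 0 < β) : ∃ α > (0 : ℝ), ∃ δ > (0 : ℝ),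
      ∀ (μ' : ℝ) (v N : ℕ) (x0 x1 η : ℝ) (Y : ℕ → ℝ),
      μ ≤ μ' → μ' ≤ 2 * μ → Prof m σ2 μ' E v N x0 x1 η Y → 8 ≤ v + 1 → η ≤ α → N ≤ K * (v + 1) →
      FF I σ2 μ' x1 ≤ FF I σ2 μ' (sSup (MS I E σ2 μ')) + δ → x1 ≤ x0 + β := by
  obtain ⟨α, hα, hB⟩ := caseB_ind hs hσ hμ (16 * K) β hβ
  obtain ⟨δ, hδ, hn⟩ := near_min hs hσ hμ hα
  refine ⟨α, hα, δ, hδ, fun μ' v N x0 x1 η Y h1 h2 hP hv hη hN hF => ?_⟩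
  have h3 := hB μ' v N x0 x1 η Y h1 h2 hP hv hη
    (hn μ' h1 h2 x1 ⟨hP.xnonneg.trans hP.x01, hP.xleE⟩ hF)
  have h4 : N ≤ 16 * K * ((v + 1) / 8) := by
    calc N ≤ K * (v + 1) := hN
      _ ≤ K * (16 * ((v + 1) / 8)) := Nat.mul_le_mul_left _ (by omega)
      _ = _ := by ring
  rw [Nat.sub_eq_zero_of_le h4, hP.left 0 (by omega)] at h3
  linarith

lemma unif_m {E : ℝ} {m I : ℝ → ℝ} (hs : MIsys E m I) {a b η : ℝ} (ha : 0 < a) (hη : 0 < η) :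
    ∃ κ0 > (0 : ℝ), ∀ κ ≤ κ0, ∀ s s', a ≤ s → s ≤ b → s - κ ≤ s' → m s' ≤ m s + η := by
  have huc := isCompact_Icc.uniformContinuousOn_of_continuous
    (hs.cont.continuousOn (s := Set.Icc (a / 2) b))
  rw [Metric.uniformContinuousOn_iff] at huc
  obtain ⟨d, hd, h⟩ := huc η hη
  refine ⟨min (a / 2) (d / 2), by positivity, fun κ hκ s s' h1 h2 h3 => ?_⟩
  have l1 : min (a / 2) (d / 2) ≤ a / 2 := min_le_left _ _
  have l2 : min (a / 2) (d / 2) ≤ d / 2 := min_le_right _ _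
  rcases le_total s s' with hle | hle
  · have := hs.anti.antitoneOn (Set.mem_Ioi.2 (ha.trans_le h1)) (Set.mem_Ioi.2 (by linarith)) hle
    linarith
  · have := h s' ⟨by linarith, by linarith⟩ s ⟨by linarith, h2⟩ (by
      rw [Real.dist_eq, abs_sub_lt_iff]; constructor <;> linarith)
    rw [Real.dist_eq, abs_sub_lt_iff] at this
    linarith [this.1]

lemma prof_exists {E : ℝ} {m I : ℝ → ℝ} (hs : MIsys E m I) {σ2 μ : ℝ} (hσ : 0 < σ2) (hμ : 0 < μ)
    {v Λ : ℕ} {x0 a κ η : ℝ} (hx0 : x0 ∈ Set.Icc (0 : ℝ) E) (hx0m : x0 ≤ m (sf σ2 μ x0))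
    (ψ S : Fin Λ → ℝ) (hψE : ∀ c, ψ c ≤ E) (hη : 0 ≤ η)
    (hS : ∀ Y : ℕ → ℝ, (∀ i, 0 ≤ Y i) → (∀ c : Fin Λ, ψ c ≤ Y (c + 2 * (v + 1))) →
      ∀ c : Fin Λ, SA σ2 μ v Y (c + (v + 2)) - κ ≤ S c)
    (hψS : ∀ c, ψ c = m (S c)) (ha : a ≤ sf σ2 μ E)
    (hm : ∀ s s', a ≤ s → s ≤ σ2⁻¹ → s - κ ≤ s' → m s' ≤ m s + η) :
    ∃ (Y : ℕ → ℝ) (x1 : ℝ), Prof m σ2 μ E v (2 * (v + 1) + Λ) x0 x1 η Y ∧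
      ∀ c, sf σ2 μ x1 - κ ≤ S c := by
  set e : ℕ → ℝ := fun i => if h : 2 * (v + 1) ≤ i ∧ i < 2 * (v + 1) + Λ then
    max x0 (ψ ⟨i - 2 * (v + 1), by omega⟩) else x0 with he
  set Y : ℕ → ℝ := ⇑(partialSups e) with hY
  have hmono : Monotone Y := (partialSups e).monotone
  have he0 : ∀ i, x0 ≤ e i := fun i => by
    simp only [he]; split_ifs
    · exact le_max_left _ _
    · exact le_rfl
  have heE : ∀ i, e i ≤ E := fun i => by
    simp only [he]; split_ifs
    · exact max_le hx0.2 (hψE _)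
    · exact hx0.2
  have heY : ∀ i, e i ≤ Y i := fun i => le_partialSups e i
  have hY0 : ∀ i, x0 ≤ Y i := fun i => (he0 i).trans (heY i)
  have hYE : ∀ i, Y i ≤ E := fun i => partialSups_le e i _ fun j _ => heE j
  have hleft : ∀ i < 2 * (v + 1), Y i = x0 := fun i hi => by
    refine le_antisymm (partialSups_le e i _ fun j hj => ?_) (hY0 i)
    simp only [he]; rw [dif_neg (by omega)]
  have hright : ∀ i, 2 * (v + 1) + Λ ≤ i → Y i = Y (2 * (v + 1) + Λ) := fun i hi => by
    refine le_antisymm (partialSups_le e i _ fun j hj => ?_) (hmono hi)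
    by_cases hj2 : j ≤ 2 * (v + 1) + Λ
    · exact (heY j).trans (hmono hj2)
    · have : e j = x0 := by simp only [he]; rw [dif_neg (by omega)]
      rw [this]; exact hY0 _
  have hψY : ∀ c : Fin Λ, ψ c ≤ Y (c + 2 * (v + 1)) := fun c => by
    refine le_trans ?_ (heY _)
    simp only [he]; rw [dif_pos (by omega)]
    refine le_trans (le_of_eq ?_) (le_max_right _ _)
    congr 1; ext; simp
  -- crude profile
  have hSpos : ∀ i, 0 < SA σ2 μ v Y i := fun i =>
    lt_of_lt_of_le (sf_pos hσ hμ (hx0.1.trans hx0.2)) (le_avg fun k _ =>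
      sf_anti hσ hμ (le_avg fun k _ => hx0.1.trans (hY0 _)) (avg_le fun k _ => hYE _))
  have hP0 : Prof m σ2 μ E v (2 * (v + 1) + Λ) x0 (Y (2 * (v + 1) + Λ)) E Y :=
    ⟨hmono, hleft, hright, hx0.1, hYE _, fun i => by
      have := hs.nn _ (hSpos i)
      have := hYE (i + v)
      linarith⟩
  have hSc := hS Y (fun i => hx0.1.trans (hY0 i)) hψY
  refine ⟨Y, Y (2 * (v + 1) + Λ), ⟨hmono, hleft, hright, hx0.1, hYE _, fun i => ?_⟩, fun c => ?_⟩
  · refine partialSups_le e _ _ fun j hj => ?_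
    have hb0 : x0 ≤ m (SA σ2 μ v Y i) + η := by
      have h1 : SA σ2 μ v Y i ≤ sf σ2 μ x0 := avg_le fun k _ =>
        sf_anti hσ hμ hx0.1 (le_avg fun k _ => hY0 _)
      have := hs.anti.antitoneOn (Set.mem_Ioi.2 (hSpos i)) (Set.mem_Ioi.2 (sf_pos hσ hμ hx0.1)) h1
      linarith
    simp only [he]; split_ifs with h
    · refine max_le hb0 ?_
      rw [hψS]
      refine hm _ _ ?_ (hP0.SAle hσ hμ i) ?_
      · exact ha.trans ((sf_anti hσ hμ (hx0.1.trans hP0.x01) (hYE _)).trans (hP0.SAge hσ hμ i))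
      · have h1 := hSc ⟨j - 2 * (v + 1), by omega⟩
        have h2 := hP0.SAanti hσ hμ (show j - 2 * (v + 1) + (v + 2) ≤ i by omega)
        simp only at h1
        linarith
    · exact hb0
  · have h1 := hSc c
    have h2 := hP0.SAge hσ hμ (c + (v + 2))
    linarith

/-- comparison of the band matrix with the window averages -/
lemma band_bound {E σ2 μ ρ : ℝ} (hσ : 0 < σ2) (hμ : 0 < μ) (hE : 0 ≤ E) {v Λ : ℕ} (hΛ : 2 ≤ Λ)
    (hρ0 : 0 ≤ ρ) (hρ1 : ρ ≤ 1) (ψ : Fin Λ → ℝ) (hψ0 : ∀ c, 0 ≤ ψ c) (hψE : ∀ c, ψ c ≤ E)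
    (Y : ℕ → ℝ) (hY0 : ∀ i, 0 ≤ Y i) (hY : ∀ c : Fin Λ, ψ c ≤ Y (c + 2 * (v + 1))) (c : Fin Λ) :
    SA σ2 μ v Y (c + (v + 2)) - ρ * (1 / σ2 + 2 * μ * E / σ2 ^ 2) ≤
      ∑ r : Fin (Λ + (v + 1) - 1), baseW (v + 1) Λ ρ r c /
        (σ2 + μ * ∑ c' : Fin Λ, baseW (v + 1) Λ ρ r c' * ψ c') := by
  have hΛ1 : (1 : ℝ) ≤ (Λ : ℝ) - 1 := by
    have : (2 : ℝ) ≤ Λ := by exact_mod_cast hΛ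
    linarith
  have hv : (0 : ℝ) < (v : ℝ) + 1 := by positivity
  have hq : 0 ≤ ρ / ((Λ : ℝ) - 1) := div_nonneg hρ0 (by linarith)
  have hp : 0 ≤ (1 - ρ) / ((v : ℝ) + 1) := div_nonneg (by linarith) hv.le
  have hW0 : ∀ r c, 0 ≤ baseW (v + 1) Λ ρ r c := fun r c => by
    unfold baseW; push_cast; split_ifs
    · exact hp
    · exact hq
  have hav0 : ∀ r, 0 ≤ avg v Y r := fun r => le_avg fun k _ => hY0 _
  -- row bound
  have hγ : ∀ r : Fin (Λ + (v + 1) - 1),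
      ∑ c' : Fin Λ, baseW (v + 1) Λ ρ r c' * ψ c' ≤ avg v Y (r + (v + 2)) + 2 * ρ * E := by
    intro r
    have h1 : ∀ c' : Fin Λ, baseW (v + 1) Λ ρ r c' * ψ c' ≤
        (if c'.val ≤ r.val ∧ r.val < c'.val + (v + 1) then Y (c' + 2 * (v + 1)) / ((v : ℝ) + 1) else 0)
          + ρ / ((Λ : ℝ) - 1) * E := by
      intro c'
      have hb : ρ / ((Λ : ℝ) - 1) * ψ c' ≤ ρ / ((Λ : ℝ) - 1) * E := mul_le_mul_of_nonneg_left (hψE c') hq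
      unfold baseW; push_cast; split_ifs
      · have h2 : (1 - ρ) / ((v : ℝ) + 1) * ψ c' ≤ 1 / ((v : ℝ) + 1) * Y (c' + 2 * (v + 1)) := by
          have := hY c'
          have := hψ0 c'
          gcongr
          linarith
        have h3 : 0 ≤ ρ / ((Λ : ℝ) - 1) * E := mul_nonneg hq hE
        rw [one_div_mul_eq_div] at h2
        linarith
      · linarith
    refine (Finset.sum_le_sum fun c' _ => h1 c').trans ?_
    rw [Finset.sum_add_distrib]
    refine add_le_add ?_ ?_
    · rw [← Finset.sum_filter, ← Finset.sum_div]
      unfold avg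
      refine div_le_div_of_nonneg_right ?_ hv.le
      rw [← Finset.sum_image (f := Y) (g := fun c' : Fin Λ => (c' : ℕ) + 2 * (v + 1))
        (fun x _ y _ h => by simp only at h; ext; omega)]
      have h4 : ∑ k ∈ Finset.range (v + 1), Y (↑r + (v + 2) + k) =
          ∑ j ∈ Finset.Ico (↑r + (v + 2)) (↑r + (v + 2) + (v + 1)), Y j := by
        rw [Finset.sum_Ico_eq_sum_range]; simp
      rw [h4]
      refine Finset.sum_le_sum_of_subset_of_nonneg (fun j hj => ?_) fun _ _ _ => hY0 _
      simp only [Finset.mem_image, Finset.mem_filter, Finset.mem_univ, true_and] at hj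
      obtain ⟨c', hc, rfl⟩ := hj
      simp only [Finset.mem_Ico]
      omega
    · rw [Finset.sum_const, Finset.card_univ, Fintype.card_fin, nsmul_eq_mul]
      have h5 : (Λ : ℝ) ≤ 2 * ((Λ : ℝ) - 1) := by linarith
      calc (Λ : ℝ) * (ρ / ((Λ : ℝ) - 1) * E) ≤ 2 * ((Λ : ℝ) - 1) * (ρ / ((Λ : ℝ) - 1) * E) := by gcongr
        _ = 2 * ρ * E := by
          have : (Λ : ℝ) - 1 ≠ 0 := by linarith
          field_simp
  have hγ0 : ∀ r : Fin (Λ + (v + 1) - 1), 0 ≤ ∑ c' : Fin Λ, baseW (v + 1) Λ ρ r c' * ψ c' :=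
    fun r => Finset.sum_nonneg fun c' _ => mul_nonneg (hW0 r c') (hψ0 c')
  -- per-row lower bound
  have hrow : ∀ r : Fin (Λ + (v + 1) - 1), sf σ2 μ (avg v Y (r + (v + 2))) - 2 * ρ * μ * E / σ2 ^ 2 ≤
      (σ2 + μ * ∑ c' : Fin Λ, baseW (v + 1) Λ ρ r c' * ψ c')⁻¹ := by
    intro r
    have hd : 0 ≤ 2 * ρ * E := by positivity
    have h1 : sf σ2 μ (avg v Y (r + (v + 2)) + 2 * ρ * E) ≤
        (σ2 + μ * ∑ c' : Fin Λ, baseW (v + 1) Λ ρ r c' * ψ c')⁻¹ := sf_anti hσ hμ (hγ0 r) (hγ r)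
    have h2 := sf_sub hσ hμ (hav0 (r + (v + 2))) (add_nonneg (hav0 (r + (v + 2))) hd)
    have h3 := sf_le hσ hμ (hav0 (r + (v + 2)))
    have h4 := sf_le hσ hμ (add_nonneg (hav0 (r + (v + 2))) hd)
    have h5 := sf_pos hσ hμ (hav0 (r + (v + 2)))
    have h6 := sf_pos hσ hμ (add_nonneg (hav0 (r + (v + 2))) hd)
    have h7 : μ * (avg v Y (r + (v + 2)) + 2 * ρ * E - avg v Y (r + (v + 2))) *
        (sf σ2 μ (avg v Y (r + (v + 2))) * sf σ2 μ (avg v Y (r + (v + 2)) + 2 * ρ * E)) ≤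
        μ * (2 * ρ * E) * (σ2⁻¹ * σ2⁻¹) := by
      rw [add_sub_cancel_left]
      gcongr
    have h8 : μ * (2 * ρ * E) * (σ2⁻¹ * σ2⁻¹) = 2 * ρ * μ * E / σ2 ^ 2 := by field_simp
    linarith
  -- column sum
  set φ : Fin (Λ + (v + 1) - 1) → ℝ := fun r => σ2 + μ * ∑ c' : Fin Λ, baseW (v + 1) Λ ρ r c' * ψ c' with hφ
  have hφ0 : ∀ r, 0 < φ r := fun r => den_pos hσ hμ (hγ0 r)
  have hinj : ∀ k ∈ Finset.range (v + 1), (c : ℕ) + k < Λ + (v + 1) - 1 := fun k hk => by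
    simp only [Finset.mem_range] at hk; have := c.2; omega
  set d := 2 * ρ * μ * E / σ2 ^ 2 with hd
  have hd0 : 0 ≤ d := by positivity
  have hcol : (1 - ρ) * (SA σ2 μ v Y (c + (v + 2)) - d) ≤ ∑ r, baseW (v + 1) Λ ρ r c / φ r := by
    have e1 : (1 - ρ) * (SA σ2 μ v Y (c + (v + 2)) - d) = ∑ k ∈ (Finset.range (v + 1)).attach,
        (1 - ρ) / ((v : ℝ) + 1) * (sf σ2 μ (avg v Y (c + k.1 + (v + 2))) - d) := by
      rw [Finset.sum_attach (Finset.range (v + 1)) (fun k => (1 - ρ) / ((v : ℝ) + 1) *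
        (sf σ2 μ (avg v Y (c + k + (v + 2))) - d)), ← Finset.mul_sum, Finset.sum_sub_distrib]
      unfold SA
      have e2 : ∀ k, (c : ℕ) + k + (v + 2) = c + (v + 2) + k := fun k => by ring
      simp only [e2]
      rw [avg]
      simp only [Finset.sum_const, Finset.card_range, nsmul_eq_mul]
      push_cast
      field_simp
    rw [e1]
    have e3 : ∀ k ∈ (Finset.range (v + 1)).attach,
        (1 - ρ) / ((v : ℝ) + 1) * (sf σ2 μ (avg v Y (c + k.1 + (v + 2))) - d) ≤
        (fun r => baseW (v + 1) Λ ρ r c / φ r) ⟨c + k.1, hinj k.1 k.2⟩ := by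
      intro k _
      have hk := Finset.mem_range.1 k.2
      simp only
      have e4 : baseW (v + 1) Λ ρ ⟨c + k.1, hinj k.1 k.2⟩ c = (1 - ρ) / ((v : ℝ) + 1) := by
        unfold baseW; push_cast; rw [if_pos (by simp; omega)]
      rw [e4, div_eq_mul_inv _ (φ _)]
      exact mul_le_mul_of_nonneg_left (hrow ⟨c + k.1, hinj k.1 k.2⟩) hp
    refine (Finset.sum_le_sum e3).trans ?_
    rw [← Finset.sum_image (f := fun r => baseW (v + 1) Λ ρ r c / φ r)
      (g := fun k : {x // x ∈ Finset.range (v + 1)} =>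
        (⟨c + k.1, hinj k.1 k.2⟩ : Fin (Λ + (v + 1) - 1)))
      (fun x _ y _ h => by simp only [Fin.mk.injEq] at h; ext; omega)]
    exact Finset.sum_le_sum_of_subset_of_nonneg (Finset.subset_univ _)
      fun r _ _ => div_nonneg (hW0 r c) (hφ0 r).le
  have hSA1 : SA σ2 μ v Y (c + (v + 2)) ≤ σ2⁻¹ := avg_le fun k _ => sf_le hσ hμ (hav0 _)
  have h9 : ρ * SA σ2 μ v Y (c + (v + 2)) ≤ ρ * σ2⁻¹ := mul_le_mul_of_nonneg_left hSA1 hρ0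
  have h10 : 0 ≤ ρ * d := mul_nonneg hρ0 hd0
  have h11 : ρ * (1 / σ2 + 2 * μ * E / σ2 ^ 2) = ρ * σ2⁻¹ + d := by rw [hd]; field_simp
  rw [h11]
  linarith

lemma sc_fp (B : ℕ) [NeZero B] {E : ℝ} {I : ℝ → ℝ}
    (hs : MIsys E (fun s => mmseFn B E s⁻¹) I) {σ2 μ : ℝ} (hσ : 0 < σ2) (hμ : 0 < μ) {R C : ℕ}
    (W : Fin R → Fin C → ℝ) (hW : ∀ r c, 0 ≤ W r c) (hWp : ∀ c, ∃ r, 0 < W r c) (τ : Fin C → ℝ)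
    (hτ : ∀ c, Tendsto (fun t => scτ B R C E σ2 μ W t c) atTop (nhds (τ c))) :
    ∃ ψ : Fin C → ℝ, (∀ c, 0 ≤ ψ c) ∧ (∀ c, ψ c ≤ E) ∧ (∀ c, 0 < τ c) ∧
      (∀ c, ψ c = mmseFn B E ((τ c)⁻¹)⁻¹) ∧
      ∀ c, (τ c)⁻¹ = ∑ r, W r c / (σ2 + μ * ∑ c', W r c' * ψ c') := by
  have hE : 0 ≤ E := (hs.nn 1 one_pos).trans (hs.le 1 one_pos)
  set T : (Fin C → ℝ) → Fin C → ℝ := fun ψ c => ∑ r, W r c / (σ2 + μ * ∑ c', W r c' * ψ c') with hT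
  have hden : ∀ ψ : Fin C → ℝ, (∀ c, 0 ≤ ψ c) → ∀ r, σ2 ≤ σ2 + μ * ∑ c', W r c' * ψ c' := by
    intro ψ h r
    have : 0 ≤ ∑ c', W r c' * ψ c' := Finset.sum_nonneg fun c' _ => mul_nonneg (hW r c') (h c')
    have := mul_nonneg hμ.le this
    linarith
  have hTpos : ∀ ψ : Fin C → ℝ, (∀ c, 0 ≤ ψ c) → ∀ c, 0 < T ψ c := by
    intro ψ h c
    obtain ⟨r0, hr0⟩ := hWp c
    exact Finset.sum_pos' (fun r _ => div_nonneg (hW r c) (hσ.le.trans (hden ψ h r)))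
      ⟨r0, Finset.mem_univ _, div_pos hr0 (hσ.trans_le (hden ψ h r0))⟩
  have hψ : ∀ t c, 0 ≤ scψ B R C E σ2 μ W t c ∧ scψ B R C E σ2 μ W t c ≤ E := by
    intro t
    induction t with
    | zero => intro c; simp only [scψ]; exact ⟨hE, le_rfl⟩
    | succ t ih =>
      intro c
      have hp := hTpos _ (fun c => (ih c).1) c
      simp only [scψ]
      exact ⟨hs.nn _ hp, hs.le _ hp⟩
  have hτT : ∀ t c, scτ B R C E σ2 μ W t c = (T (scψ B R C E σ2 μ W t) c)⁻¹ := fun t c => rfl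
  have hsucc : ∀ t c, scψ B R C E σ2 μ W (t + 1) c = mmseFn B E (T (scψ B R C E σ2 μ W t) c)⁻¹ :=
    fun t c => by simp only [scψ, hT]
  have hτpos : ∀ c, 0 < τ c := by
    intro c
    have hup : ∀ t, T (scψ B R C E σ2 μ W t) c ≤ ∑ r, W r c / σ2 := fun t =>
      Finset.sum_le_sum fun r _ =>
        div_le_div_of_nonneg_left (hW r c) hσ (hden _ (fun c => (hψ t c).1) r)
    have hsp : 0 < ∑ r, W r c / σ2 := (hTpos _ (fun c => (hψ 0 c).1) c).trans_le (hup 0)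
    refine lt_of_lt_of_le (inv_pos.2 hsp) (ge_of_tendsto' (hτ c) fun t => ?_)
    rw [hτT]
    exact inv_anti₀ (hTpos _ (fun c => (hψ t c).1) c) (hup t)
  have hTlim : ∀ c, Tendsto (fun t => T (scψ B R C E σ2 μ W t) c) atTop (nhds (τ c)⁻¹) := by
    intro c
    have := (hτ c).inv₀ (hτpos c).ne'
    refine this.congr fun t => ?_
    rw [hτT, inv_inv]
  have hψlim : ∀ c, Tendsto (fun t => scψ B R C E σ2 μ W (t + 1) c) atTop
      (nhds (mmseFn B E ((τ c)⁻¹)⁻¹)) := by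
    intro c
    have := (hs.cont.tendsto (τ c)⁻¹).comp (hTlim c)
    refine this.congr fun t => ?_
    rw [hsucc]; rfl
  have h0 : ∀ c, 0 ≤ mmseFn B E ((τ c)⁻¹)⁻¹ := fun c =>
    ge_of_tendsto' (hψlim c) fun t => (hψ _ c).1
  refine ⟨fun c => mmseFn B E ((τ c)⁻¹)⁻¹, h0,
    fun c => le_of_tendsto' (hψlim c) fun t => (hψ _ c).2, hτpos, fun c => rfl, fun c => ?_⟩
  refine tendsto_nhds_unique ((hTlim c).comp (tendsto_add_atTop_nat 1)) ?_
  refine tendsto_finsetSum _ fun r _ => ?_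
  refine Tendsto.div tendsto_const_nhds ?_ (hσ.trans_le (hden _ h0 r)).ne'
  refine tendsto_const_nhds.add (tendsto_const_nhds.mul ?_)
  exact tendsto_finsetSum _ fun c' _ => tendsto_const_nhds.mul (hψlim c')

/-- threshold saturation: for every `ε > 0` there are `ω₀, Λ₀, ρ₀` such
that for all `(ω, Λ, ρ)` base matrices with `ω > ω₀`, `Λ > Λ₀`, `Λ ≥ 2ω − 1`, `0 ≤ ρ < ρ₀`,
the fixed points of the spatially coupled state evolution (with `μ_inner = ϑμ`,
`ϑ = 1 + (ω−1)/Λ`) satisfy `max_c τ_c^{SC-FP} ≤ σ² + ϑμ(max 𝓜(ϑμ, σ²) + ε)`. -/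
theorem stmt4 (B : ℕ) [NeZero B] (hB : 2 ≤ B) (E σ2 μ : ℝ)
    (hE : 0 < E) (hσ : 0 < σ2) (hμ : 0 < μ) :
    ∀ ε > (0 : ℝ), ∃ (ω₀ Λ₀ : ℕ) (ρ₀ : ℝ), 0 < ρ₀ ∧
      ∀ (ω Λ : ℕ) (ρ : ℝ), ω₀ < ω → Λ₀ < Λ → 2 * ω - 1 ≤ Λ → 0 ≤ ρ → ρ < ρ₀ →
        (minSet B E ((1 + ((ω : ℝ) - 1) / Λ) * μ) σ2).Nonempty ∧
        ∀ τFP : Fin Λ → ℝ,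
          (∀ c, Tendsto
            (fun t => scτ B (Λ + ω - 1) Λ E σ2 ((1 + ((ω : ℝ) - 1) / Λ) * μ)
              (baseW ω Λ ρ) t c) atTop (nhds (τFP c))) →
          ∀ c, τFP c ≤ σ2 + (1 + ((ω : ℝ) - 1) / Λ) * μ *
            (sSup (minSet B E ((1 + ((ω : ℝ) - 1) / Λ) * μ) σ2) + ε) := by
  intro ε hε
  set m : ℝ → ℝ := fun s => mmseFn B E s⁻¹ with hm
  set I : ℝ → ℝ := fun s => miFn B E s⁻¹ with hI
  have hs : MIsys E m I := mi_sys B hB hE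
  have hpot : ∀ μ' x, potF B E μ' σ2 x = FF I σ2 μ' x := fun μ' x => by
    simp only [potF, FF, kk, sf, hI, inv_inv]
  have hMS : ∀ μ', minSet B E μ' σ2 = MS I E σ2 μ' := fun μ' => by
    simp only [minSet, MS, hpot]
  simp only [hMS]
  obtain ⟨θ, hθ, δA, hδA, hA⟩ := caseA hs hσ hμ (half_pos hε)
  set K : ℕ := 2 + ⌈1 / θ⌉₊ with hK
  obtain ⟨α, hα, δB, hδB, hBB⟩ := caseB hs hσ hμ K (half_pos hε)
  set δ := min δA δB with hδd
  have hδ : 0 < δ := lt_min hδA hδB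
  have hδ1 : δ ≤ δA := min_le_left _ _
  have hδ2 : δ ≤ δB := min_le_right _ _
  set η := min α (δ * σ2) with hηd
  have hη : 0 < η := by positivity
  have hη1 : η ≤ α := min_le_left _ _
  have hη2 : η ≤ δ * σ2 := min_le_right _ _
  set a := (σ2 + 2 * μ * E)⁻¹ with had
  have ha : 0 < a := by positivity
  obtain ⟨κ0, hκ0, hun⟩ := unif_m (b := σ2⁻¹) hs ha hη
  set D := σ2 + 2 * μ * E with hD
  have hDp : 0 < D := by positivity
  set d := μ * (ε / 2) with hdd
  have hd : 0 < d := by positivity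
  set κ1 := d / (D * (D + d)) with hκOne
  have hκ1 : 0 < κ1 := by positivity
  set Ck := 1 / σ2 + 4 * μ * E / σ2 ^ 2 with hCk
  have hCkp : 0 < Ck := by positivity
  refine ⟨max 8 ⌈E / (σ2 * δ)⌉₊, 2, min (1 / 2) (min κ0 κ1 / Ck), by positivity, ?_⟩
  intro ω Λ ρ hω hΛ hωΛ hρ0 hρ
  have hω8 : 8 < ω := (le_max_left _ _).trans_lt hω
  have hωc : ⌈E / (σ2 * δ)⌉₊ < ω := (le_max_right _ _).trans_lt hω
  obtain ⟨v, rfl⟩ : ∃ v, ω = v + 1 := ⟨ω - 1, by omega⟩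
  have hρh : ρ < 1 / 2 := hρ.trans_le (min_le_left _ _)
  have hρk : ρ * Ck < min κ0 κ1 := by
    have := hρ.trans_le (min_le_right _ _)
    rwa [lt_div_iff₀ hCkp] at this
  have hΛp : (0 : ℝ) < Λ := by exact_mod_cast (by omega : 0 < Λ)
  have hvΛ : (v : ℝ) ≤ Λ := by exact_mod_cast (by omega : v ≤ Λ)
  set t : ℝ := 1 + (((v + 1 : ℕ) : ℝ) - 1) / Λ with ht
  have ht' : t = 1 + (v : ℝ) / Λ := by rw [ht]; push_cast; ring
  have hvd : 0 ≤ (v : ℝ) / Λ := by positivity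
  have hvd1 : (v : ℝ) / Λ ≤ 1 := by rw [div_le_one hΛp]; exact hvΛ
  have ht1 : 1 ≤ t := by linarith
  have ht2 : t ≤ 2 := by linarith
  set μ' := t * μ with hμ'd
  have hμ1 : μ ≤ μ' := le_mul_of_one_le_left hμ.le ht1
  have hμ2 : μ' ≤ 2 * μ := by rw [hμ'd]; gcongr
  have hμ' : 0 < μ' := hμ.trans_le hμ1
  refine ⟨MS_nonempty hs hσ hμ', fun τ hτ c => ?_⟩
  have hM := MS_sSup_mem hs hσ hμ'
  have hMm := MS_le_m hs hσ hμ' hM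
  set M := sSup (MS I E σ2 μ') with hMd
  have hvp : (0 : ℝ) < (v : ℝ) + 1 := by positivity
  obtain ⟨ψ, hψ0, hψE, hτp, hψτ, hτS⟩ := sc_fp B hs hσ hμ' (baseW (v + 1) Λ ρ)
    (fun r c => by
      unfold baseW; split_ifs
      · exact div_nonneg (by linarith) (by positivity)
      · refine div_nonneg hρ0 ?_
        have : (2 : ℝ) < Λ := by exact_mod_cast hΛ
        linarith)
    (fun c => ⟨⟨c, by have := c.2; omega⟩, by
      unfold baseW; rw [if_pos (by simp)]
      exact div_pos (by linarith) (by positivity)⟩) τ hτ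
  set κ := ρ * (1 / σ2 + 2 * μ' * E / σ2 ^ 2) with hκ
  have hκC : κ ≤ ρ * Ck := by
    rw [hκ, hCk]
    have : 2 * μ' * E ≤ 4 * μ * E := by nlinarith
    gcongr
  have hκ0' : κ ≤ κ0 := by linarith [min_le_left κ0 κ1]
  have hκ1' : κ ≤ κ1 := by linarith [min_le_right κ0 κ1]
  obtain ⟨Y, x1, hP, hx1S⟩ := prof_exists (v := v) (a := a) (κ := κ) (η := η) hs hσ hμ' hM.1 hMm
    ψ (fun c => (τ c)⁻¹) hψE hη.le
    (fun Y hY0 hY c => by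
      have := band_bound hσ hμ' hE.le (by omega) hρ0 (by linarith) ψ hψ0 hψE Y hY0 hY c
      rw [← hτS c] at this
      exact this)
    hψτ (sf_ge hσ hμ hμ1 hμ2 hE.le le_rfl) (hun κ hκ0')
  have hx10 : 0 ≤ x1 := hP.xnonneg.trans hP.x01
  have hen := hP.energy hs hσ hμ' hη.le
  have hen2 : FF I σ2 μ' x1 ≤ FF I σ2 μ' M + δ := by
    have h1 : E / (((v : ℝ) + 1) * σ2) ≤ δ := by
      have h2 : E / (σ2 * δ) ≤ (v : ℝ) + 1 := by
        refine (Nat.le_ceil _).trans ?_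
        exact_mod_cast hωc.le
      rw [div_le_iff₀ (by positivity)] at h2 ⊢
      linarith
    have h3 : η / σ2 ≤ δ := by rw [div_le_iff₀ hσ]; exact hη2
    linarith
  have hx1 : x1 ≤ M + ε / 2 := by
    rcases le_or_gt t (1 + θ) with h | h
    · exact hA t ht1 h x1 ⟨hx10, hP.xleE⟩ (by linarith)
    · refine hBB μ' v _ M x1 η Y hμ1 hμ2 hP (by omega) hη1 ?_ (by linarith)
      have h1 : θ < (v : ℝ) / Λ := by linarith
      rw [lt_div_iff₀ hΛp] at h1
      have h2 : (Λ : ℝ) ≤ 1 / θ * (v + 1) := by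
        rw [div_mul_eq_mul_div, le_div_iff₀ hθ]; linarith
      have h3 : (Λ : ℝ) ≤ (⌈1 / θ⌉₊ : ℝ) * (v + 1) :=
        h2.trans (mul_le_mul_of_nonneg_right (Nat.le_ceil _) hvp.le)
      have h4 : Λ ≤ ⌈1 / θ⌉₊ * (v + 1) := by exact_mod_cast h3
      rw [hK, add_mul]
      omega
  -- conclude
  have hS := hx1S c
  set T := σ2 + μ' * x1 with hT
  have hTp : 0 < T := den_pos hσ hμ' hx10
  have hTD : T ≤ D := by
    have := hP.xleE
    rw [hT, hD]; gcongr
  have h5 : (T + d)⁻¹ ≤ (τ c)⁻¹ := by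
    refine le_trans ?_ hS
    have h6 : κ1 ≤ d / (T * (T + d)) := by rw [hκOne]; gcongr
    have h7 : sf σ2 μ' x1 - (T + d)⁻¹ = d / (T * (T + d)) := by
      have h8 : sf σ2 μ' x1 = T⁻¹ := rfl
      have : T + d ≠ 0 := by positivity
      rw [h8]; field_simp; ring
    linarith
  have h9 : τ c ≤ T + d := (inv_le_inv₀ (by positivity) (hτp c)).1 h5
  have h10 : μ' * x1 ≤ μ' * (M + ε / 2) := mul_le_mul_of_nonneg_left hx1 hμ'.le
  have h11 : d ≤ μ' * (ε / 2) := mul_le_mul_of_nonneg_right hμ1 (by positivity)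
  calc τ c ≤ T + d := h9
    _ ≤ σ2 + μ' * (M + ε) := by rw [hT]; linarith

end
end

section
/- Let B ≥ 2 be an integer and E > 0. Suppose x ∈ ℝ^B has exactly one nonzero entry, equal to √E, at index j*. Suppose v ∈ ℝ^B has nonnegative entries summing to √E. Define the hard-decision vector x̂ ∈ ℝ^B by x̂_j = √E if v_j > v_i for all i ≠ j, and x̂_j = 0 otherwise. If x̂ ≠ x, then ‖v − x‖² ≥ E/4. Consequently, if x ∈ ℝ^{LB} has L sections each with exactly one nonzero entry equal to √E, and v ∈ ℝ^{LB} has L sections each with nonnegative entries summing to √E, and x̂ is formed by applying the hard decision section by section, then (1/L) Σ_{ℓ=1}^L 1{x̂ restricted to section ℓ ≠ x restricted to section ℓ} ≤ (4/(L·E)) ‖v − x‖². -/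
open scoped Classical

open Real

noncomputable section

/-- The section-wise hard decision on `ℝ^B`: `√E` at a coordinate that is strictly
larger than all others, `0` elsewhere. -/
def hardDec (B : ℕ) (E : ℝ) (v : Fin B → ℝ) : Fin B → ℝ :=
  fun j => if ∀ i : Fin B, i ≠ j → v i < v j then sqrt E else 0

theorem sec_bound (B : ℕ) (E : ℝ) (hE : 0 < E) (x v : Fin B → ℝ) (jstar : Fin B)
    (hx : x jstar = sqrt E) (hx0 : ∀ i, i ≠ jstar → x i = 0)
    (hv : ∀ i, 0 ≤ v i) (hs : ∑ i, v i = sqrt E)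
    (hne : hardDec B E v ≠ x) : E / 4 ≤ ∑ i, (v i - x i) ^ 2 := by
  have h1 : ∃ i, i ≠ jstar ∧ v jstar ≤ v i := by
    by_contra hcon
    push Not at hcon
    apply hne
    funext j
    unfold hardDec
    by_cases hj : j = jstar
    · subst hj
      rw [if_pos hcon, hx]
    · rw [hx0 j hj, if_neg]
      intro h
      exact lt_asymm (h jstar (Ne.symm hj)) (hcon j hj)
  obtain ⟨i, hi, hle⟩ := h1
  have h2 : v i + v jstar ≤ sqrt E := by
    rw [← hs, ← Finset.sum_pair hi]
    exact Finset.sum_le_sum_of_subset_of_nonneg (Finset.subset_univ _) (fun k _ _ => hv k)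
  have h3 : (v jstar - x jstar) ^ 2 ≤ ∑ i, (v i - x i) ^ 2 :=
    Finset.single_le_sum (f := fun i => (v i - x i) ^ 2) (fun k _ => sq_nonneg _)
      (Finset.mem_univ jstar)
  refine le_trans ?_ h3
  rw [hx]
  have h4 := Real.sq_sqrt hE.le
  have h5 := Real.sqrt_nonneg E
  nlinarith

/-- if `x` has a single nonzero entry `√E` and `v` has nonnegative
entries summing to `√E`, then a hard-decision error implies `‖v − x‖² ≥ E/4`;
consequently, section by section, the UER is at most `(4/(L·E))‖v − x‖²`. -/
theorem stmt6 (B : ℕ) (hB : 2 ≤ B) (E : ℝ) (hE : 0 < E) :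
    (∀ (x v : Fin B → ℝ) (jstar : Fin B),
      x jstar = sqrt E → (∀ i, i ≠ jstar → x i = 0) →
      (∀ i, 0 ≤ v i) → (∑ i, v i = sqrt E) →
      hardDec B E v ≠ x → E / 4 ≤ ∑ i, (v i - x i) ^ 2) ∧
    (∀ (L : ℕ), 0 < L → ∀ (x v : Fin L × Fin B → ℝ),
      (∀ ℓ : Fin L, ∃ jstar : Fin B, x (ℓ, jstar) = sqrt E ∧
        ∀ b, b ≠ jstar → x (ℓ, b) = 0) →
      (∀ ℓ b, 0 ≤ v (ℓ, b)) → (∀ ℓ : Fin L, ∑ b : Fin B, v (ℓ, b) = sqrt E) →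
      (L : ℝ)⁻¹ * (∑ ℓ : Fin L,
          if (fun b => hardDec B E (fun b' => v (ℓ, b')) b) ≠ (fun b => x (ℓ, b))
          then (1 : ℝ) else 0) ≤
        4 / (L * E) * ∑ j : Fin L × Fin B, (v j - x j) ^ 2) := by
  refine ⟨fun x v j h1 h2 h3 h4 h5 => sec_bound B E hE x v j h1 h2 h3 h4 h5, ?_⟩
  intro L hL x v hx hv hs
  have hL' : (0 : ℝ) < L := by exact_mod_cast hL
  have key : (∑ ℓ : Fin L,
          if (fun b => hardDec B E (fun b' => v (ℓ, b')) b) ≠ (fun b => x (ℓ, b))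
          then (1 : ℝ) else 0) ≤ 4 / E * ∑ j : Fin L × Fin B, (v j - x j) ^ 2 := by
    rw [Fintype.sum_prod_type, Finset.mul_sum]
    refine Finset.sum_le_sum fun ℓ _ => ?_
    split_ifs with h
    · obtain ⟨j, hj, hj0⟩ := hx ℓ
      have := sec_bound B E hE (fun b => x (ℓ, b)) (fun b => v (ℓ, b)) j hj hj0 (hv ℓ) (hs ℓ) h
      rw [div_mul_eq_mul_div, le_div_iff₀ hE]
      linarith
    · exact mul_nonneg (by positivity) (Finset.sum_nonneg fun _ _ => sq_nonneg _)
  calc _ ≤ (L : ℝ)⁻¹ * (4 / E * ∑ j : Fin L × Fin B, (v j - x j) ^ 2) :=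
        mul_le_mul_of_nonneg_left key (by positivity)
    _ = _ := by field_simp

end
end

section
/- Let B ≥ 2 be an integer, E_b > 0, N₀ > 0, μ > 0, and set E = E_b log₂ B, σ² = N₀/2. Fix δ̃ ∈ (0, 1) and g ∈ (0, 1), and suppose the minimum mean squared error function satisfies the lower bound: for every τ > 0 with E/τ < (2 − δ̃) ln B, one has mmse(1/τ) > (1 − g)E. Define the state evolution sequence ψ⁰ = E, τᵗ = σ² + μψᵗ, ψᵗ⁺¹ = mmse(1/τᵗ). If μ log₂ B > (1/(2(1 − g))) · ( 1/((1 − δ̃/2) ln 2) − N₀/E_b ), then E/τᵗ < (2 − δ̃) ln B for all t ≥ 0. -/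
open MeasureTheory ProbabilityTheory Real Filter

noncomputable section

/-- State evolution sequence `ψᵗ`. -/
def seψ (B : ℕ) [NeZero B] (E σ2 μ : ℝ) : ℕ → ℝ
  | 0 => E
  | t + 1 => mmseFn B E (σ2 + μ * seψ B E σ2 μ t)

/-- State evolution sequence `τᵗ = σ² + μψᵗ`. -/
def seτ (B : ℕ) [NeZero B] (E σ2 μ : ℝ) (t : ℕ) : ℝ := σ2 + μ * seψ B E σ2 μ t

/-- with `E = E_b log₂ B` and `σ² = N₀/2`, if the MMSE lower bound
`mmse(1/τ) > (1−g)E` holds whenever `E/τ < (2−δ̃) ln B`, and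
`μ log₂ B > (1/(2(1−g)))(1/((1−δ̃/2) ln 2) − N₀/E_b)`, then the state evolution
satisfies `E/τᵗ < (2−δ̃) ln B` for all `t ≥ 0`. -/
theorem stmt10 (B : ℕ) [NeZero B] (hB : 2 ≤ B) (Eb N0 μ : ℝ)
    (hEb : 0 < Eb) (hN0 : 0 < N0) (hμ : 0 < μ)
    (δt g : ℝ) (hδt : 0 < δt) (hδt1 : δt < 1) (hg : 0 < g) (hg1 : g < 1)
    (hmmse : ∀ τ : ℝ, 0 < τ →
      Eb * Real.logb 2 B / τ < (2 - δt) * Real.log B →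
      (1 - g) * (Eb * Real.logb 2 B) < mmseFn B (Eb * Real.logb 2 B) τ)
    (hcond : μ * Real.logb 2 B >
      1 / (2 * (1 - g)) * (1 / ((1 - δt / 2) * Real.log 2) - N0 / Eb)) :
    ∀ t : ℕ, Eb * Real.logb 2 B / seτ B (Eb * Real.logb 2 B) (N0 / 2) μ t <
      (2 - δt) * Real.log B := by
  have hB1 : (1 : ℝ) < B := by exact_mod_cast hB
  have hlB : 0 < Real.log B := Real.log_pos hB1
  have hl2 : 0 < Real.log 2 := Real.log_pos (by norm_num)
  have hL : 0 < Real.logb 2 B := Real.logb_pos (by norm_num) hB1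
  have hLeq : Real.logb 2 B * Real.log 2 = Real.log B := by
    rw [Real.logb]; field_simp
  have hE : 0 < Eb * Real.logb 2 B := mul_pos hEb hL
  have hg' : 0 < 1 - g := by linarith
  have hd : 0 < 1 - δt / 2 := by linarith
  have key : ∀ ψ : ℝ, (1 - g) * (Eb * Real.logb 2 B) < ψ →
      0 < N0 / 2 + μ * ψ ∧
      Eb * Real.logb 2 B / (N0 / 2 + μ * ψ) < (2 - δt) * Real.log B := by
    intro ψ hψ
    have hψ0 : 0 < ψ := lt_trans (mul_pos hg' hE) hψ
    have hτ : 0 < N0 / 2 + μ * ψ := by positivity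
    refine ⟨hτ, ?_⟩
    have hD : 0 < (1 - δt / 2) * Real.log 2 := mul_pos hd hl2
    have h1 : 1 / ((1 - δt / 2) * Real.log 2) - N0 / Eb
        < μ * Real.logb 2 B * (2 * (1 - g)) := by
      have h := hcond
      rw [gt_iff_lt, one_div_mul_eq_div, div_lt_iff₀ (by positivity)] at h
      exact h
    have h2 : 1 / ((1 - δt / 2) * Real.log 2)
        < μ * Real.logb 2 B * (2 * (1 - g)) + N0 / Eb := by linarith
    rw [div_lt_iff₀ hD] at h2
    have h3 : Eb < (μ * (Eb * Real.logb 2 B) * (2 * (1 - g)) + N0) *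
        ((1 - δt / 2) * Real.log 2) := by
      have h := mul_lt_mul_of_pos_left h2 hEb
      have e : Eb * ((μ * Real.logb 2 B * (2 * (1 - g)) + N0 / Eb) *
          ((1 - δt / 2) * Real.log 2)) =
          (μ * (Eb * Real.logb 2 B) * (2 * (1 - g)) + N0) *
          ((1 - δt / 2) * Real.log 2) := by field_simp
      rw [e, mul_one] at h
      exact h
    have h4 : μ * (Eb * Real.logb 2 B) * (2 * (1 - g)) + N0 < 2 * (N0 / 2 + μ * ψ) := by
      have := mul_lt_mul_of_pos_left hψ hμ
      linarith
    have h5 := h3.trans (mul_lt_mul_of_pos_right h4 hD)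
    have h6 := mul_lt_mul_of_pos_right h5 hL
    rw [div_lt_iff₀ hτ, ← hLeq]
    linarith
  have main : ∀ t : ℕ, (1 - g) * (Eb * Real.logb 2 B)
      < seψ B (Eb * Real.logb 2 B) (N0 / 2) μ t := by
    intro t
    induction t with
    | zero =>
      have := mul_pos hg hE
      simp only [seψ]
      linarith
    | succ t ih =>
      obtain ⟨a, b⟩ := key _ ih
      simp only [seψ]
      exact hmmse _ a b
  intro t
  exact (key _ (main t)).2

end
end

section
/- For every δ̃ ∈ (0, 1) and every δ₂ ∈ (0, √2 − √(2 − δ̃)), there exists B₀ such that for all integers B ≥ B₀ and all real a with 0 ≤ a < (2 − δ̃) ln B, the following holds: 𝔼[ Φ(√a + Z)^{B−1} ] ≤ B^{−δ₂²/2}/(δ₂ √(ln B)) + B^{−δ₂²}, where Z ~ N(0,1) and Φ is the standard normal distribution function. -/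
open MeasureTheory ProbabilityTheory Real Filter

noncomputable section

/-- The standard Gaussian measure on `ℝ`. -/
def stdGaussian : Measure ℝ := gaussianReal 0 1

/-- Standard normal distribution function `Φ`. -/
def Phi (u : ℝ) : ℝ := (stdGaussian (Set.Iic u)).toReal

lemma stdG_apply (s : Set ℝ) : stdGaussian.real s = ∫ x in s, gaussianPDFReal 0 1 x := by
  unfold _root_.stdGaussian Measure.real
  rw [gaussianReal_apply_eq_integral 0 (by norm_num) s,
    ENNReal.toReal_ofReal (setIntegral_nonneg_of_ae (by
      filter_upwards with x using gaussianPDFReal_nonneg 0 1 x))]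

lemma pdf_eq (x : ℝ) : gaussianPDFReal 0 1 x = (√(2 * π))⁻¹ * Real.exp (-x ^ 2 / 2) := by
  simp [gaussianPDFReal]

lemma sqrt2pi_ge : 1 ≤ √(2 * π) := by
  rw [Real.one_le_sqrt]
  nlinarith [Real.pi_gt_three]

lemma sqrt2pi_le : √(2 * π) ≤ 3 := by
  rw [Real.sqrt_le_left (by norm_num)]
  nlinarith [Real.pi_lt_four]

instance : IsProbabilityMeasure stdGaussian := by
  unfold _root_.stdGaussian; infer_instance

lemma tail_upper (t : ℝ) (ht : 0 < t) :
    stdGaussian.real (Set.Ioi t) ≤ Real.exp (-t ^ 2 / 2) / t := by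
  have hd : ∀ x ∈ Set.Ici t, HasDerivAt (fun x : ℝ => -(Real.exp (-x ^ 2 / 2) / t))
      (x / t * Real.exp (-x ^ 2 / 2)) x := by
    intro x _
    have h1 : HasDerivAt (fun x : ℝ => -x ^ 2 / 2) (-x) x := by
      have h0 := ((hasDerivAt_pow 2 x).neg).div_const 2
      exact h0.congr_deriv (by push_cast; ring)
    have h2 := (h1.exp.div_const t).neg
    exact h2.congr_deriv (by ring)
  have hlim : Tendsto (fun x : ℝ => -(Real.exp (-x ^ 2 / 2) / t)) atTop (nhds 0) := by
    have h1 : Tendsto (fun x : ℝ => -x ^ 2 / 2) atTop atBot := by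
      have h2 : Tendsto (fun x : ℝ => x ^ 2 / 2) atTop atTop :=
        (tendsto_pow_atTop (by norm_num)).atTop_div_const (by norm_num)
      have h3 := tendsto_neg_atTop_atBot.comp h2
      refine h3.congr (fun x => ?_)
      simp only [Function.comp]; ring
    have := ((Real.tendsto_exp_atBot.comp h1).div_const t).neg
    simpa using this
  have hpos : ∀ x ∈ Set.Ioi t, 0 ≤ x / t * Real.exp (-x ^ 2 / 2) := by
    intro x hx
    have : 0 < x := ht.trans hx
    positivity
  have hint := integrableOn_Ioi_deriv_of_nonneg' hd hpos hlim
  have hval := integral_Ioi_of_hasDerivAt_of_nonneg' hd hpos hlim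
  rw [stdG_apply]
  have : ∫ x in Set.Ioi t, gaussianPDFReal 0 1 x
      ≤ ∫ x in Set.Ioi t, x / t * Real.exp (-x ^ 2 / 2) := by
    apply setIntegral_mono_on (integrable_gaussianPDFReal 0 1).integrableOn hint measurableSet_Ioi
    intro x hx
    rw [pdf_eq]
    have h1 : (√(2 * π))⁻¹ ≤ 1 := inv_le_one_of_one_le₀ sqrt2pi_ge
    have h2 : 1 ≤ x / t := by rw [one_le_div ht]; exact le_of_lt hx
    exact mul_le_mul_of_nonneg_right (h1.trans h2) (Real.exp_pos _).le
  rw [hval] at this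
  linarith

lemma tail_lower (u : ℝ) (hu : 0 ≤ u) :
    Real.exp (-(u + 1) ^ 2 / 2) / 3 ≤ stdGaussian.real (Set.Ioi u) := by
  have h1 : stdGaussian.real (Set.Ioc u (u + 1)) ≤ stdGaussian.real (Set.Ioi u) :=
    measureReal_mono (fun x hx => hx.1)
  refine le_trans ?_ h1
  rw [stdG_apply]
  have h2 : ∫ x in Set.Ioc u (u + 1), Real.exp (-(u + 1) ^ 2 / 2) / 3
      ≤ ∫ x in Set.Ioc u (u + 1), gaussianPDFReal 0 1 x := by
    apply setIntegral_mono_on (by simp) (integrable_gaussianPDFReal 0 1).integrableOn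
      measurableSet_Ioc
    intro x hx
    rw [pdf_eq, div_eq_inv_mul]
    have h3 : (3 : ℝ)⁻¹ ≤ (√(2 * π))⁻¹ :=
      inv_anti₀ (by linarith [sqrt2pi_ge]) sqrt2pi_le
    have h4 : -(u + 1) ^ 2 / 2 ≤ -x ^ 2 / 2 := by nlinarith [hx.1, hx.2]
    exact mul_le_mul h3 (Real.exp_le_exp.2 h4) (Real.exp_pos _).le (by positivity)
  simpa using h2

lemma Phi_eq (u : ℝ) : Phi u = 1 - stdGaussian.real (Set.Ioi u) := by
  have := probReal_compl_eq_one_sub (μ := stdGaussian) (measurableSet_Ioi (a := u))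
  rw [← this, Set.compl_Ioi]
  rfl

lemma Phi_mono {u v : ℝ} (h : u ≤ v) : Phi u ≤ Phi v :=
  measureReal_mono (μ := stdGaussian) (Set.Iic_subset_Iic.2 h)

lemma Phi_nonneg (u : ℝ) : 0 ≤ Phi u := ENNReal.toReal_nonneg

lemma Phi_le_one (u : ℝ) : Phi u ≤ 1 := measureReal_le_one (μ := stdGaussian)

lemma split_bound (n : ℕ) (r t : ℝ) :
    (∫ z, Phi (r + z) ^ n ∂ stdGaussian) ≤ stdGaussian.real (Set.Ioi t) + Phi (r + t) ^ n := by
  have h1 : Integrable (fun z => (Set.Ioi t).indicator (fun _ => (1 : ℝ)) z) stdGaussian :=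
    (integrable_const _).indicator measurableSet_Ioi
  have h2 : Integrable (fun _ : ℝ => Phi (r + t) ^ n) stdGaussian := integrable_const _
  have : (∫ z, Phi (r + z) ^ n ∂ stdGaussian) ≤
      ∫ z, ((Set.Ioi t).indicator (fun _ => (1 : ℝ)) z + Phi (r + t) ^ n) ∂ stdGaussian := by
    apply integral_mono_of_nonneg
    · filter_upwards with z using pow_nonneg (Phi_nonneg _) _
    · exact h1.add h2
    · filter_upwards with z
      by_cases hz : t < z
      · have h3 : Phi (r + z) ^ n ≤ 1 := pow_le_one₀ (Phi_nonneg _) (Phi_le_one _)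
        have h4 : 0 ≤ Phi (r + t) ^ n := pow_nonneg (Phi_nonneg _) _
        simp [hz]; linarith
      · have h3 : Phi (r + z) ^ n ≤ Phi (r + t) ^ n :=
          pow_le_pow_left₀ (Phi_nonneg _) (Phi_mono (by linarith)) _
        simpa [hz] using h3
  refine this.trans (le_of_eq ?_)
  rw [integral_add h1 h2, integral_indicator measurableSet_Ioi]
  simp

lemma eventually_s (c K : ℝ) (hc0 : 0 ≤ c) (hc : c ^ 2 < 2) :
    ∀ᶠ s : ℝ in atTop, 1 ≤ s ∧ K * s ^ 2 ≤ Real.exp (s ^ 2 - (c * s + 1) ^ 2 / 2) := by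
  have h1 := (Real.tendsto_exp_div_pow_atTop 2).eventually_ge_atTop K
  have hk : 0 < 1 - c ^ 2 / 2 := by linarith
  filter_upwards [h1, eventually_ge_atTop 1, eventually_ge_atTop ((c + 2) / (1 - c ^ 2 / 2))]
    with s hs1 hs2 hs3
  refine ⟨hs2, ?_⟩
  rw [le_div_iff₀ (by positivity)] at hs1
  refine hs1.trans (Real.exp_le_exp.2 ?_)
  rw [div_le_iff₀ hk] at hs3
  nlinarith [mul_le_mul_of_nonneg_right hs3 (by linarith : (0 : ℝ) ≤ s)]

/-- for every `δ̃ ∈ (0,1)` and `δ₂ ∈ (0, √2 − √(2−δ̃))`, for all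
sufficiently large `B` and all `0 ≤ a < (2−δ̃) ln B`,
`𝔼[Φ(√a + Z)^{B−1}] ≤ B^{−δ₂²/2}/(δ₂√(ln B)) + B^{−δ₂²}`. -/
theorem stmt11 (δt δ2 : ℝ) (hδt : 0 < δt) (hδt1 : δt < 1)
    (hδ2 : 0 < δ2) (hδ2' : δ2 < Real.sqrt 2 - Real.sqrt (2 - δt)) :
    ∃ B₀ : ℕ, ∀ B : ℕ, B₀ ≤ B → ∀ a : ℝ, 0 ≤ a → a < (2 - δt) * Real.log B →
      (∫ z, Phi (Real.sqrt a + z) ^ (B - 1) ∂ stdGaussian) ≤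
        (B : ℝ) ^ (-(δ2 ^ 2) / 2) / (δ2 * Real.sqrt (Real.log B)) +
          (B : ℝ) ^ (-(δ2 ^ 2)) := by
  set c := Real.sqrt (2 - δt) + δ2 with hcdef
  have hc0 : 0 ≤ c := by positivity
  have hc2 : c ^ 2 < 2 := by
    have h1 : c < √2 := by linarith
    have h2 : √2 ^ 2 = 2 := Real.sq_sqrt (by norm_num)
    nlinarith [Real.sqrt_nonneg 2]
  have hT : Tendsto (fun B : ℕ => √(Real.log B)) atTop atTop :=
    Real.tendsto_sqrt_atTop.comp (Real.tendsto_log_atTop.comp tendsto_natCast_atTop_atTop)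
  have hev := hT.eventually (eventually_s c (6 * δ2 ^ 2) hc0 hc2)
  obtain ⟨B₀, hB₀⟩ := eventually_atTop.1 (hev.and (eventually_ge_atTop 2))
  refine ⟨B₀, fun B hB a ha haB => ?_⟩
  obtain ⟨⟨hs1, hs⟩, hB2⟩ := hB₀ B hB
  have hBr : (2 : ℝ) ≤ B := by exact_mod_cast hB2
  have hBpos : (0 : ℝ) < B := by linarith
  have hL : 0 ≤ Real.log B := Real.log_nonneg (by linarith)
  set s := √(Real.log B) with hsdef
  have hss : s ^ 2 = Real.log B := Real.sq_sqrt hL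
  have hra : √a ≤ √(2 - δt) * s := by
    rw [hsdef, ← Real.sqrt_mul (by linarith)]
    exact Real.sqrt_le_sqrt haB.le
  have ht : 0 < δ2 * s := by positivity
  refine (split_bound (B - 1) (√a) (δ2 * s)).trans (add_le_add ?_ ?_)
  · refine (tail_upper _ ht).trans (le_of_eq ?_)
    rw [Real.rpow_def_of_pos hBpos, ← hss]
    congr 2; ring
  · have hu : Phi (√a + δ2 * s) ≤ Phi (c * s) := Phi_mono (by rw [hcdef]; linarith)
    have hq := tail_lower (c * s) (by positivity)
    have hP : Phi (c * s) ≤ Real.exp (-(Real.exp (-(c * s + 1) ^ 2 / 2) / 3)) := by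
      rw [Phi_eq]
      refine le_trans ?_ (Real.add_one_le_exp _)
      linarith
    refine (pow_le_pow_left₀ (Phi_nonneg _) (hu.trans hP) _).trans ?_
    rw [← Real.exp_nat_mul, Real.rpow_def_of_pos hBpos, Real.exp_le_exp, ← hss,
      Nat.cast_sub (by omega), Nat.cast_one]
    have hB' : Real.exp (s ^ 2) = B := by rw [hss, Real.exp_log hBpos]
    have he : Real.exp (s ^ 2 - (c * s + 1) ^ 2 / 2) = B * Real.exp (-(c * s + 1) ^ 2 / 2) := by
      rw [← hB', ← Real.exp_add]; congr 1; ring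
    rw [he] at hs
    have hE := Real.exp_pos (-(c * s + 1) ^ 2 / 2)
    nlinarith

end
end

section
/- Let b > 0. The equation S = (1/2) log₂(1 + 2bS) has a solution S > 0 if and only if b > ln 2. -/
/-- for `b > 0`, the equation `S = (1/2)log₂(1 + 2bS)` has a positive
solution if and only if `b > ln 2`. -/
theorem stmt15 (b : ℝ) (hb : 0 < b) :
    (∃ S : ℝ, 0 < S ∧ S = 1 / 2 * Real.logb 2 (1 + 2 * b * S)) ↔ Real.log 2 < b := by
  have hL : 0 < Real.log 2 := Real.log_pos (by norm_num)
  have key : ∀ S : ℝ, S = 1 / 2 * Real.logb 2 (1 + 2 * b * S) ↔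
      Real.log (1 + 2 * b * S) - 2 * S * Real.log 2 = 0 := by
    intro S
    rw [Real.logb]
    generalize Real.log (1 + 2 * b * S) = y
    constructor
    · intro h
      rw [h]
      field_simp
      ring
    · intro h
      field_simp
      linarith
  simp only [key]
  generalize Real.log 2 = L at hL
  constructor
  · rintro ⟨S, hS, h⟩
    have hx : 0 < 2 * b * S := by positivity
    have h1 := Real.log_lt_sub_one_of_pos (x := 1 + 2 * b * S) (by linarith) (by linarith)
    have h2 : L * S < b * S := by linarith
    exact lt_of_mul_lt_mul_right h2 hS.le
  · intro h
    have hS1 : 0 < (b / L - 1) / (2 * b) := by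
      have : 1 < b / L := (one_lt_div hL).2 h
      apply div_pos <;> linarith
    have hle : (b / L - 1) / (2 * b) ≤ b / L ^ 2 := by
      rw [div_le_div_iff₀ (by positivity) (by positivity)]
      have : (b / L - 1) * L ^ 2 = b * L - L ^ 2 := by field_simp
      rw [this]
      nlinarith
    have hc : ContinuousOn (fun S : ℝ => Real.log (1 + 2 * b * S) - 2 * S * L)
        (Set.Icc ((b / L - 1) / (2 * b)) (b / L ^ 2)) := by
      apply ContinuousOn.sub
      · apply ContinuousOn.log (by fun_prop)
        intro x hx
        have : 0 < x := lt_of_lt_of_le hS1 hx.1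
        positivity
      · fun_prop
    have hmem : (0 : ℝ) ∈ Set.Icc (Real.log (1 + 2 * b * (b / L ^ 2)) - 2 * (b / L ^ 2) * L)
        (Real.log (1 + 2 * b * ((b / L - 1) / (2 * b))) - 2 * ((b / L - 1) / (2 * b)) * L) := by
      constructor
      · have h1 := Real.quadratic_le_exp_of_nonneg (x := 2 * (b / L ^ 2) * L) (by positivity)
        have h2 : 1 + 2 * b * (b / L ^ 2) ≤ Real.exp (2 * (b / L ^ 2) * L) := by
          refine le_trans ?_ h1
          have h3 : (2 * (b / L ^ 2) * L) ^ 2 / 2 = 2 * b * (b / L ^ 2) := by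
            field_simp
          have h4 : 0 ≤ 2 * (b / L ^ 2) * L := by positivity
          linarith
        have h5 := (Real.log_le_iff_le_exp (by positivity)).2 h2
        linarith
      · have h1 : 1 + 2 * b * ((b / L - 1) / (2 * b)) = b / L := by
          field_simp
          ring
        have h2 : 2 * ((b / L - 1) / (2 * b)) * L = 1 - (b / L)⁻¹ := by
          field_simp
        rw [h1, h2]
        have := Real.one_sub_inv_le_log_of_pos (x := b / L) (by positivity)
        linarith
    obtain ⟨S, hS, h0⟩ := intermediate_value_Icc' hle hc hmem
    exact ⟨S, lt_of_lt_of_le hS1 hS.1, h0⟩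
end

section
/- Let B ≥ 2 be an integer and E > 0. For s > 0 define J(s) = Es + ln B − 𝔼 ln[ exp(Es + √(Es) Z₁) + Σ_{j=2}^B exp(√(Es) Z_j) ] and M(s) = E · (1 − 𝔼[ exp(√(Es) Z₁) / ( exp(√(Es) Z₁) + exp(−Es) Σ_{j=2}^B exp(√(Es) Z_j) ) ]), where Z₁, …, Z_B are i.i.d. standard Gaussian. Then J is differentiable on (0, ∞) and J′(s) = (1/2) M(s) for all s > 0. -/
open MeasureTheory ProbabilityTheory Real Filter

noncomputable section

/-- The mutual information `J(s) = I(X; √s X + Z)` for `X ~ p₁`, as a function of the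
signal-to-noise ratio `s`. -/
def Jfun (B : ℕ) [NeZero B] (E s : ℝ) : ℝ :=
  E * s + Real.log B - ∫ z, Real.log (exp (E * s + sqrt (E * s) * z 0) +
      ∑ j ∈ Finset.univ.erase (0 : Fin B), exp (sqrt (E * s) * z j)) ∂ gaussPi B

/-- The MMSE `M(s) = 𝔼‖X − 𝔼[X | √s X + Z]‖²` for `X ~ p₁`, as a function of the
signal-to-noise ratio `s`. -/
def Mfun (B : ℕ) [NeZero B] (E s : ℝ) : ℝ :=
  E * (1 - ∫ z, exp (sqrt (E * s) * z 0) /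
      (exp (sqrt (E * s) * z 0) +
        exp (-(E * s)) * ∑ j ∈ Finset.univ.erase (0 : Fin B), exp (sqrt (E * s) * z j))
    ∂ gaussPi B)

instance gaussPi_prob (B : ℕ) : IsProbabilityMeasure (gaussPi B) := by
  unfold gaussPi; infer_instance

/-- The shift vector. -/
def shiftv {B : ℕ} (k : Fin B) (t : ℝ) : Fin B → ℝ := fun i => if i = k then t else 0

lemma gauss_shift (t : ℝ) : gaussianReal t 1 =
    (gaussianReal 0 1).withDensity (fun x => ENNReal.ofReal (exp (t * x - t ^ 2 / 2))) := by
  rw [gaussianReal_of_var_ne_zero _ one_ne_zero, gaussianReal_of_var_ne_zero _ one_ne_zero,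
    ← withDensity_mul _ (measurable_gaussianPDF _ _) (by fun_prop)]
  congr 1
  ext x
  simp only [gaussianPDF, Pi.mul_apply]
  rw [← ENNReal.ofReal_mul (gaussianPDFReal_nonneg _ _ _)]
  congr 1
  simp only [gaussianPDFReal]
  rw [mul_assoc (√(2 * π * ((1 : NNReal) : ℝ)))⁻¹, ← Real.exp_add]
  congr 2
  simp
  ring

lemma pi_withDensity_aux {B : ℕ} (f : Fin B → ℝ → ENNReal) (hf : ∀ i, Measurable (f i))
    [∀ i, SigmaFinite ((gaussianReal 0 1).withDensity (f i))] :
    Measure.pi (fun i => (gaussianReal 0 1).withDensity (f i)) =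
      (gaussPi B).withDensity (fun z => ∏ i, f i (z i)) := by
  refine Measure.pi_eq fun s hs => ?_
  rw [withDensity_apply _ (MeasurableSet.univ_pi hs), ← lintegral_indicator (MeasurableSet.univ_pi hs)]
  have h1 : ∀ z : Fin B → ℝ, (Set.univ.pi s).indicator (fun z => ∏ i, f i (z i)) z =
      ∏ i, (s i).indicator (f i) (z i) := by
    intro z
    by_cases hz : z ∈ Set.univ.pi s
    · rw [Set.indicator_of_mem hz]
      refine Finset.prod_congr rfl fun i _ => ?_
      rw [Set.indicator_of_mem (hz i (Set.mem_univ _))]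
    · rw [Set.indicator_of_notMem hz]
      simp only [Set.mem_pi, not_forall] at hz
      obtain ⟨i, _, hi⟩ := hz
      exact (Finset.prod_eq_zero (Finset.mem_univ i) (Set.indicator_of_notMem hi _)).symm
  simp_rw [h1]
  have hm : ∀ i, Measurable ((s i).indicator (f i)) := fun i => (hf i).indicator (hs i)
  have := lintegral_prod_eq_prod_lintegral_of_indepFun (μ := gaussPi B) Finset.univ
    (fun i (z : Fin B → ℝ) => (s i).indicator (f i) (z i))
    (iIndepFun_pi (fun i => (hm i).aemeasurable)) (fun i => (hm i).comp (measurable_pi_apply i))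
  rw [this]
  refine Finset.prod_congr rfl fun i _ => ?_
  rw [withDensity_apply _ (hs i), ← lintegral_indicator (hs i)]
  have h2 := (measurePreserving_eval (fun _ : Fin B => gaussianReal 0 1) i).lintegral_comp (hm i)
  exact h2

lemma gaussPi_map_shift {B : ℕ} (k : Fin B) (t : ℝ) :
    (gaussPi B).map (fun z => z + shiftv k t) =
      (gaussPi B).withDensity (fun z => ENNReal.ofReal (exp (t * z k - t ^ 2 / 2))) := by
  have h1 : (gaussPi B).map (fun z => z + shiftv k t) =
      Measure.pi (fun i => (gaussianReal 0 1).map (fun x => x + shiftv k t i)) := by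
    have : ∀ i, IsProbabilityMeasure ((gaussianReal 0 1).map (fun x => x + shiftv k t i)) :=
      fun i => Measure.isProbabilityMeasure_map (by fun_prop)
    exact Measure.pi_map_pi (μ := fun _ : Fin B => gaussianReal 0 1)
      (f := fun i x => x + shiftv k t i) (fun i => by fun_prop)
  have h2 : ∀ i, (gaussianReal 0 1).map (fun x => x + shiftv k t i) =
      (gaussianReal 0 1).withDensity
        ((fun (i : Fin B) (x : ℝ) => if i = k then ENNReal.ofReal (exp (t * x - t ^ 2 / 2)) else 1) i) := by
    intro i
    rw [gaussianReal_map_add_const]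
    by_cases h : i = k
    · simp [h, shiftv, gauss_shift t]
    · have : (fun _ : ℝ => (1 : ENNReal)) = 1 := rfl
      simp [h, shiftv, this, withDensity_one]
  have h3 : ∀ i, SigmaFinite ((gaussianReal 0 1).withDensity
        ((fun (i : Fin B) (x : ℝ) => if i = k then ENNReal.ofReal (exp (t * x - t ^ 2 / 2)) else 1) i)) := by
    intro i
    rw [← h2, gaussianReal_map_add_const]; infer_instance
  rw [h1]
  simp_rw [h2]
  rw [pi_withDensity_aux]
  · congr 1
    ext z
    simp
  · intro i
    by_cases h : i = k
    · simp only [h, if_true]; fun_prop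
    · simp only [h, if_false]; fun_prop

lemma shift_emb {B : ℕ} (c : Fin B → ℝ) : MeasurableEmbedding (fun z : Fin B → ℝ => z + c) :=
  (MeasurableEquiv.addRight c).measurableEmbedding

lemma integral_tilt {B : ℕ} (k : Fin B) (t : ℝ) (f : (Fin B → ℝ) → ℝ) :
    ∫ z, f (z + shiftv k t) ∂gaussPi B = ∫ z, exp (t * z k - t ^ 2 / 2) * f z ∂gaussPi B := by
  rw [← (shift_emb _).integral_map (g := f), gaussPi_map_shift,
    integral_withDensity_eq_integral_toReal_smul (by fun_prop) (by simp)]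
  simp [ENNReal.toReal_ofReal, (exp_pos _).le]

lemma integrable_tilt {B : ℕ} (k : Fin B) (t : ℝ) (f : (Fin B → ℝ) → ℝ) :
    Integrable (fun z => f (z + shiftv k t)) (gaussPi B) ↔
      Integrable (fun z => exp (t * z k - t ^ 2 / 2) * f z) (gaussPi B) := by
  rw [show (fun z => f (z + shiftv k t)) = f ∘ (fun z => z + shiftv k t) from rfl,
    ← (shift_emb _).integrable_map_iff, gaussPi_map_shift,
    integrable_withDensity_iff_integrable_smul' (by fun_prop) (by simp)]
  simp [ENNReal.toReal_ofReal, (exp_pos _).le]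

lemma integrable_coord {B : ℕ} (i : Fin B) : Integrable (fun z => z i) (gaussPi B) :=
  integrable_eval (μ := fun _ : Fin B => gaussianReal 0 1)
    (memLp_one_iff_integrable.1 (memLp_id_gaussianReal 1))

lemma integral_coord {B : ℕ} (i : Fin B) : ∫ z, z i ∂gaussPi B = 0 := by
  have := integral_eval (μ := fun _ : Fin B => gaussianReal 0 1) (i := i)
  unfold gaussPi
  rw [this]; simp

/-- Weighted average. -/
def hfun {B : ℕ} (t : ℝ) (z : Fin B → ℝ) : ℝ := (∑ j, exp (t * z j) * z j) / ∑ j, exp (t * z j)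

lemma sum_exp_pos {B : ℕ} [NeZero B] (a : Fin B → ℝ) : 0 < ∑ j, exp (a j) :=
  Finset.sum_pos (fun _ _ => exp_pos _) ⟨0, Finset.mem_univ _⟩

lemma wavg_bound {B : ℕ} [NeZero B] (a b : Fin B → ℝ) :
    |(∑ j, exp (a j) * b j) / ∑ j, exp (a j)| ≤ ∑ j, |b j| := by
  rw [abs_div, abs_of_pos (sum_exp_pos a), div_le_iff₀ (sum_exp_pos a)]
  refine (Finset.abs_sum_le_sum_abs _ _).trans ?_
  rw [Finset.sum_mul]
  refine Finset.sum_le_sum fun j _ => ?_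
  rw [abs_mul, abs_of_pos (exp_pos _), mul_comm]
  exact mul_le_mul_of_nonneg_left
    (Finset.single_le_sum (f := fun j => exp (a j)) (fun i _ => (exp_pos _).le) (Finset.mem_univ j))
    (abs_nonneg _)

lemma integrable_h_shift {B : ℕ} [NeZero B] (k : Fin B) (t : ℝ) :
    Integrable (fun z => hfun t (z + shiftv k t)) (gaussPi B) := by
  have hb : Integrable (fun z : Fin B → ℝ => ∑ j, |z j + shiftv k t j|) (gaussPi B) :=
    integrable_finsetSum _ fun j _ => ((integrable_coord j).add (integrable_const _)).abs
  refine hb.mono' ?_ (ae_of_all _ fun z => ?_)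
  · unfold hfun
    apply Measurable.aestronglyMeasurable
    fun_prop
  · exact wavg_bound _ _

lemma h_symm {B : ℕ} (k l : Fin B) (t : ℝ) :
    ∫ z, hfun t (z + shiftv k t) ∂gaussPi B = ∫ z, hfun t (z + shiftv l t) ∂gaussPi B := by
  have hp := measurePreserving_piCongrLeft (fun _ : Fin B => gaussianReal 0 1) (Equiv.swap k l)
  have := hp.integral_comp' (fun z : Fin B → ℝ => hfun t (z + shiftv l t))
  unfold gaussPi
  rw [← this]
  congr 1
  ext z
  have key : ∀ j, (MeasurableEquiv.piCongrLeft (fun _ : Fin B => ℝ) (Equiv.swap k l)) z j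
      = z (Equiv.swap k l j) := by
    intro j
    have := Equiv.piCongrLeft_apply_apply (fun _ : Fin B => ℝ) (Equiv.swap k l) z (Equiv.swap k l j)
    simp only [Equiv.swap_apply_self] at this
    exact this
  have ks : ∀ j, shiftv l t j = shiftv k t (Equiv.swap k l j) := by
    intro j
    unfold shiftv
    congr 1
    rw [Equiv.swap_apply_eq_iff, Equiv.swap_apply_left]
  unfold hfun
  simp only [Pi.add_apply, key, ks]
  rw [Equiv.sum_comp (Equiv.swap k l) (fun j => exp (t * (z j + shiftv k t j)) * (z j + shiftv k t j)),
    Equiv.sum_comp (Equiv.swap k l) (fun j => exp (t * (z j + shiftv k t j)))]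

lemma h_integral {B : ℕ} [NeZero B] (k : Fin B) (t : ℝ) :
    ∫ z, hfun t (z + shiftv k t) ∂gaussPi B = t := by
  have hB : (0 : ℝ) < B := by exact_mod_cast Nat.pos_of_ne_zero (NeZero.ne B)
  have h1 : ∑ l : Fin B, ∫ z, hfun t (z + shiftv l t) ∂gaussPi B =
      B * ∫ z, hfun t (z + shiftv k t) ∂gaussPi B := by
    rw [Finset.sum_congr rfl fun l _ => h_symm l k t]; simp
  have h2 : ∀ l : Fin B, Integrable (fun z => exp (t * z l - t ^ 2 / 2) * z l) (gaussPi B) := by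
    intro l
    rw [← integrable_tilt l t (fun z => z l)]
    exact (integrable_coord l).add (integrable_const _)
  have h3 : ∀ l : Fin B, ∫ z, exp (t * z l - t ^ 2 / 2) * z l ∂(gaussPi B) = t := by
    intro l
    rw [← integral_tilt l t (fun z => z l)]
    simp only [Pi.add_apply]
    rw [integral_add (integrable_coord l) (integrable_const _), integral_coord]
    simp [shiftv]
  have h4 : ∑ l : Fin B, ∫ z, hfun t (z + shiftv l t) ∂gaussPi B = B * t := by
    simp_rw [integral_tilt]
    rw [← integral_finsetSum _ (fun l _ => (integrable_tilt l t _).1 (integrable_h_shift l t))]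
    have : ∀ z : Fin B → ℝ, ∑ l, exp (t * z l - t ^ 2 / 2) * hfun t z =
        ∑ l, exp (t * z l - t ^ 2 / 2) * z l := by
      intro z
      have hS := sum_exp_pos (fun j => t * z j)
      simp only [Real.exp_sub, div_mul_eq_mul_div]
      rw [← Finset.sum_div, ← Finset.sum_div, ← Finset.sum_mul]
      unfold hfun
      rw [mul_div_cancel₀ _ hS.ne']
    simp_rw [this]
    rw [integral_finsetSum _ (fun l _ => h2 l)]
    simp [h3]
  rw [h1] at h4
  exact mul_left_cancel₀ hB.ne' h4

/-- The log-partition function, in the parameter `t = √(E s)`. -/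
def Lfun {B : ℕ} [NeZero B] (t : ℝ) (z : Fin B → ℝ) : ℝ :=
  Real.log (∑ j, exp (t * (z j + shiftv 0 t j)))

/-- The posterior probability of the true index. -/
def pfun {B : ℕ} [NeZero B] (t : ℝ) (z : Fin B → ℝ) : ℝ :=
  exp (t * (z 0 + t)) / ∑ j, exp (t * (z j + shiftv 0 t j))

/-- Derivative of `Lfun`. -/
def Dfun {B : ℕ} [NeZero B] (t : ℝ) (z : Fin B → ℝ) : ℝ :=
  (∑ j, exp (t * (z j + shiftv 0 t j)) * (z j + 2 * shiftv 0 t j)) /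
    ∑ j, exp (t * (z j + shiftv 0 t j))

lemma L_deriv {B : ℕ} [NeZero B] (t : ℝ) (z : Fin B → ℝ) :
    HasDerivAt (fun t => Lfun t z) (Dfun t z) t := by
  unfold Lfun Dfun
  refine HasDerivAt.log ?_ (sum_exp_pos _).ne'
  refine HasDerivAt.fun_sum fun j _ => ?_
  refine HasDerivAt.exp ?_
  unfold shiftv
  by_cases h : j = 0
  · simp only [h, if_true]
    have := (hasDerivAt_id t).mul ((hasDerivAt_id t).const_add (z 0))
    refine HasDerivAt.congr_deriv (f' := 1 * (z 0 + id t) + id t * 1) this ?_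
    simp only [id]; ring
  · simp only [h, if_false]
    have := (hasDerivAt_id t).mul_const (z j + 0)
    refine HasDerivAt.congr_deriv (f' := 1 * (z j + 0)) this ?_
    ring

lemma D_eq {B : ℕ} [NeZero B] (t : ℝ) (z : Fin B → ℝ) :
    Dfun t z = hfun t (z + shiftv 0 t) + t * pfun t z := by
  unfold Dfun hfun pfun
  simp only [Pi.add_apply]
  rw [← mul_div_assoc, ← add_div]
  congr 1
  have : ∑ j, exp (t * (z j + shiftv 0 t j)) * shiftv 0 t j = t * exp (t * (z 0 + t)) := by
    rw [Finset.sum_eq_single 0]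
    · simp [shiftv, mul_comm]
    · intro b _ hb; simp [shiftv, hb]
    · simp
  rw [← this, ← Finset.sum_add_distrib]
  exact Finset.sum_congr rfl fun j _ => by ring

lemma L_bound {B : ℕ} [NeZero B] (a : Fin B → ℝ) :
    |Real.log (∑ j, exp (a j))| ≤ Real.log B + ∑ j, |a j| := by
  have hB : (1 : ℝ) ≤ B := by exact_mod_cast Nat.pos_of_ne_zero (NeZero.ne B)
  have hl : ∀ j, |a j| ≤ ∑ j, |a j| := fun j =>
    Finset.single_le_sum (f := fun j => |a j|) (fun i _ => abs_nonneg _) (Finset.mem_univ j)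
  have hlog := Real.log_nonneg hB
  rw [abs_le]
  constructor
  · rw [Real.le_log_iff_exp_le (sum_exp_pos a)]
    refine le_trans ?_ (Finset.single_le_sum (f := fun j => exp (a j)) (fun i _ => (exp_pos _).le)
      (Finset.mem_univ 0))
    rw [exp_le_exp]
    have := hl 0
    have := neg_abs_le (a 0)
    linarith
  · rw [Real.log_le_iff_le_exp (sum_exp_pos a), Real.exp_add, Real.exp_log (by linarith)]
    calc ∑ j, exp (a j) ≤ ∑ j : Fin B, exp (∑ j, |a j|) :=
          Finset.sum_le_sum fun j _ => exp_le_exp.2 ((le_abs_self _).trans (hl j))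
      _ = _ := by simp

lemma L_meas {B : ℕ} [NeZero B] (t : ℝ) : Measurable (fun z : Fin B → ℝ => Lfun t z) := by
  unfold Lfun; fun_prop

lemma L_integrable {B : ℕ} [NeZero B] (t : ℝ) :
    Integrable (fun z : Fin B → ℝ => Lfun t z) (gaussPi B) := by
  have hb : Integrable (fun z : Fin B → ℝ => Real.log B + ∑ j, |t * (z j + shiftv 0 t j)|)
      (gaussPi B) :=
    (integrable_const _).add (integrable_finsetSum _ fun j _ =>
      (((integrable_coord j).add (integrable_const _)).const_mul t).abs)
  exact hb.mono' (L_meas t).aestronglyMeasurable (ae_of_all _ fun z => L_bound _)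

lemma p_integrable {B : ℕ} [NeZero B] (t : ℝ) :
    Integrable (fun z : Fin B → ℝ => pfun t z) (gaussPi B) := by
  refine (integrable_const (1 : ℝ)).mono' ?_ (ae_of_all _ fun z => ?_)
  · apply Measurable.aestronglyMeasurable
    unfold pfun; fun_prop
  · have hS := sum_exp_pos (fun j => t * (z j + shiftv 0 t j))
    unfold pfun
    rw [Real.norm_of_nonneg (div_nonneg (exp_pos _).le hS.le), div_le_one hS]
    have := Finset.single_le_sum (f := fun j => exp (t * (z j + shiftv 0 t j)))
      (fun i _ => (exp_pos _).le) (Finset.mem_univ 0)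
    simpa [shiftv] using this

lemma IL_deriv {B : ℕ} [NeZero B] (t : ℝ) :
    HasDerivAt (fun t => ∫ z : Fin B → ℝ, Lfun t z ∂gaussPi B)
      (t + t * ∫ z : Fin B → ℝ, pfun t z ∂gaussPi B) t := by
  have hb : Integrable (fun z : Fin B → ℝ => ∑ j : Fin B, (|z j| + 2 * (|t| + 1))) (gaussPi B) :=
    integrable_finsetSum _ fun j _ => (integrable_coord j).abs.add (integrable_const _)
  have := (hasDerivAt_integral_of_dominated_loc_of_deriv_le (μ := gaussPi B)
    (F := fun t z => Lfun t z) (F' := fun t z => Dfun t z) (x₀ := t) (Metric.ball_mem_nhds t one_pos)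
    (Eventually.of_forall fun x => (L_meas x).aestronglyMeasurable) (L_integrable t)
    (by
      apply Measurable.aestronglyMeasurable
      unfold Dfun; fun_prop)
    (ae_of_all _ fun z x hx => by
      refine (wavg_bound _ _).trans (Finset.sum_le_sum fun j _ => ?_)
      refine (abs_add_le _ _).trans ?_
      gcongr
      rw [abs_mul, abs_two]
      gcongr
      rw [Metric.mem_ball, Real.dist_eq] at hx
      have h1 : |x| ≤ |t| + 1 := by
        have := abs_sub_abs_le_abs_sub x t
        linarith
      unfold shiftv
      split_ifs
      · exact h1
      · rw [abs_zero]; positivity) hb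
    (ae_of_all _ fun z x _ => L_deriv x z)).2
  refine this.congr_deriv ?_
  simp_rw [D_eq]
  rw [integral_add (integrable_h_shift 0 t) ((p_integrable t).const_mul t), h_integral,
    integral_const_mul]

/-- I-MMSE relation for the prior `p₁`: `J` is differentiable on
`(0, ∞)` with `J′(s) = (1/2)M(s)`. -/
theorem stmt18 (B : ℕ) [NeZero B] (hB : 2 ≤ B) (E : ℝ) (hE : 0 < E) :
    ∀ s : ℝ, 0 < s → HasDerivAt (fun s' => Jfun B E s') (1 / 2 * Mfun B E s) s := by
  intro s hs
  have hEs : 0 < E * s := mul_pos hE hs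
  have hsplit : ∀ (u : ℝ), 0 ≤ u → ∀ z : Fin B → ℝ,
      ∑ j, exp (sqrt u * (z j + shiftv 0 (sqrt u) j)) = exp (u + sqrt u * z 0) +
        ∑ j ∈ Finset.univ.erase (0 : Fin B), exp (sqrt u * z j) := by
    intro u hu z
    rw [← Finset.add_sum_erase _ _ (Finset.mem_univ (0 : Fin B))]
    congr 1
    · simp only [shiftv, if_true]
      rw [mul_add, Real.mul_self_sqrt hu, add_comm]
    · refine Finset.sum_congr rfl fun j hj => ?_
      simp [shiftv, Finset.ne_of_mem_erase hj]
  have hJ : (fun s' => Jfun B E s') =ᶠ[nhds s] fun s' =>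
      E * s' + Real.log B - ∫ z : Fin B → ℝ, Lfun (sqrt (E * s')) z ∂gaussPi B := by
    filter_upwards [lt_mem_nhds hs] with x hx
    simp only [Jfun, Lfun, hsplit (E * x) (mul_pos hE hx).le]
  have hM : Mfun B E s = E * (1 - ∫ z : Fin B → ℝ, pfun (sqrt (E * s)) z ∂gaussPi B) := by
    unfold Mfun pfun
    congr 3
    ext z
    rw [hsplit _ hEs.le, mul_add, Real.mul_self_sqrt hEs.le, add_comm _ (E * s), Real.exp_add]
    rw [← mul_div_mul_left _ _ (exp_pos (E * s)).ne', mul_add, ← mul_assoc (exp (E * s)) (exp (-_)),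
      ← Real.exp_add (E * s) (-(E * s)), add_neg_cancel, Real.exp_zero, one_mul]
  refine HasDerivAt.congr_of_eventuallyEq ?_ hJ
  have h0 : HasDerivAt (fun x : ℝ => E * x) E s := by
    simpa using (hasDerivAt_id s).const_mul E
  have h1 := h0.sqrt hEs.ne'
  have h2 := (IL_deriv (B := B) (sqrt (E * s))).comp s h1
  have h3 := (h0.add_const (Real.log B)).sub h2
  refine h3.congr_deriv ?_
  rw [hM]
  have : sqrt (E * s) ≠ 0 := (Real.sqrt_pos.2 hEs).ne'
  field_simp
  ring

end
end
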